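/- Fix an integer k ≥ 1 and sequences of positive integers p = p(d), n = n(d) with limsup_{d→∞} max{p, n}/d^k < ∞. Let Q_k^W ∈ ℝ^{p×p} have entries (Q_k^W)_{ij} = q_k(√d·⟨w_i, w_j⟩)/√N_k and Q_k^X ∈ ℝ^{n×n} have entries (Q_k^X)_{ij} = q_k(⟨x_i, x_j⟩/√d)/√N_k. Then there exists C > 0 such that for every D > 0 there is d₀ with: for all d ≥ d₀ and all t > 0, P(‖Q_k^W‖_op ≥ C + t) ≤ (d·t)^{−D} and P(‖Q_k^X‖_op ≥ C + t) ≤ (d·t)^{−D}. Moreover, for every r > 0 there exists K > 0 such that for all d, both E[‖Q_k^W‖_op^r] ≤ K and E[‖Q_k^X‖_op^r] ≤ K. -/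

import Mathlib

/-!
Operator-norm tail bound and moment bounds for Gegenbauer kernel matrices
(Lemma "inprodmtx_opnorm_prbd").
-/

open MeasureTheory Filter

noncomputable section

/-- Uniform probability measure on the sphere of radius `r` in `ℝ^d`
(normalized `(d-1)`-dimensional Hausdorff measure). -/
def sphereUniform (d : ℕ) (r : ℝ) : Measure (EuclideanSpace ℝ (Fin d)) :=
  ((Measure.hausdorffMeasure ((d : ℝ) - 1) :
        Measure (EuclideanSpace ℝ (Fin d))) (Metric.sphere 0 r))⁻¹ •
    (Measure.hausdorffMeasure ((d : ℝ) - 1) :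
        Measure (EuclideanSpace ℝ (Fin d))).restrict (Metric.sphere 0 r)

/-- Euclidean inner product. -/
def dotp {d : ℕ} (u v : EuclideanSpace ℝ (Fin d)) : ℝ := ∑ i, u i * v i

/-- `τ_{d,1}`: distribution of `⟨x, e⟩` for `x` uniform on `S^{d-1}(√d)` and `e` a unit vector. -/
def tau1 (d : ℕ) : Measure ℝ :=
  (sphereUniform d (Real.sqrt d)).map fun x => if h : 0 < d then x ⟨0, h⟩ else 0

/-- Dimension `N_{d,k}` of the space of degree-`k` spherical harmonics in dimension `d`. -/
def sphDim (d k : ℕ) : ℕ :=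
  if k = 0 then 1
  else if k = 1 then d
  else ((d + 2 * k - 2) * Nat.choose (d + k - 3) (k - 1)) / k

/-- `q` is the degree-`k` Gegenbauer polynomial for `τ_{d,1}`: the (unique) real polynomial of
degree `k` with positive leading coefficient, unit `L²(τ_{d,1})` norm, orthogonal to all lower
degree monomials. -/
def IsGegenbauer (d k : ℕ) (q : Polynomial ℝ) : Prop :=
  q.natDegree = k ∧ 0 < q.leadingCoeff ∧
    (∫ s, q.eval s ^ 2 ∂tau1 d) = 1 ∧
    ∀ j < k, (∫ s, q.eval s * s ^ j ∂tau1 d) = 0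

/-- `ℓ² → ℓ²` operator norm of a real matrix. -/
def opNorm {n p : ℕ} (A : Matrix (Fin n) (Fin p) ℝ) : ℝ :=
  ‖LinearMap.toContinuousLinearMap (Matrix.toEuclideanLin A)‖

/-- Law of `n` i.i.d. uniform points on the sphere of radius `√d`. -/
def Xmeas (d n : ℕ) : Measure (Fin n → EuclideanSpace ℝ (Fin d)) :=
  Measure.pi fun _ => sphereUniform d (Real.sqrt d)

/-- Law of `p` i.i.d. uniform points on the unit sphere. -/
def Wmeas (d p : ℕ) : Measure (Fin p → EuclideanSpace ℝ (Fin d)) :=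
  Measure.pi fun _ => sphereUniform d 1

/-- `Q_k^W`: the matrix with entries `q_k(√d ⟨w_i, w_j⟩)/√N_k`. -/
def QWmat (d p : ℕ) (q : Polynomial ℝ) (Nk : ℕ) (w : Fin p → EuclideanSpace ℝ (Fin d)) :
    Matrix (Fin p) (Fin p) ℝ :=
  Matrix.of fun i j => q.eval (Real.sqrt d * dotp (w i) (w j)) / Real.sqrt Nk

/-- `Q_k^X`: the matrix with entries `q_k(⟨x_i, x_j⟩/√d)/√N_k`. -/
def QXmat (d n : ℕ) (q : Polynomial ℝ) (Nk : ℕ) (x : Fin n → EuclideanSpace ℝ (Fin d)) :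
    Matrix (Fin n) (Fin n) ℝ :=
  Matrix.of fun i j => q.eval (dotp (x i) (x j) / Real.sqrt d) / Real.sqrt Nk

section GramNorm

open ProbabilityTheory Topology
open scoped ENNReal NNReal

lemma pi_absolutelyContinuous (d : ℕ) {μ ν : Measure ℝ} [SigmaFinite μ] [SigmaFinite ν]
    (h : μ ≪ ν) :
    (Measure.pi fun _ : Fin d => μ) ≪ Measure.pi fun _ : Fin d => ν := by
  induction d with
  | zero =>
    rw [Measure.pi_of_empty _ (fun i => Fin.elim0 i), Measure.pi_of_empty _ (fun i => Fin.elim0 i)]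
  | succ d ih =>
    have h1 := (measurePreserving_piFinSuccAbove (fun _ : Fin (d + 1) => μ) 0).symm
    have h2 := (measurePreserving_piFinSuccAbove (fun _ : Fin (d + 1) => ν) 0).symm
    rw [← h1.map_eq, ← h2.map_eq]
    exact (h.prod ih).map h1.measurable

lemma stdGaussian_absolutelyContinuous (d : ℕ) :
    stdGaussian (EuclideanSpace ℝ (Fin d)) ≪ volume := by
  rw [← map_pi_eq_stdGaussian, ← (PiLp.volume_preserving_toLp (Fin d)).map_eq]
  exact (pi_absolutelyContinuous d (gaussianReal_absolutelyContinuous 0 one_ne_zero)).map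
    (by fun_prop)

/-- The `r`-th absolute moment root of the standard one-dimensional Gaussian. -/
def gaussMoment (r : ℝ≥0∞) : ℝ≥0∞ := eLpNorm id r (gaussianReal 0 1)

lemma gaussMoment_lt_top (r : ℕ) : gaussMoment r < ∞ := by
  have := (memLp_id_gaussianReal (μ := 0) (v := 1) (r : ℝ≥0)).2
  simpa [gaussMoment] using this

lemma map_dual_stdGaussian {E : Type*} [NormedAddCommGroup E] [InnerProductSpace ℝ E]
    [FiniteDimensional ℝ E] [MeasurableSpace E] [BorelSpace E] (L : StrongDual ℝ E) :
    (stdGaussian E).map L = (gaussianReal 0 1).map (‖L‖ * ·) := by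
  rw [IsGaussian.map_eq_gaussianReal, gaussianReal_map_const_mul, integral_strongDual_stdGaussian,
    variance_dual_stdGaussian]
  congr 1
  · simp
  · ext
    simp

lemma eLpNorm_dual_stdGaussian {E : Type*} [NormedAddCommGroup E] [InnerProductSpace ℝ E]
    [FiniteDimensional ℝ E] [MeasurableSpace E] [BorelSpace E] (L : StrongDual ℝ E) (r : ℝ≥0∞) :
    eLpNorm L r (stdGaussian E) = ‖L‖ₑ * gaussMoment r := by
  have h1 : eLpNorm (id : ℝ → ℝ) r ((stdGaussian E).map L) = eLpNorm L r (stdGaussian E) := by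
    rw [eLpNorm_map_measure (by fun_prop) (by fun_prop)]
    rfl
  have h2 : eLpNorm (id : ℝ → ℝ) r ((gaussianReal 0 1).map (‖L‖ * ·)) =
      eLpNorm (‖L‖ • (id : ℝ → ℝ)) r (gaussianReal 0 1) := by
    rw [eLpNorm_map_measure (by fun_prop) (by fun_prop)]
    rfl
  rw [← h1, map_dual_stdGaussian, h2, eLpNorm_const_smul, gaussMoment]
  simp

lemma eLpNorm_natCast_pow {α : Type*} [MeasurableSpace α] {μ : Measure α} (f : α → ℝ) {r : ℕ}
    (hr : r ≠ 0) : eLpNorm f r μ ^ r = ∫⁻ x, ‖f x‖ₑ ^ r ∂μ := by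
  have := eLpNorm_nnreal_pow_eq_lintegral (f := f) (μ := μ) (p := (r : ℝ≥0)) (by simpa)
  simpa using this

lemma maurey_pisier_step {d : ℕ} {G : EuclideanSpace ℝ (Fin d) → ℝ} {l : ℝ≥0}
    (hG : LipschitzWith l G) {r : ℕ} (hr : r ≠ 0) (N : ℕ) :
    eLpNorm (fun z : EuclideanSpace ℝ (Fin d) × EuclideanSpace ℝ (Fin d) => G z.1 - G z.2) r
      ((stdGaussian _).prod (stdGaussian _)) ≤
    eLpNorm (fun z : EuclideanSpace ℝ (Fin d) × EuclideanSpace ℝ (Fin d) =>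
      ((N : ℝ) + 1) * (G z.1 - G (Real.cos (Real.pi / 2 / (N + 1)) • z.1 +
        Real.sin (Real.pi / 2 / (N + 1)) • z.2))) r
      ((stdGaussian _).prod (stdGaussian _)) := by
  have hGc := hG.continuous
  set μ := (stdGaussian (EuclideanSpace ℝ (Fin d))).prod (stdGaussian (EuclideanSpace ℝ (Fin d)))
  set h := Real.pi / 2 / ((N : ℝ) + 1) with hh
  set D : EuclideanSpace ℝ (Fin d) × EuclideanSpace ℝ (Fin d) → ℝ :=
    fun z => G z.1 - G (Real.cos h • z.1 + Real.sin h • z.2) with hD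
  have hDm : Measurable D := by
    apply Continuous.measurable
    simp only [hD]
    fun_prop
  have hpres : ∀ θ : ℝ, MeasurePreserving (ContinuousLinearMap.rotation
      (E := EuclideanSpace ℝ (Fin d)) θ) μ μ := fun θ =>
    ⟨by fun_prop, IsGaussian.map_rotation_eq_self_of_forall_strongDual_eq_zero
      integral_strongDual_stdGaussian θ⟩
  have hsum : (fun z : EuclideanSpace ℝ (Fin d) × EuclideanSpace ℝ (Fin d) => G z.1 - G z.2) =
      ∑ j ∈ Finset.range (N + 1), D ∘ ContinuousLinearMap.rotation (j * h) := by
    ext z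
    simp only [Finset.sum_apply, Function.comp, hD, ContinuousLinearMap.rotation_apply]
    have : ∀ j : ℕ, Real.cos h • (Real.cos (j * h) • z.1 + Real.sin (j * h) • z.2) +
        Real.sin h • (-Real.sin (j * h) • z.1 + Real.cos (j * h) • z.2) =
        Real.cos ((j + 1 : ℕ) * h) • z.1 + Real.sin ((j + 1 : ℕ) * h) • z.2 := by
      intro j
      push_cast
      rw [add_mul, one_mul, Real.cos_add, Real.sin_add]
      module
    simp only [this]
    rw [Finset.sum_range_sub' (fun j : ℕ => G (Real.cos (j * h) • z.1 + Real.sin (j * h) • z.2))]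
    have hN : ((N + 1 : ℕ) : ℝ) * h = Real.pi / 2 := by
      rw [hh]; push_cast; field_simp
    rw [hN]
    simp
  rw [hsum]
  refine (eLpNorm_sum_le (fun i _ => ?_) (by exact_mod_cast Nat.one_le_iff_ne_zero.2 hr)).trans ?_
  · exact (hDm.comp (hpres _).measurable).aestronglyMeasurable
  · simp only [eLpNorm_comp_measurePreserving hDm.aestronglyMeasurable (hpres _)]
    have : (fun z => ((N : ℝ) + 1) * D z) = ((N : ℝ) + 1) • D := rfl
    change _ ≤ eLpNorm (fun z => ((N : ℝ) + 1) * D z) r μ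
    rw [this, eLpNorm_const_smul, Finset.sum_const, Finset.card_range, nsmul_eq_mul]
    gcongr
    rw [Real.enorm_of_nonneg (by positivity), ENNReal.ofReal_add (by positivity) (by norm_num)]
    simp

lemma lipschitz_rotation_bound {E : Type*} [NormedAddCommGroup E] [NormedSpace ℝ E] {G : E → ℝ}
    {l : ℝ≥0} (hG : LipschitzWith l G) (N : ℕ) (x y : E) :
    |((N : ℝ) + 1) * (G x - G (Real.cos (Real.pi / 2 / (N + 1)) • x +
        Real.sin (Real.pi / 2 / (N + 1)) • y))| ≤ 2 * l * (‖x‖ + ‖y‖) := by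
  set h := Real.pi / 2 / ((N : ℝ) + 1) with hh
  have hpos : 0 < h := by positivity
  have hNh : ((N : ℝ) + 1) * h = Real.pi / 2 := by rw [hh]; field_simp
  have hh2 : h ≤ 2 := by
    have h1 : (1 : ℝ) * h ≤ ((N : ℝ) + 1) * h := by
      gcongr
      linarith [(Nat.cast_nonneg N : (0 : ℝ) ≤ N)]
    linarith [Real.pi_le_four]
  have h1 : |G x - G (Real.cos h • x + Real.sin h • y)| ≤ l * (h * (‖x‖ + ‖y‖)) := by
    have := hG.dist_le_mul x (Real.cos h • x + Real.sin h • y)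
    rw [Real.dist_eq] at this
    refine this.trans ?_
    gcongr
    rw [dist_eq_norm, show x - (Real.cos h • x + Real.sin h • y) =
      (1 - Real.cos h) • x - Real.sin h • y by module]
    refine (norm_sub_le _ _).trans ?_
    rw [norm_smul, norm_smul, mul_add, Real.norm_eq_abs, Real.norm_eq_abs]
    gcongr
    · rw [abs_of_nonneg (by linarith [Real.cos_le_one h])]
      nlinarith [Real.one_sub_sq_div_two_le_cos (x := h)]
    · exact Real.abs_sin_le_abs.trans (abs_of_pos hpos).le
  rw [abs_mul, abs_of_nonneg (by positivity : (0 : ℝ) ≤ (N : ℝ) + 1)]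
  calc _ ≤ ((N : ℝ) + 1) * (l * (h * (‖x‖ + ‖y‖))) := by gcongr
    _ = (((N : ℝ) + 1) * h) * (l * (‖x‖ + ‖y‖)) := by ring
    _ ≤ 2 * (l * (‖x‖ + ‖y‖)) := by
      rw [hNh]; gcongr; linarith [Real.pi_le_four]
    _ = _ := by ring

lemma tendsto_rotation_diff {E : Type*} [NormedAddCommGroup E] [NormedSpace ℝ E] {G : E → ℝ}
    {x : E} (hG : DifferentiableAt ℝ G x) (y : E) :
    Tendsto (fun N : ℕ => ((N : ℝ) + 1) * (G x - G (Real.cos (Real.pi / 2 / (N + 1)) • x +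
        Real.sin (Real.pi / 2 / (N + 1)) • y))) atTop
      (𝓝 (-(Real.pi / 2 * fderiv ℝ G x y))) := by
  have hd : HasDerivAt (fun t : ℝ => G (Real.cos t • x + Real.sin t • y)) (fderiv ℝ G x y) 0 := by
    have h1 : HasDerivAt (fun t : ℝ => Real.cos t • x + Real.sin t • y) y 0 := by
      have := ((Real.hasDerivAt_cos 0).smul_const x).fun_add
        ((Real.hasDerivAt_sin 0).smul_const y)
      simpa using this
    have h2 : HasFDerivAt G (fderiv ℝ G x) (Real.cos 0 • x + Real.sin 0 • y) := by
      simpa using hG.hasFDerivAt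
    exact h2.comp_hasDerivAt 0 h1
  have hs := hd.tendsto_slope_zero
  have hlim : Tendsto (fun N : ℕ => Real.pi / 2 / ((N : ℝ) + 1)) atTop (𝓝[≠] 0) := by
    refine tendsto_nhdsWithin_iff.2 ⟨?_, Eventually.of_forall fun N => ?_⟩
    · have := (tendsto_one_div_add_atTop_nhds_zero_nat (𝕜 := ℝ)).const_mul (Real.pi / 2)
      simpa [div_eq_mul_inv] using this
    · have : 0 < Real.pi / 2 / ((N : ℝ) + 1) := by positivity
      exact this.ne'
  have := ((hs.comp hlim).const_mul (Real.pi / 2)).neg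
  refine this.congr fun N => ?_
  have hpi := Real.pi_pos
  simp only [Function.comp, zero_add, smul_eq_mul, Real.cos_zero, Real.sin_zero, one_smul,
    zero_smul, add_zero]
  field_simp
  ring

/-- Maurey–Pisier inequality: moments of `G X - G Y` for independent Gaussian `X`, `Y` and
Lipschitz `G`. -/
lemma maurey_pisier {d : ℕ} {G : EuclideanSpace ℝ (Fin d) → ℝ} {l : ℝ≥0}
    (hG : LipschitzWith l G) {r : ℕ} (hr : r ≠ 0) :
    eLpNorm (fun z : EuclideanSpace ℝ (Fin d) × EuclideanSpace ℝ (Fin d) => G z.1 - G z.2) r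
      ((stdGaussian _).prod (stdGaussian _)) ≤ 2 * l * gaussMoment r := by
  set γ := stdGaussian (EuclideanSpace ℝ (Fin d))
  have hpow : eLpNorm (fun z : EuclideanSpace ℝ (Fin d) × EuclideanSpace ℝ (Fin d) =>
      G z.1 - G z.2) r (γ.prod γ) ^ r ≤
      ∫⁻ z, ‖-(Real.pi / 2 * fderiv ℝ G z.1 z.2)‖ₑ ^ r ∂(γ.prod γ) := by
    have hGc := hG.continuous
    have hbd : MemLp (fun z : EuclideanSpace ℝ (Fin d) × EuclideanSpace ℝ (Fin d) =>
        2 * (l : ℝ) * (‖z.1‖ + ‖z.2‖)) r (γ.prod γ) := by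
      have h0 : MemLp (fun x : EuclideanSpace ℝ (Fin d) => ‖x‖) r γ :=
        (IsGaussian.memLp_id γ r (by simp)).norm
      exact ((h0.comp_measurePreserving measurePreserving_fst).add
        (h0.comp_measurePreserving measurePreserving_snd)).const_mul _
    refine ge_of_tendsto (tendsto_lintegral_of_dominated_convergence
      (bound := fun z => ‖2 * (l : ℝ) * (‖z.1‖ + ‖z.2‖)‖ₑ ^ r)
      (F := fun N : ℕ => fun z : EuclideanSpace ℝ (Fin d) × EuclideanSpace ℝ (Fin d) =>
        ‖((N : ℝ) + 1) * (G z.1 - G (Real.cos (Real.pi / 2 / (N + 1)) • z.1 +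
        Real.sin (Real.pi / 2 / (N + 1)) • z.2))‖ₑ ^ r) (fun N => ?_) (fun N => ?_) ?_ ?_)
      (Eventually.of_forall fun N => ?_)
    · apply Measurable.pow_const
      apply Measurable.enorm
      apply Continuous.measurable
      fun_prop
    · refine Eventually.of_forall fun z => ?_
      dsimp only
      gcongr
      rw [enorm_le_iff_norm_le, Real.norm_eq_abs, Real.norm_eq_abs]
      exact (lipschitz_rotation_bound hG N z.1 z.2).trans (le_abs_self _)
    · rw [← eLpNorm_natCast_pow _ hr]
      exact ENNReal.pow_ne_top hbd.2.ne
    · have h1 : ∀ᵐ x ∂γ, DifferentiableAt ℝ G x :=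
        (stdGaussian_absolutelyContinuous d).ae_le hG.ae_differentiableAt
      have h2 : ∀ᵐ z ∂(γ.prod γ), DifferentiableAt ℝ G z.1 :=
        Measure.quasiMeasurePreserving_fst.ae h1
      filter_upwards [h2] with z hz
      exact ((ENNReal.continuous_pow r).tendsto _).comp
        ((tendsto_rotation_diff hz z.2).enorm)
    · rw [← eLpNorm_natCast_pow _ hr]
      gcongr
      exact maurey_pisier_step hG hr N
  have hle : ∫⁻ z, ‖-(Real.pi / 2 * fderiv ℝ G z.1 z.2)‖ₑ ^ r ∂(γ.prod γ) ≤
      (2 * l * gaussMoment r) ^ r := by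
    refine (lintegral_prod_le _).trans ?_
    have : ∀ x, ∫⁻ y, ‖-(Real.pi / 2 * fderiv ℝ G x y)‖ₑ ^ r ∂γ ≤ (2 * l * gaussMoment r) ^ r := by
      intro x
      rw [← eLpNorm_natCast_pow (fun y => -(Real.pi / 2 * fderiv ℝ G x y)) hr]
      gcongr
      have : (fun y => -(Real.pi / 2 * fderiv ℝ G x y)) = (-(Real.pi / 2)) • ⇑(fderiv ℝ G x) := by
        ext y; simp
      rw [this, eLpNorm_const_smul, eLpNorm_dual_stdGaussian, ← mul_assoc]
      gcongr
      · rw [enorm_neg, Real.enorm_of_nonneg (by positivity)]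
        refine (ENNReal.ofReal_le_ofReal (by linarith [Real.pi_le_four] : _ ≤ (2 : ℝ))).trans ?_
        simp
      · rw [← ofReal_norm]
        refine (ENNReal.ofReal_le_ofReal (norm_fderiv_le_of_lipschitz ℝ hG)).trans ?_
        simp
    refine (lintegral_mono this).trans ?_
    simp
  exact (ENNReal.pow_le_pow_left_iff hr).1 (hpow.trans hle)

/-- A rotation invariant probability measure carried by the unit sphere. -/
structure IsSphereLaw {d : ℕ} (σ : Measure (EuclideanSpace ℝ (Fin d))) : Prop where
  prob : IsProbabilityMeasure σ
  norm_eq : ∀ᵐ x ∂σ, ‖x‖ = 1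
  map_eq : ∀ φ : EuclideanSpace ℝ (Fin d) ≃ₗᵢ[ℝ] EuclideanSpace ℝ (Fin d), σ.map φ = σ

lemma exists_isometry_map {E : Type*} [NormedAddCommGroup E] [InnerProductSpace ℝ E]
    {v w : E} (h : ‖v‖ = ‖w‖) : ∃ φ : E ≃ₗᵢ[ℝ] E, φ v = w :=
  ⟨(Submodule.span ℝ {v - w})ᗮ.reflection, Submodule.reflection_sub h⟩

namespace IsSphereLaw

variable {d : ℕ} {σ ν : Measure (EuclideanSpace ℝ (Fin d))}

lemma dim_pos (hσ : IsSphereLaw σ) : 0 < d := by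
  rcases Nat.eq_zero_or_pos d with rfl | h
  · have := hσ.prob
    obtain ⟨x, hx⟩ := hσ.norm_eq.exists
    rw [Subsingleton.elim x 0] at hx
    simp at hx
  · exact h

lemma measurePreserving (hσ : IsSphereLaw σ)
    (φ : EuclideanSpace ℝ (Fin d) ≃ₗᵢ[ℝ] EuclideanSpace ℝ (Fin d)) :
    MeasurePreserving φ σ σ := ⟨φ.continuous.measurable, hσ.map_eq φ⟩

lemma integral_comp (hσ : IsSphereLaw σ) {F : Type*} [NormedAddCommGroup F] [NormedSpace ℝ F]
    (φ : EuclideanSpace ℝ (Fin d) ≃ₗᵢ[ℝ] EuclideanSpace ℝ (Fin d))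
    (f : EuclideanSpace ℝ (Fin d) → F) : ∫ x, f (φ x) ∂σ = ∫ x, f x ∂σ :=
  (hσ.measurePreserving φ).integral_comp φ.toHomeomorph.measurableEmbedding f

lemma charFun_congr (hσ : IsSphereLaw σ) {t t' : EuclideanSpace ℝ (Fin d)} (h : ‖t‖ = ‖t'‖) :
    charFun σ t = charFun σ t' := by
  obtain ⟨φ, rfl⟩ := exists_isometry_map h
  rw [charFun_apply, charFun_apply,
    ← hσ.integral_comp φ (fun x => Complex.exp (inner ℝ x (φ t) * Complex.I))]
  simp only [LinearIsometryEquiv.inner_map_map]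

lemma unique (hσ : IsSphereLaw σ) (hν : IsSphereLaw ν) : σ = ν := by
  have := hσ.prob
  have := hν.prob
  apply Measure.ext_of_charFun
  ext t
  have h1 : charFun σ t = ∫ u, charFun σ (‖t‖ • u) ∂ν := by
    have : ∀ᵐ u ∂ν, charFun σ (‖t‖ • u) = charFun σ t := by
      filter_upwards [hν.norm_eq] with u hu
      exact hσ.charFun_congr (by simp [norm_smul, hu])
    rw [integral_congr_ae this]
    simp
  have h2 : charFun ν t = ∫ u, charFun ν (‖t‖ • u) ∂σ := by
    have : ∀ᵐ u ∂σ, charFun ν (‖t‖ • u) = charFun ν t := by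
      filter_upwards [hσ.norm_eq] with u hu
      exact hν.charFun_congr (by simp [norm_smul, hu])
    rw [integral_congr_ae this]
    simp
  rw [h1, h2]
  simp only [charFun_apply]
  rw [integral_integral_swap]
  · simp only [inner_smul_right, real_inner_comm]
  · refine Integrable.of_bound (C := 1) ?_ (Eventually.of_forall fun z => ?_)
    · apply Continuous.aestronglyMeasurable
      fun_prop
    · simp only [Function.uncurry, Complex.norm_exp_ofReal_mul_I, le_refl]

end IsSphereLaw

lemma isSphereLaw_map_stdGaussian {d : ℕ} (hd : 0 < d) :
    IsSphereLaw ((stdGaussian (EuclideanSpace ℝ (Fin d))).map fun x => ‖x‖⁻¹ • x) := by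
  have hm : Measurable fun x : EuclideanSpace ℝ (Fin d) => ‖x‖⁻¹ • x := by fun_prop
  have : Nonempty (Fin d) := ⟨⟨0, hd⟩⟩
  refine ⟨Measure.isProbabilityMeasure_map hm.aemeasurable, ?_, fun φ => ?_⟩
  · rw [ae_map_iff hm.aemeasurable (measurableSet_eq_fun (by fun_prop) (by fun_prop))]
    have : ∀ᵐ x ∂(stdGaussian (EuclideanSpace ℝ (Fin d))), x ≠ 0 := by
      refine (stdGaussian_absolutelyContinuous d).ae_le
        (?_ : ∀ᵐ x ∂(volume : Measure (EuclideanSpace ℝ (Fin d))), x ≠ 0)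
      rw [ae_iff]
      simp
    filter_upwards [this] with x hx
    simp [norm_smul, hx]
  · rw [Measure.map_map φ.continuous.measurable hm]
    conv_rhs => rw [← stdGaussian_map φ]
    rw [Measure.map_map hm φ.continuous.measurable]
    congr 1
    ext x
    simp

lemma integral_norm_sq_stdGaussian (d : ℕ) :
    ∫ y, ‖y‖ ^ 2 ∂(stdGaussian (EuclideanSpace ℝ (Fin d))) = d := by
  have h (i : Fin d) : ∫ y : EuclideanSpace ℝ (Fin d), y i ^ 2 ∂(stdGaussian _) = 1 := by
    have h1 := variance_dual_stdGaussian (innerSL ℝ (EuclideanSpace.single i (1 : ℝ)))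
    rw [variance_eq_integral (by fun_prop), integral_strongDual_stdGaussian] at h1
    simpa [EuclideanSpace.inner_single_left] using h1
  simp only [EuclideanSpace.real_norm_sq_eq]
  rw [integral_finsetSum]
  · simp [h]
  · intro i _
    have := (IsGaussian.memLp_dual (stdGaussian (EuclideanSpace ℝ (Fin d)))
      (innerSL ℝ (EuclideanSpace.single i (1 : ℝ))) 2 (by simp)).integrable_sq
    simpa [EuclideanSpace.inner_single_left] using this

lemma norm_sub_sqrt_stdGaussian {d : ℕ} (x : EuclideanSpace ℝ (Fin d)) {r : ℕ} (hr : 2 ≤ r) :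
    ‖√d - ‖x‖‖ₑ ≤ eLpNorm (fun y : EuclideanSpace ℝ (Fin d) => ‖x‖ - ‖y‖) r
      (stdGaussian _) := by
  set γ := stdGaussian (EuclideanSpace ℝ (Fin d))
  have hL2 : MemLp (fun y : EuclideanSpace ℝ (Fin d) => ‖y‖) 2 γ :=
    (IsGaussian.memLp_id γ 2 (by simp)).norm
  have hi1 : Integrable (fun y : EuclideanSpace ℝ (Fin d) => ‖y‖) γ := hL2.integrable (by simp)
  have hi2 : Integrable (fun y : EuclideanSpace ℝ (Fin d) => ‖y‖ ^ 2) γ := hL2.integrable_sq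
  have ha : ∫ y, ‖y‖ ∂γ ≤ √d := by
    apply Real.le_sqrt_of_sq_le
    have := variance_nonneg (fun y : EuclideanSpace ℝ (Fin d) => ‖y‖) γ
    rw [variance_eq_sub hL2] at this
    have h2 := integral_norm_sq_stdGaussian d
    simp only [Pi.pow_apply] at this
    linarith
  have hexp : ∫ y, (‖x‖ - ‖y‖) ^ 2 ∂γ = ‖x‖ ^ 2 - 2 * ‖x‖ * ∫ y, ‖y‖ ∂γ + d := by
    have : ∀ y : EuclideanSpace ℝ (Fin d), (‖x‖ - ‖y‖) ^ 2 =
      (‖x‖ ^ 2 - 2 * ‖x‖ * ‖y‖) + ‖y‖ ^ 2 := fun y => by ring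
    simp only [this]
    have hi4 : Integrable (fun y : EuclideanSpace ℝ (Fin d) => 2 * ‖x‖ * ‖y‖) γ := hi1.const_mul _
    have hi5 : Integrable (fun y : EuclideanSpace ℝ (Fin d) => ‖x‖ ^ 2 - 2 * ‖x‖ * ‖y‖) γ :=
      (integrable_const _).sub hi4
    rw [integral_add hi5 hi2, integral_sub (integrable_const _) hi4, integral_const_mul,
      integral_norm_sq_stdGaussian]
    simp
  have hi3 : Integrable (fun y : EuclideanSpace ℝ (Fin d) => (‖x‖ - ‖y‖) ^ 2) γ :=
    ((memLp_const ‖x‖).sub hL2).integrable_sq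
  have hle : (√d - ‖x‖) ^ 2 ≤ ∫ y, (‖x‖ - ‖y‖) ^ 2 ∂γ := by
    rw [hexp]
    nlinarith [Real.sq_sqrt (Nat.cast_nonneg d : (0 : ℝ) ≤ d),
      mul_le_mul_of_nonneg_left ha (norm_nonneg x)]
  have h2 : ‖√d - ‖x‖‖ₑ ^ 2 ≤
      eLpNorm (fun y : EuclideanSpace ℝ (Fin d) => ‖x‖ - ‖y‖) (2 : ℕ) γ ^ 2 := by
    rw [eLpNorm_natCast_pow _ two_ne_zero]
    have : ∀ a : ℝ, ‖a‖ₑ ^ 2 = ENNReal.ofReal (a ^ 2) := fun a => by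
      rw [← ofReal_norm, ← ENNReal.ofReal_pow (norm_nonneg _), Real.norm_eq_abs, sq_abs]
    simp only [this]
    rw [← ofReal_integral_eq_lintegral_ofReal hi3 (Eventually.of_forall fun y => sq_nonneg _)]
    exact ENNReal.ofReal_le_ofReal hle
  refine ((ENNReal.pow_le_pow_left_iff two_ne_zero).1 h2).trans ?_
  exact eLpNorm_le_eLpNorm_of_exponent_le (by exact_mod_cast hr)
    (Continuous.aestronglyMeasurable (by fun_prop))

lemma eLpNorm_norm_sub_sqrt {d : ℕ} {r : ℕ} (hr : 2 ≤ r) :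
    eLpNorm (fun x : EuclideanSpace ℝ (Fin d) => √d - ‖x‖) r (stdGaussian _) ≤
      2 * gaussMoment r := by
  have hr0 : r ≠ 0 := by omega
  rw [← ENNReal.pow_le_pow_left_iff hr0, eLpNorm_natCast_pow _ hr0]
  have h1 := maurey_pisier (d := d) (G := fun x => ‖x‖) lipschitzWith_one_norm hr0
  rw [← ENNReal.pow_le_pow_left_iff hr0, eLpNorm_natCast_pow _ hr0, lintegral_prod _
    (Measurable.aemeasurable (by fun_prop))] at h1
  simp only [ENNReal.coe_one, mul_one] at h1
  refine le_trans (lintegral_mono fun x => ?_) h1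
  rw [← eLpNorm_natCast_pow (fun y : EuclideanSpace ℝ (Fin d) => ‖x‖ - ‖y‖) hr0]
  gcongr
  exact norm_sub_sqrt_stdGaussian x hr

/-- Pairwise concentration for Lipschitz functions on the sphere. -/
lemma IsSphereLaw.eLpNorm_prod_sub_le {d : ℕ} {σ : Measure (EuclideanSpace ℝ (Fin d))}
    (hσ : IsSphereLaw σ) {F : EuclideanSpace ℝ (Fin d) → ℝ} {l : ℝ≥0} (hF : LipschitzWith l F)
    {r : ℕ} (hr : 2 ≤ r) :
    eLpNorm (fun z : EuclideanSpace ℝ (Fin d) × EuclideanSpace ℝ (Fin d) => F z.1 - F z.2) r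
      (σ.prod σ) ≤ ENNReal.ofReal (6 * l / √d) * gaussMoment r := by
  have hd := hσ.dim_pos
  have hr0 : r ≠ 0 := by omega
  have hm : 0 < √(d : ℝ) := by positivity
  set m := √(d : ℝ) with hmdef
  have hFc := hF.continuous
  rw [hσ.unique (isSphereLaw_map_stdGaussian hd)]
  set γ := stdGaussian (EuclideanSpace ℝ (Fin d))
  set φ : EuclideanSpace ℝ (Fin d) → EuclideanSpace ℝ (Fin d) := fun x => ‖x‖⁻¹ • x with hφ
  have hφm : Measurable φ := by fun_prop
  rw [Measure.map_prod_map _ _ hφm hφm, eLpNorm_map_measure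
    (Continuous.aestronglyMeasurable (by fun_prop)) (by fun_prop)]
  set G : EuclideanSpace ℝ (Fin d) → ℝ := fun x => F (m⁻¹ • x) with hGdef
  have hG : LipschitzWith (l * Real.toNNReal m⁻¹) G := by
    refine hF.comp (LipschitzWith.of_dist_le_mul fun x y => ?_)
    rw [dist_smul₀, Real.norm_of_nonneg (by positivity), Real.coe_toNNReal _ (by positivity)]
  set lm : ℝ≥0 := l * Real.toNNReal m⁻¹ with hlm
  have hGc := hG.continuous
  set H : EuclideanSpace ℝ (Fin d) → ℝ := fun x => F (φ x) - G x with hH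
  have hHm : Measurable H := by
    have := hFc.measurable
    have := hGc.measurable
    fun_prop
  have hHb : eLpNorm H r γ ≤ lm * (2 * gaussMoment r) := by
    have h1 : ∀ x, ‖H x‖ ≤ lm * ‖m - ‖x‖‖ := by
      intro x
      have h2 : dist (φ x) (m⁻¹ • x) ≤ m⁻¹ * ‖m - ‖x‖‖ := by
        rw [dist_eq_norm, hφ]
        dsimp only
        rw [← sub_smul, norm_smul]
        rcases eq_or_ne x 0 with rfl | hx
        · simp
          positivity
        · have hx' : 0 < ‖x‖ := norm_pos_iff.2 hx
          rw [show ‖x‖⁻¹ - m⁻¹ = (m - ‖x‖) * (‖x‖⁻¹ * m⁻¹) by field_simp, norm_mul,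
            Real.norm_of_nonneg (by positivity : 0 ≤ ‖x‖⁻¹ * m⁻¹)]
          apply le_of_eq
          field_simp
      have h3 := hF.dist_le_mul (φ x) (m⁻¹ • x)
      rw [Real.dist_eq] at h3
      refine h3.trans ?_
      rw [hlm, NNReal.coe_mul, Real.coe_toNNReal _ (by positivity), mul_assoc]
      gcongr
    refine (eLpNorm_le_nnreal_smul_eLpNorm_of_ae_le_mul
      (Eventually.of_forall (fun x => NNReal.coe_le_coe.1 (h1 x))) _).trans ?_
    rw [ENNReal.smul_def, smul_eq_mul]
    gcongr
    exact eLpNorm_norm_sub_sqrt hr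
  have hdec : ((fun z : EuclideanSpace ℝ (Fin d) × EuclideanSpace ℝ (Fin d) => F z.1 - F z.2) ∘
      Prod.map φ φ) = (fun z => G z.1 - G z.2) + ((H ∘ Prod.fst) - (H ∘ Prod.snd)) := by
    ext z
    simp only [hH, Function.comp, Prod.map, Pi.add_apply, Pi.sub_apply]
    ring
  have hr1 : (1 : ℝ≥0∞) ≤ r := by exact_mod_cast (by omega : 1 ≤ r)
  rw [hdec]
  refine (eLpNorm_add_le (Continuous.aestronglyMeasurable (by fun_prop))
    (Measurable.aestronglyMeasurable (by fun_prop)) hr1).trans ?_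
  refine (add_le_add le_rfl (MeasureTheory.eLpNorm_sub_le (Measurable.aestronglyMeasurable (by fun_prop))
    (Measurable.aestronglyMeasurable (by fun_prop)) hr1)).trans ?_
  rw [eLpNorm_comp_measurePreserving hHm.aestronglyMeasurable measurePreserving_fst,
    eLpNorm_comp_measurePreserving hHm.aestronglyMeasurable measurePreserving_snd]
  refine (add_le_add (maurey_pisier hG hr0) (add_le_add hHb hHb)).trans ?_
  have : ENNReal.ofReal (6 * l / m) = 6 * lm := by
    rw [show (6 * l / m : ℝ) = 6 * lm by rw [hlm, NNReal.coe_mul, Real.coe_toNNReal _ (by positivity)]; ring,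
      ENNReal.ofReal_mul (by norm_num)]
    simp
  rw [this]
  apply le_of_eq
  ring

/-- Concentration of Lipschitz functions on the sphere around their mean. -/
lemma IsSphereLaw.eLpNorm_sub_integral_le {d : ℕ} {σ : Measure (EuclideanSpace ℝ (Fin d))}
    (hσ : IsSphereLaw σ) {F : EuclideanSpace ℝ (Fin d) → ℝ} {l : ℝ≥0} (hF : LipschitzWith l F)
    {r : ℕ} (hr : 2 ≤ r) :
    eLpNorm (fun x => F x - ∫ y, F y ∂σ) r σ ≤ ENNReal.ofReal (6 * l / √d) * gaussMoment r := by
  have := hσ.prob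
  have hr0 : r ≠ 0 := by omega
  have hFc := hF.continuous
  have h1 := hσ.eLpNorm_prod_sub_le hF hr
  rw [← ENNReal.pow_le_pow_left_iff hr0, eLpNorm_natCast_pow _ hr0] at h1 ⊢
  rw [lintegral_prod _ (Continuous.aemeasurable (by fun_prop))] at h1
  refine le_trans (lintegral_mono fun x => ?_) h1
  rw [← eLpNorm_natCast_pow (fun y => F x - F y) hr0]
  gcongr
  have hFint : Integrable F σ := by
    refine Integrable.of_bound (C := ‖F 0‖ + l) hFc.aestronglyMeasurable ?_
    filter_upwards [hσ.norm_eq] with y hy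
    have := hF.dist_le_mul y 0
    rw [dist_zero_right, hy, dist_eq_norm] at this
    have h2 := norm_le_norm_add_norm_sub' (F y) (F 0)
    linarith
  have : F x - ∫ y, F y ∂σ = ∫ y, (F x - F y) ∂σ := by
    rw [integral_sub (integrable_const _) hFint]
    simp
  rw [this]
  refine (enorm_integral_le_lintegral_enorm _).trans ?_
  rw [← eLpNorm_one_eq_lintegral_enorm]
  exact eLpNorm_le_eLpNorm_of_exponent_le (by exact_mod_cast (by omega : 1 ≤ r))
    (Continuous.aestronglyMeasurable (by fun_prop))

lemma IsSphereLaw.measure_deviation_le {d : ℕ} {σ : Measure (EuclideanSpace ℝ (Fin d))}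
    (hσ : IsSphereLaw σ) {f : EuclideanSpace ℝ (Fin d) → ℝ} {l : ℝ≥0}
    (hf : LipschitzOnWith l f (Metric.sphere 0 1)) {r : ℕ} (hr : 2 ≤ r) {a : ℝ} (ha : 0 < a) :
    σ {x | a ≤ |f x - ∫ y, f y ∂σ|} ≤
      ENNReal.ofReal ((6 * l / √d * (gaussMoment r).toReal / a) ^ r) := by
  have := hσ.prob
  have hr0 : r ≠ 0 := by omega
  obtain ⟨F, hF, hFf⟩ := hf.extend_real
  have hFc := hF.continuous
  have hae : ∀ᵐ x ∂σ, f x = F x := by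
    filter_upwards [hσ.norm_eq] with x hx
    exact hFf (by simpa using hx)
  rw [integral_congr_ae hae]
  have h1 : σ {x | a ≤ |f x - ∫ y, F y ∂σ|} ≤ σ {x | ENNReal.ofReal a ≤ ‖F x - ∫ y, F y ∂σ‖ₑ} := by
    refine measure_mono_ae ?_
    filter_upwards [hae] with x hx h
    have h' : a ≤ |f x - ∫ y, F y ∂σ| := h
    change ENNReal.ofReal a ≤ ‖F x - ∫ y, F y ∂σ‖ₑ
    rw [← ofReal_norm, Real.norm_eq_abs, ← hx]
    exact ENNReal.ofReal_le_ofReal h'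
  refine h1.trans ?_
  have ha' : ENNReal.ofReal a ≠ 0 := by simpa using ha
  refine (meas_ge_le_mul_pow_eLpNorm_enorm σ (p := r) (by simpa) (by simp)
    (Continuous.aestronglyMeasurable (by fun_prop)) ha' (by simp)).trans ?_
  have h2 := hσ.eLpNorm_sub_integral_le hF hr
  rw [ENNReal.toReal_natCast, ENNReal.rpow_natCast, ENNReal.rpow_natCast, ← mul_pow,
    ENNReal.ofReal_pow (by positivity)]
  gcongr
  rw [ENNReal.ofReal_div_of_pos ha, ENNReal.ofReal_mul (by positivity),
    ENNReal.ofReal_toReal (gaussMoment_lt_top r).ne, div_eq_mul_inv, mul_comm]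
  gcongr

lemma IsSphereLaw.integral_inner_pow_le {d : ℕ} {σ : Measure (EuclideanSpace ℝ (Fin d))}
    (hσ : IsSphereLaw σ) {e : EuclideanSpace ℝ (Fin d)} (he : ‖e‖ = 1) {k : ℕ} (hk : 1 ≤ k) :
    ∫ z, (inner ℝ e z) ^ (2 * k) ∂σ ≤ (6 * (gaussMoment (2 * k : ℕ)).toReal) ^ (2 * k) / d ^ k := by
  have := hσ.prob
  have hd := hσ.dim_pos
  have hr0 : 2 * k ≠ 0 := by omega
  have hF : LipschitzWith 1 (fun z : EuclideanSpace ℝ (Fin d) => inner ℝ e z) := by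
    refine LipschitzWith.of_dist_le_mul fun x y => ?_
    rw [Real.dist_eq, ← inner_sub_right, dist_eq_norm]
    simpa [he] using abs_real_inner_le_norm e (x - y)
  have h0 : ∫ z, inner ℝ e z ∂σ = 0 := by
    have := hσ.integral_comp (LinearIsometryEquiv.neg ℝ) (fun z => inner ℝ e z)
    simp only [LinearIsometryEquiv.coe_neg, inner_neg_right, integral_neg] at this
    linarith
  have h1 := hσ.eLpNorm_sub_integral_le hF (r := 2 * k) (by omega)
  rw [h0] at h1
  simp only [sub_zero] at h1
  rw [← ENNReal.pow_le_pow_left_iff hr0, eLpNorm_natCast_pow _ hr0,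
    ← ENNReal.ofReal_toReal (gaussMoment_lt_top (2 * k)).ne, ← ENNReal.ofReal_mul (by positivity),
    ← ENNReal.ofReal_pow (by positivity)] at h1
  have h2 : ∀ z, ‖(inner ℝ e z : ℝ)‖ₑ ^ (2 * k) =
      ENNReal.ofReal ((inner ℝ e z : ℝ) ^ (2 * k)) := fun z => by
    rw [← ofReal_norm, ← ENNReal.ofReal_pow (norm_nonneg _), Real.norm_eq_abs,
      (even_two_mul k).pow_abs]
  have hmeas : Measurable fun z : EuclideanSpace ℝ (Fin d) => (inner ℝ e z : ℝ) ^ (2 * k) :=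
    Continuous.measurable (by fun_prop)
  rw [integral_eq_lintegral_of_nonneg_ae (Eventually.of_forall fun z =>
    (even_two_mul k).pow_nonneg _) hmeas.aestronglyMeasurable]
  refine ENNReal.toReal_le_of_le_ofReal (by positivity) ?_
  simp only [← h2]
  refine h1.trans (ENNReal.ofReal_le_ofReal (le_of_eq ?_))
  have : (√(d : ℝ)) ^ (2 * k) = d ^ k := by
    rw [pow_mul, Real.sq_sqrt (Nat.cast_nonneg d)]
  rw [mul_pow, div_pow, this]
  simp
  ring

lemma sphereUniform_univ_of_ne_zero {d : ℕ} {r : ℝ} (h : sphereUniform d r ≠ 0) :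
    IsProbabilityMeasure (sphereUniform d r) := by
  constructor
  have key : sphereUniform d r Set.univ =
      ((Measure.hausdorffMeasure ((d : ℝ) - 1) : Measure (EuclideanSpace ℝ (Fin d)))
        (Metric.sphere 0 r))⁻¹ *
      (Measure.hausdorffMeasure ((d : ℝ) - 1) : Measure (EuclideanSpace ℝ (Fin d)))
        (Metric.sphere 0 r) := by
    simp [sphereUniform]
  rw [key]
  refine ENNReal.inv_mul_cancel (fun h0 => h ?_) (fun h0 => h ?_)
  · rw [sphereUniform, Measure.restrict_eq_zero.2 h0, smul_zero]
  · rw [sphereUniform, h0, ENNReal.inv_top, zero_smul]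

lemma isSphereLaw_sphereUniform {d : ℕ} (h : sphereUniform d 1 ≠ 0) :
    IsSphereLaw (sphereUniform d 1) := by
  refine ⟨sphereUniform_univ_of_ne_zero h, ?_, fun φ => ?_⟩
  · refine Measure.ae_smul_measure ?_ _
    filter_upwards [ae_restrict_mem Metric.isClosed_sphere.measurableSet] with x hx
    simpa using hx
  · have h1 : MeasurePreserving φ (Measure.hausdorffMeasure ((d : ℝ) - 1))
        (Measure.hausdorffMeasure ((d : ℝ) - 1)) :=
      φ.toIsometryEquiv.measurePreserving_hausdorffMeasure _
    have h2 := h1.restrict_preimage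
      (Metric.isClosed_sphere (x := (0 : EuclideanSpace ℝ (Fin d))) (ε := 1)).measurableSet
    have h3 : φ ⁻¹' Metric.sphere 0 1 = Metric.sphere 0 1 := by
      ext x; simp
    rw [h3] at h2
    rw [sphereUniform, Measure.map_smul, h2.map_eq]

lemma sphereUniform_eq_map {d : ℕ} (hd : 0 < d) :
    sphereUniform d √d = (sphereUniform d 1).map (fun x => √(d : ℝ) • x) := by
  have hs : 0 < √(d : ℝ) := by positivity
  have hd1 : (0 : ℝ) ≤ (d : ℝ) - 1 := by
    have : (1 : ℝ) ≤ d := by exact_mod_cast hd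
    linarith
  set μ : Measure (EuclideanSpace ℝ (Fin d)) := Measure.hausdorffMeasure ((d : ℝ) - 1) with hμ
  set c : ℝ≥0∞ := ((‖√(d : ℝ)‖₊ ^ ((d : ℝ) - 1) : ℝ≥0) : ℝ≥0∞) with hc
  have hc0 : c ≠ 0 := by
    rw [hc, ENNReal.coe_ne_zero]
    exact (NNReal.rpow_pos (by simpa using hs.ne')).ne'
  have hct : c ≠ ∞ := ENNReal.coe_ne_top
  have hsc : ∀ s : Set (EuclideanSpace ℝ (Fin d)),
      μ ((fun x => √(d : ℝ) • x) '' s) = c * μ s := by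
    intro s
    have := Measure.hausdorffMeasure_smul₀ hd1 hs.ne' s
    rw [ENNReal.smul_def, smul_eq_mul] at this
    exact this
  have hinj : Function.Injective (fun x : EuclideanSpace ℝ (Fin d) => √(d : ℝ) • x) :=
    smul_right_injective _ hs.ne'
  have hsph : Metric.sphere (0 : EuclideanSpace ℝ (Fin d)) √d =
      (fun x => √(d : ℝ) • x) '' Metric.sphere 0 1 := by
    ext x
    simp only [mem_sphere_iff_norm, sub_zero, Set.mem_image]
    constructor
    · intro hx
      refine ⟨(√(d : ℝ))⁻¹ • x, ?_, ?_⟩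
      · rw [norm_smul, hx, norm_inv, Real.norm_of_nonneg hs.le, inv_mul_cancel₀ hs.ne']
      · rw [smul_smul, mul_inv_cancel₀ hs.ne', one_smul]
    · rintro ⟨y, hy, rfl⟩
      rw [norm_smul, hy, Real.norm_of_nonneg hs.le, mul_one]
  ext A hA
  have hm : Measurable fun x : EuclideanSpace ℝ (Fin d) => √(d : ℝ) • x := by fun_prop
  rw [Measure.map_apply hm hA, sphereUniform, sphereUniform, ← hμ, Measure.smul_apply,
    Measure.smul_apply, Measure.restrict_apply hA, Measure.restrict_apply (hm hA), hsph, hsc]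
  have : A ∩ (fun x => √(d : ℝ) • x) '' Metric.sphere 0 1 =
      (fun x => √(d : ℝ) • x) '' ((fun x => √(d : ℝ) • x) ⁻¹' A ∩ Metric.sphere 0 1) := by
    rw [Set.inter_comm, Set.image_preimage_inter, Set.inter_comm]
  rw [this, hsc, ENNReal.mul_inv (Or.inl hc0) (Or.inl hct), smul_eq_mul, smul_eq_mul,
    mul_mul_mul_comm, ENNReal.inv_mul_cancel hc0 hct, one_mul]

/-- Abstract form of `IsGegenbauer` on the unit sphere. -/
structure IsZonal {d : ℕ} (σ : Measure (EuclideanSpace ℝ (Fin d))) (k : ℕ) (p : Polynomial ℝ) :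
    Prop where
  natDegree_le : p.natDegree ≤ k
  integral_sq : ∀ e : EuclideanSpace ℝ (Fin d), ‖e‖ = 1 → ∫ z, p.eval (inner ℝ e z) ^ 2 ∂σ = 1
  orthogonal : ∀ e : EuclideanSpace ℝ (Fin d), ‖e‖ = 1 → ∀ j < k,
    ∫ z, p.eval (inner ℝ e z) * (inner ℝ e z) ^ j ∂σ = 0

lemma IsGegenbauer.dim_pos {d k : ℕ} (hk : 1 ≤ k) {q : Polynomial ℝ} (h : IsGegenbauer d k q) :
    0 < d := by
  obtain ⟨-, -, h1, h2⟩ := h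
  have h3 := h2 0 (by omega)
  rcases Nat.eq_zero_or_pos d with rfl | hd
  · exfalso
    rw [tau1, integral_map (by simp) (Continuous.aestronglyMeasurable (by fun_prop))] at h1 h3
    simp only [lt_irrefl, dite_false, integral_const, pow_zero, mul_one, smul_eq_mul] at h1 h3
    rcases mul_eq_zero.1 h3 with h4 | h4
    · rw [h4] at h1
      simp at h1
    · simp [h4] at h1
  · exact hd

lemma IsGegenbauer.isSphereLaw {d k : ℕ} (hk : 1 ≤ k) {q : Polynomial ℝ}
    (h : IsGegenbauer d k q) : IsSphereLaw (sphereUniform d 1) := by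
  apply isSphereLaw_sphereUniform
  intro h0
  have hd := h.dim_pos hk
  obtain ⟨-, -, h1, -⟩ := h
  rw [tau1, sphereUniform_eq_map hd, h0] at h1
  simp at h1

lemma IsGegenbauer.isZonal {d k : ℕ} (hk : 1 ≤ k) {q : Polynomial ℝ}
    (h : IsGegenbauer d k q) :
    IsZonal (sphereUniform d 1) k (q.comp (Polynomial.C √(d : ℝ) * Polynomial.X)) := by
  have hd := h.dim_pos hk
  have hσ := h.isSphereLaw hk
  have hs : 0 < √(d : ℝ) := by positivity
  obtain ⟨h0, -, h1, h2⟩ := h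
  have key : ∀ (f : Polynomial ℝ) (e : EuclideanSpace ℝ (Fin d)), ‖e‖ = 1 →
      ∫ s, f.eval s ∂tau1 d = ∫ z, f.eval (√(d : ℝ) * inner ℝ e z) ∂(sphereUniform d 1) := by
    intro f e he
    have hm : Measurable fun x : EuclideanSpace ℝ (Fin d) => if h : 0 < d then x ⟨0, h⟩ else 0 := by
      simp only [hd, dite_true]
      fun_prop
    rw [tau1, integral_map hm.aemeasurable (Continuous.aestronglyMeasurable (by fun_prop)),
      sphereUniform_eq_map hd]
    have hm2 := (f.continuous.measurable.comp hm).aestronglyMeasurable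
      (μ := (sphereUniform d 1).map (fun x => √(d : ℝ) • x))
    simp only [Function.comp_def] at hm2
    rw [integral_map (by fun_prop) hm2]
    obtain ⟨φ, hφ⟩ := exists_isometry_map (v := EuclideanSpace.single (⟨0, hd⟩ : Fin d) (1 : ℝ))
      (w := e) (by simp [he])
    rw [← hσ.integral_comp φ (fun z => f.eval (√(d : ℝ) * inner ℝ e z))]
    simp only [← hφ, LinearIsometryEquiv.inner_map_map]
    simp [hd, EuclideanSpace.inner_single_left]
  refine ⟨?_, fun e he => ?_, fun e he j hj => ?_⟩
  · refine Polynomial.natDegree_comp_le.trans ?_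
    rw [h0]
    rw [Polynomial.natDegree_C_mul_X _ hs.ne', mul_one]
  · have := key (q ^ 2) e he
    simp only [Polynomial.eval_pow, h1] at this
    simpa [Polynomial.eval_comp] using this.symm
  · have := key (q * Polynomial.X ^ j) e he
    simp only [Polynomial.eval_mul, Polynomial.eval_pow, Polynomial.eval_X, h2 j hj] at this
    simp only [mul_pow, mul_left_comm _ (√(d : ℝ) ^ j), integral_const_mul] at this
    simpa [Polynomial.eval_comp, hs.ne', hd.ne'] using this.symm

namespace IsSphereLaw

variable {d : ℕ} {σ : Measure (EuclideanSpace ℝ (Fin d))}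

lemma integrable (hσ : IsSphereLaw σ) {f : EuclideanSpace ℝ (Fin d) → ℝ} (hf : Continuous f) :
    Integrable f σ := by
  have := hσ.prob
  obtain ⟨C, hC⟩ := (isCompact_sphere (0 : EuclideanSpace ℝ (Fin d)) 1).exists_bound_of_continuousOn
    hf.continuousOn
  refine Integrable.of_bound (C := C) hf.aestronglyMeasurable ?_
  filter_upwards [hσ.norm_eq] with x hx
  exact hC x (by simpa using hx)

lemma eq_zero_of_integral_sq (hσ : IsSphereLaw σ) {f : EuclideanSpace ℝ (Fin d) → ℝ}
    (hf : Continuous f) (h : ∫ z, f z ^ 2 ∂σ = 0) {z : EuclideanSpace ℝ (Fin d)} (hz : ‖z‖ = 1) :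
    f z = 0 := by
  have := hσ.prob
  by_contra hne
  have h0 : (fun z => f z ^ 2) =ᵐ[σ] 0 :=
    (integral_eq_zero_iff_of_nonneg (fun z => sq_nonneg _) (hσ.integrable (hf.pow 2))).1 h
  have hopen : IsOpen {x | f x ≠ 0} := isOpen_ne_fun hf continuous_const
  obtain ⟨ε, hε, hball⟩ := Metric.isOpen_iff.1 hopen z hne
  have hnull : σ (Metric.ball z ε) = 0 := by
    refine measure_mono_null hball ?_
    rw [EventuallyEq, ae_iff] at h0
    simpa using h0
  have hall : ∀ x : EuclideanSpace ℝ (Fin d), ‖x‖ = 1 → σ (Metric.ball x ε) = 0 := by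
    intro x hx
    obtain ⟨φ, rfl⟩ := exists_isometry_map (v := z) (w := x) (by rw [hx, hz])
    rw [← hσ.map_eq φ, Measure.map_apply φ.continuous.measurable Metric.isOpen_ball.measurableSet]
    rwa [show φ ⁻¹' Metric.ball (φ z) ε = Metric.ball z ε by ext y; simp]
  have hs : σ (Metric.sphere 0 1) = 0 := by
    refine measure_null_of_locally_null _ fun x hx => ⟨Metric.ball x ε, ?_, hall x (by simpa using hx)⟩
    exact mem_nhdsWithin_of_mem_nhds (Metric.ball_mem_nhds x hε)
  have h1 : ∀ᵐ x ∂σ, x ∉ Metric.sphere (0 : EuclideanSpace ℝ (Fin d)) 1 := measure_eq_zero_iff_ae_notMem.1 hs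
  obtain ⟨x, hx1, hx2⟩ := (h1.and hσ.norm_eq).exists
  exact hx1 (by simpa using hx2)

end IsSphereLaw

lemma exists_isometry_pair {d : ℕ} {e₀ e₁ w w' : EuclideanSpace ℝ (Fin d)} (h0 : ‖e₀‖ = 1)
    (h1 : ‖e₁‖ = 1) (h01 : inner ℝ e₀ e₁ = 0) (hw : ‖w‖ = 1) (hw' : ‖w'‖ = 1) :
    ∃ (φ : EuclideanSpace ℝ (Fin d) ≃ₗᵢ[ℝ] EuclideanSpace ℝ (Fin d)) (b : ℝ),
      φ e₀ = w ∧ w' = inner ℝ w w' • w + b • φ e₁ ∧ b ^ 2 = 1 - inner ℝ w w' ^ 2 := by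
  obtain ⟨φ₁, hφ₁⟩ := exists_isometry_map (v := e₀) (w := w) (by rw [h0, hw])
  set a : ℝ := inner ℝ w w'
  set u := w' - a • w with hu
  have huw : inner ℝ w u = 0 := by
    rw [hu, inner_sub_right, inner_smul_right, real_inner_self_eq_norm_sq, hw]
    simp [a]
  have hb : ‖u‖ ^ 2 = 1 - a ^ 2 := by
    rw [hu, norm_sub_sq_real, inner_smul_right, norm_smul, hw, hw', real_inner_comm]
    simp only [mul_one, one_pow, Real.norm_eq_abs, sq_abs]
    change 1 - 2 * (a * a) + a ^ 2 = 1 - a ^ 2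
    ring
  rcases eq_or_ne u 0 with hu0 | hu0
  · refine ⟨φ₁, 0, hφ₁, ?_, ?_⟩
    · rw [zero_smul, add_zero]
      exact sub_eq_zero.1 hu0
    · rw [← hb, hu0]; simp
  · have hun : 0 < ‖u‖ := norm_pos_iff.2 hu0
    set v := φ₁.symm (‖u‖⁻¹ • u) with hv
    have hvn : ‖v‖ = 1 := by
      rw [hv, LinearIsometryEquiv.norm_map, norm_smul, norm_inv, norm_norm]
      exact inv_mul_cancel₀ hun.ne'
    have hve : inner ℝ e₀ v = 0 := by
      rw [← φ₁.inner_map_map, hφ₁, hv, φ₁.apply_symm_apply, inner_smul_right, huw, mul_zero]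
    set φ₂ := (Submodule.span ℝ {e₁ - v})ᗮ.reflection with hφ₂
    have hφ₂0 : φ₂ e₀ = e₀ := by
      apply Submodule.reflection_mem_subspace_eq_self
      rw [Submodule.mem_orthogonal_singleton_iff_inner_left, inner_sub_right, h01, hve, sub_zero]
    have hφ₂1 : φ₂ e₁ = v := Submodule.reflection_sub (by rw [h1, hvn])
    refine ⟨φ₂.trans φ₁, ‖u‖, ?_, ?_, hb⟩
    · simp [hφ₂0, hφ₁]
    · simp only [LinearIsometryEquiv.trans_apply, hφ₂1, hv, LinearIsometryEquiv.apply_symm_apply]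
      rw [smul_smul, mul_inv_cancel₀ hun.ne', one_smul, hu]
      simp

namespace IsSphereLaw

variable {d : ℕ} {σ : Measure (EuclideanSpace ℝ (Fin d))}

lemma exists_polynomial_monomial (hσ : IsSphereLaw σ) (hd : 2 ≤ d) (i j : ℕ) :
    ∃ P : Polynomial ℝ, P.natDegree ≤ j ∧ ∀ w w' : EuclideanSpace ℝ (Fin d), ‖w‖ = 1 → ‖w'‖ = 1 →
      ∫ z, (inner ℝ w z) ^ i * (inner ℝ w' z) ^ j ∂σ = P.eval (inner ℝ w w') := by
  set e₀ : EuclideanSpace ℝ (Fin d) := EuclideanSpace.single ⟨0, by omega⟩ 1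
  set e₁ : EuclideanSpace ℝ (Fin d) := EuclideanSpace.single ⟨1, by omega⟩ 1
  have h0 : ‖e₀‖ = 1 := by simp [e₀]
  have h1 : ‖e₁‖ = 1 := by simp [e₁]
  have h01 : inner ℝ e₀ e₁ = 0 := by simp [e₀, e₁, EuclideanSpace.inner_single_left]
  set M : ℕ → ℝ := fun l => ∫ z, inner ℝ e₀ z ^ (i + (j - l)) * inner ℝ e₁ z ^ l ∂σ with hM
  have hodd : ∀ l, ¬ Even l → M l = 0 := by
    intro l hl
    set φ := (Submodule.span ℝ {e₁})ᗮ.reflection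
    have hφ0 : φ e₀ = e₀ := by
      apply Submodule.reflection_mem_subspace_eq_self
      rw [Submodule.mem_orthogonal_singleton_iff_inner_left, h01]
    have hφ1 : φ e₁ = -e₁ := Submodule.reflection_orthogonalComplement_singleton_eq_neg e₁
    have h2 := hσ.integral_comp φ
      (fun z => (inner ℝ e₀ z : ℝ) ^ (i + (j - l)) * (inner ℝ e₁ z : ℝ) ^ l)
    have h3 : ∀ z, (inner ℝ e₀ (φ z) : ℝ) = inner ℝ e₀ z := fun z => by
      conv_lhs => rw [← hφ0, φ.inner_map_map]
    have h4 : ∀ z, (inner ℝ e₁ (φ z) : ℝ) = - inner ℝ e₁ z := fun z => by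
      have : e₁ = φ (-e₁) := by rw [map_neg, hφ1, neg_neg]
      conv_lhs => rw [this, φ.inner_map_map, inner_neg_left]
    simp only [h3, h4, (Nat.not_even_iff_odd.1 hl).neg_pow, mul_neg, integral_neg] at h2
    simp only [hM]
    linarith
  refine ⟨∑ l ∈ Finset.range (j + 1), if Even l then
    Polynomial.C ((j.choose l : ℝ) * M l) * (Polynomial.X ^ (j - l) *
      (1 - Polynomial.X ^ 2) ^ (l / 2)) else 0, ?_, fun w w' hw hw' => ?_⟩
  · refine Polynomial.natDegree_sum_le_of_forall_le _ _ fun l hl => ?_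
    rw [Finset.mem_range] at hl
    split_ifs with he
    · refine (Polynomial.natDegree_C_mul_le _ _).trans ?_
      refine Polynomial.natDegree_mul_le.trans ?_
      have h2 : (1 - Polynomial.X ^ 2 : Polynomial ℝ).natDegree ≤ 2 :=
        (Polynomial.natDegree_sub_le _ _).trans (by simp)
      have h3 := Polynomial.natDegree_pow_le_of_le (l / 2) h2
      have h4 := Polynomial.natDegree_X_pow_le (R := ℝ) (j - l)
      omega
    · simp
  · obtain ⟨φ, b, hφ, hw2, hb⟩ := exists_isometry_pair h0 h1 h01 hw hw'
    set a : ℝ := inner ℝ w w'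
    rw [← hσ.integral_comp φ (fun z => (inner ℝ w z : ℝ) ^ i * (inner ℝ w' z : ℝ) ^ j)]
    have h5 : ∀ z, (inner ℝ w' (φ z) : ℝ) = b * inner ℝ e₁ z + a * inner ℝ e₀ z := fun z => by
      rw [hw2, inner_add_left, inner_smul_left, inner_smul_left, φ.inner_map_map, ← hφ,
        φ.inner_map_map]
      simp [add_comm]
    have h6 : ∀ z, (inner ℝ w (φ z) : ℝ) = inner ℝ e₀ z := fun z => by
      rw [← hφ, φ.inner_map_map]
    simp only [h5, h6, add_pow, Finset.mul_sum]
    rw [integral_finsetSum _ (fun l _ => hσ.integrable (by fun_prop)), Polynomial.eval_finsetSum]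
    refine Finset.sum_congr rfl fun l _ => ?_
    have h7 : ∀ z, (inner ℝ e₀ z : ℝ) ^ i * ((b * inner ℝ e₁ z) ^ l *
        (a * inner ℝ e₀ z) ^ (j - l) * (j.choose l : ℝ)) =
        (j.choose l : ℝ) * a ^ (j - l) * b ^ l *
          ((inner ℝ e₀ z : ℝ) ^ (i + (j - l)) * (inner ℝ e₁ z : ℝ) ^ l) := fun z => by
      rw [mul_pow, mul_pow, pow_add]; ring
    simp only [h7, integral_const_mul]
    change _ * M l = _
    split_ifs with he
    · obtain ⟨m, rfl⟩ := even_iff_exists_two_mul.1 he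
      simp only [Polynomial.eval_mul, Polynomial.eval_C, Polynomial.eval_pow, Polynomial.eval_X,
        Polynomial.eval_sub, Polynomial.eval_one]
      rw [Nat.mul_div_cancel_left _ two_pos, ← hb, pow_mul b]
      ring
    · rw [hodd l he]; simp

lemma exists_polynomial (hσ : IsSphereLaw σ) (hd : 2 ≤ d) (p q : Polynomial ℝ) :
    ∃ P : Polynomial ℝ, P.natDegree ≤ q.natDegree ∧ ∀ w w' : EuclideanSpace ℝ (Fin d),
      ‖w‖ = 1 → ‖w'‖ = 1 →
      ∫ z, p.eval (inner ℝ w z) * q.eval (inner ℝ w' z) ∂σ = P.eval (inner ℝ w w') := by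
  choose P hP1 hP2 using hσ.exists_polynomial_monomial hd
  refine ⟨∑ i ∈ Finset.range (p.natDegree + 1), ∑ j ∈ Finset.range (q.natDegree + 1),
    Polynomial.C (p.coeff i * q.coeff j) * P i j, ?_, fun w w' hw hw' => ?_⟩
  · refine Polynomial.natDegree_sum_le_of_forall_le _ _ fun i _ =>
      Polynomial.natDegree_sum_le_of_forall_le _ _ fun j hj => ?_
    rw [Finset.mem_range] at hj
    exact (Polynomial.natDegree_C_mul_le _ _).trans ((hP1 i j).trans (by omega))
  · have h1 : ∀ z, p.eval (inner ℝ w z) * q.eval (inner ℝ w' z) =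
        ∑ i ∈ Finset.range (p.natDegree + 1), ∑ j ∈ Finset.range (q.natDegree + 1),
          p.coeff i * q.coeff j * ((inner ℝ w z : ℝ) ^ i * (inner ℝ w' z : ℝ) ^ j) := fun z => by
      rw [p.eval_eq_sum_range, q.eval_eq_sum_range, Finset.sum_mul_sum]
      exact Finset.sum_congr rfl fun i _ => Finset.sum_congr rfl fun j _ => by ring
    simp only [h1, Polynomial.eval_finsetSum, Polynomial.eval_mul, Polynomial.eval_C,
      ← hP2 _ _ w w' hw hw']
    rw [integral_finsetSum _ (fun i _ => hσ.integrable (by fun_prop))]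
    refine Finset.sum_congr rfl fun i _ => ?_
    rw [integral_finsetSum _ (fun i _ => hσ.integrable (by fun_prop))]
    exact Finset.sum_congr rfl fun j _ => integral_const_mul _ _

end IsSphereLaw

namespace IsZonal

variable {d k : ℕ} {σ : Measure (EuclideanSpace ℝ (Fin d))} {p : Polynomial ℝ}

lemma integral_mul_eq_zero (hp : IsZonal σ k p) (hσ : IsSphereLaw σ) {Q : Polynomial ℝ}
    (hQ : Q.natDegree < k) {e : EuclideanSpace ℝ (Fin d)} (he : ‖e‖ = 1) :
    ∫ z, p.eval (inner ℝ e z) * Q.eval (inner ℝ e z) ∂σ = 0 := by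
  have h1 : ∀ z, p.eval (inner ℝ e z) * Q.eval (inner ℝ e z) =
      ∑ j ∈ Finset.range k, Q.coeff j * (p.eval (inner ℝ e z) * (inner ℝ e z : ℝ) ^ j) := fun z => by
    rw [Polynomial.eval_eq_sum_range' hQ, Finset.mul_sum]
    exact Finset.sum_congr rfl fun j _ => by ring
  simp only [h1]
  rw [integral_finsetSum _ (fun i _ => hσ.integrable (by fun_prop))]
  refine Finset.sum_eq_zero fun j hj => ?_
  rw [integral_const_mul, hp.orthogonal e he j (Finset.mem_range.1 hj), mul_zero]

lemma coeff_ne_zero (hp : IsZonal σ k p) (hσ : IsSphereLaw σ) (hk : 1 ≤ k)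
    {e : EuclideanSpace ℝ (Fin d)} (he : ‖e‖ = 1) : p.coeff k ≠ 0 := by
  intro h
  have h1 : p.natDegree < k := by
    refine lt_of_le_of_ne hp.natDegree_le fun h2 => ?_
    rw [← h2] at h
    have : p = 0 := Polynomial.leadingCoeff_eq_zero.1 h
    rw [this, Polynomial.natDegree_zero] at h2
    omega
  have h2 := hp.integral_mul_eq_zero hσ h1 he
  have h3 := hp.integral_sq e he
  simp only [pow_two] at h3
  linarith

lemma eval_eq_of_orthogonal (hp : IsZonal σ k p) (hσ : IsSphereLaw σ) (hk : 1 ≤ k)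
    {F : Polynomial ℝ} (hF : F.natDegree ≤ k) {e : EuclideanSpace ℝ (Fin d)} (he : ‖e‖ = 1)
    (hF' : ∀ j < k, ∫ z, F.eval (inner ℝ e z) * (inner ℝ e z : ℝ) ^ j ∂σ = 0) :
    ∃ c : ℝ, ∀ z, ‖z‖ = 1 → F.eval (inner ℝ e z) = c * p.eval (inner ℝ e z) := by
  have hκ := hp.coeff_ne_zero hσ hk he
  set c := F.coeff k / p.coeff k with hc
  set H := F - Polynomial.C c * p with hH
  have hH1 : H.natDegree < k := by
    have h1 : H.natDegree ≤ k := (Polynomial.natDegree_sub_le _ _).trans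
      (max_le hF ((Polynomial.natDegree_C_mul_le _ _).trans hp.natDegree_le))
    refine lt_of_le_of_ne h1 fun h2 => ?_
    have h3 : H.coeff k = 0 := by
      rw [hH, Polynomial.coeff_sub, Polynomial.coeff_C_mul, hc, div_mul_cancel₀ _ hκ, sub_self]
    rw [← h2] at h3
    have : H = 0 := Polynomial.leadingCoeff_eq_zero.1 h3
    rw [this, Polynomial.natDegree_zero] at h2
    omega
  have hH2 : ∀ j < k, ∫ z, H.eval (inner ℝ e z) * (inner ℝ e z : ℝ) ^ j ∂σ = 0 := fun j hj => by
    have h1 : ∀ z, H.eval (inner ℝ e z) * (inner ℝ e z : ℝ) ^ j =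
        F.eval (inner ℝ e z) * (inner ℝ e z : ℝ) ^ j -
        c * (p.eval (inner ℝ e z) * (inner ℝ e z : ℝ) ^ j) := fun z => by
      simp only [hH, Polynomial.eval_sub, Polynomial.eval_mul, Polynomial.eval_C]; ring
    simp only [h1]
    rw [integral_sub (hσ.integrable (by fun_prop)) (hσ.integrable (by fun_prop)),
      integral_const_mul, hF' j hj, hp.orthogonal e he j hj]
    simp
  have hH3 : ∫ z, H.eval (inner ℝ e z) ^ 2 ∂σ = 0 := by
    have h1 : ∀ z, H.eval (inner ℝ e z) ^ 2 =
        ∑ j ∈ Finset.range k, H.coeff j * (H.eval (inner ℝ e z) * (inner ℝ e z : ℝ) ^ j) :=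
      fun z => by
      rw [pow_two]
      nth_rewrite 1 [Polynomial.eval_eq_sum_range' hH1]
      rw [Finset.sum_mul]
      exact Finset.sum_congr rfl fun j _ => by ring
    simp only [h1]
    rw [integral_finsetSum _ (fun i _ => hσ.integrable (by fun_prop))]
    refine Finset.sum_eq_zero fun j hj => ?_
    rw [integral_const_mul, hH2 j (Finset.mem_range.1 hj), mul_zero]
  refine ⟨c, fun z hz => ?_⟩
  have := hσ.eq_zero_of_integral_sq (f := fun z => H.eval (inner ℝ e z)) (by fun_prop) hH3 hz
  simp only [hH, Polynomial.eval_sub, Polynomial.eval_mul, Polynomial.eval_C] at this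
  linarith

end IsZonal

/-- `K` is, up to the factor `N`, the reproducing kernel of a space of functions on the sphere that
are polynomials of degree at most `k`, normalised to be `1` on the diagonal. -/
structure IsReproducing {d : ℕ} (σ : Measure (EuclideanSpace ℝ (Fin d))) (k : ℕ) (K : Polynomial ℝ)
    (N : ℝ) : Prop where
  natDegree_le : K.natDegree ≤ k
  pos : 0 < N
  eval_one : K.eval 1 = 1
  orthogonal : ∀ e : EuclideanSpace ℝ (Fin d), ‖e‖ = 1 → ∀ j < k,
    ∫ z, K.eval (inner ℝ e z) * (inner ℝ e z : ℝ) ^ j ∂σ = 0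
  reproducing : ∀ w w' : EuclideanSpace ℝ (Fin d), ‖w‖ = 1 → ‖w'‖ = 1 →
    ∫ z, K.eval (inner ℝ w z) * K.eval (inner ℝ w' z) ∂σ = K.eval (inner ℝ w w') / N

lemma IsZonal.isReproducing {d k : ℕ} {σ : Measure (EuclideanSpace ℝ (Fin d))} {p : Polynomial ℝ}
    (hp : IsZonal σ k p) (hσ : IsSphereLaw σ) (hd : 2 ≤ d) (hk : 1 ≤ k) :
    p.eval 1 ≠ 0 ∧
      IsReproducing σ k (Polynomial.C (p.eval 1)⁻¹ * p) (p.eval 1 ^ 2) := by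
  have := hσ.prob
  obtain ⟨F, hF1, hF2⟩ := hσ.exists_polynomial hd p p
  have hpow : ∀ j < k, ∀ w : EuclideanSpace ℝ (Fin d), ‖w‖ = 1 →
      ∫ u, F.eval (inner ℝ w u) * (inner ℝ w u : ℝ) ^ j ∂σ = 0 := by
    intro j hj w hw
    obtain ⟨G, hG1, hG2⟩ := hσ.exists_polynomial hd p (Polynomial.X ^ j)
    have hG3 : G.natDegree < k := by
      refine lt_of_le_of_lt (hG1.trans (Polynomial.natDegree_X_pow_le j)) hj
    have hcongr : ∫ u, F.eval (inner ℝ w u) * (inner ℝ w u : ℝ) ^ j ∂σ =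
        ∫ u, ∫ z, p.eval (inner ℝ w z) * p.eval (inner ℝ u z) * (inner ℝ w u : ℝ) ^ j ∂σ ∂σ := by
      refine integral_congr_ae ?_
      filter_upwards [hσ.norm_eq] with u hu
      rw [← hF2 w u hw hu, integral_mul_const]
    rw [hcongr, integral_integral_swap]
    · have : ∀ᵐ z ∂σ, ∫ u, p.eval (inner ℝ w z) * p.eval (inner ℝ u z) * (inner ℝ w u : ℝ) ^ j ∂σ =
          p.eval (inner ℝ w z) * G.eval (inner ℝ w z) := by
        filter_upwards [hσ.norm_eq] with z hz
        rw [real_inner_comm z w, ← hG2 z w hz hw, ← integral_const_mul]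
        refine integral_congr_ae (Eventually.of_forall fun u => ?_)
        simp only [Polynomial.eval_pow, Polynomial.eval_X, real_inner_comm z u]
        ring
      rw [integral_congr_ae this]
      exact hp.integral_mul_eq_zero hσ hG3 hw
    · obtain ⟨C, hC⟩ := ((isCompact_sphere (0 : EuclideanSpace ℝ (Fin d)) 1).prod
        (isCompact_sphere (0 : EuclideanSpace ℝ (Fin d)) 1)).exists_bound_of_continuousOn
        (f := fun x : EuclideanSpace ℝ (Fin d) × EuclideanSpace ℝ (Fin d) =>
          p.eval (inner ℝ w x.2) * p.eval (inner ℝ x.1 x.2) * (inner ℝ w x.1 : ℝ) ^ j)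
        (Continuous.continuousOn (by fun_prop))
      refine Integrable.of_bound (C := C) (Continuous.aestronglyMeasurable (by fun_prop)) ?_
      have h1 : ∀ᵐ x ∂(σ.prod σ), ‖x.1‖ = 1 := Measure.quasiMeasurePreserving_fst.ae hσ.norm_eq
      have h2 : ∀ᵐ x ∂(σ.prod σ), ‖x.2‖ = 1 := Measure.quasiMeasurePreserving_snd.ae hσ.norm_eq
      filter_upwards [h1, h2] with x hx1 hx2
      exact hC x (by simp [hx1, hx2])
  have hself : ∀ w : EuclideanSpace ℝ (Fin d), ‖w‖ = 1 → (inner ℝ w w : ℝ) = 1 := fun w hw => by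
    rw [real_inner_self_eq_norm_sq, hw, one_pow]
  have hmain : ∀ w : EuclideanSpace ℝ (Fin d), ‖w‖ = 1 → p.eval 1 ≠ 0 ∧ 
      ∀ w' : EuclideanSpace ℝ (Fin d), ‖w'‖ = 1 →
        F.eval (inner ℝ w w') = (p.eval 1)⁻¹ * p.eval (inner ℝ w w') := by
    intro w hw
    obtain ⟨c, hc⟩ := hp.eval_eq_of_orthogonal hσ hk (hF1.trans hp.natDegree_le) hw
      (fun j hj => hpow j hj w hw)
    have h1 : F.eval 1 = 1 := by
      have := hF2 w w hw hw
      rw [hself w hw] at this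
      rw [← this, ← hp.integral_sq w hw]
      simp only [pow_two]
    have h2 := hc w hw
    rw [hself w hw, h1] at h2
    have h3 : p.eval 1 ≠ 0 := right_ne_zero_of_mul (h2 ▸ one_ne_zero)
    refine ⟨h3, fun w' hw' => ?_⟩
    rw [hc w' hw', eq_inv_of_mul_eq_one_left h2.symm]
  obtain ⟨e, he⟩ : ∃ e : EuclideanSpace ℝ (Fin d), ‖e‖ = 1 := hσ.norm_eq.exists
  have h3 := (hmain e he).1
  refine ⟨h3, ?_⟩
  constructor
  · exact (Polynomial.natDegree_C_mul_le _ _).trans hp.natDegree_le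
  · positivity
  · rw [Polynomial.eval_mul, Polynomial.eval_C, inv_mul_cancel₀ h3]
  · intro e he j hj
    simp only [Polynomial.eval_mul, Polynomial.eval_C, mul_assoc, integral_const_mul,
      hp.orthogonal e he j hj, mul_zero]
  · intro w w' hw hw'
    have h4 : ∀ z, (Polynomial.C (p.eval 1)⁻¹ * p).eval (inner ℝ w z) *
        (Polynomial.C (p.eval 1)⁻¹ * p).eval (inner ℝ w' z) =
        ((p.eval 1)⁻¹ ^ 2) * (p.eval (inner ℝ w z) * p.eval (inner ℝ w' z)) := fun z => by
      simp only [Polynomial.eval_mul, Polynomial.eval_C]; ring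
    simp only [h4]
    rw [integral_const_mul, hF2 w w' hw hw', (hmain w hw).2 w' hw', Polynomial.eval_mul,
      Polynomial.eval_C, inv_pow, div_eq_inv_mul]

namespace IsReproducing

variable {d k : ℕ} {σ : Measure (EuclideanSpace ℝ (Fin d))} {K : Polynomial ℝ} {N : ℝ}

lemma integral_sq (hK : IsReproducing σ k K N) {w : EuclideanSpace ℝ (Fin d)} (hw : ‖w‖ = 1) :
    ∫ z, K.eval (inner ℝ w z) ^ 2 ∂σ = 1 / N := by
  have := hK.reproducing w w hw hw
  rw [real_inner_self_eq_norm_sq, hw, one_pow, hK.eval_one] at this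
  simpa only [pow_two] using this

lemma abs_eval_inner_le (hK : IsReproducing σ k K N) (hσ : IsSphereLaw σ)
    {w w' : EuclideanSpace ℝ (Fin d)} (hw : ‖w‖ = 1) (hw' : ‖w'‖ = 1) :
    |K.eval (inner ℝ w w')| ≤ 1 := by
  have hN := hK.pos
  have h1 := hK.reproducing w w' hw hw'
  have h2 : ∫ z, (K.eval (inner ℝ w z) + K.eval (inner ℝ w' z)) ^ 2 ∂σ =
      2 / N + 2 * (K.eval (inner ℝ w w') / N) := by
    have : ∀ z, (K.eval (inner ℝ w z) + K.eval (inner ℝ w' z)) ^ 2 =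
      K.eval (inner ℝ w z) ^ 2 + K.eval (inner ℝ w' z) ^ 2 +
        2 * (K.eval (inner ℝ w z) * K.eval (inner ℝ w' z)) := fun z => by ring
    simp only [this]
    rw [integral_add (hσ.integrable (by fun_prop)) (hσ.integrable (by fun_prop)),
      integral_add (hσ.integrable (by fun_prop)) (hσ.integrable (by fun_prop)),
      integral_const_mul, hK.integral_sq hw, hK.integral_sq hw', h1]
    ring
  have h3 : ∫ z, (K.eval (inner ℝ w z) - K.eval (inner ℝ w' z)) ^ 2 ∂σ =
      2 / N - 2 * (K.eval (inner ℝ w w') / N) := by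
    have : ∀ z, (K.eval (inner ℝ w z) - K.eval (inner ℝ w' z)) ^ 2 =
      K.eval (inner ℝ w z) ^ 2 + K.eval (inner ℝ w' z) ^ 2 -
        2 * (K.eval (inner ℝ w z) * K.eval (inner ℝ w' z)) := fun z => by ring
    simp only [this]
    rw [integral_sub (hσ.integrable (by fun_prop)) (hσ.integrable (by fun_prop)),
      integral_add (hσ.integrable (by fun_prop)) (hσ.integrable (by fun_prop)),
      integral_const_mul, hK.integral_sq hw, hK.integral_sq hw', h1]
    ring
  have h4 : 0 ≤ 2 / N + 2 * (K.eval (inner ℝ w w') / N) :=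
    h2 ▸ integral_nonneg fun z => sq_nonneg _
  have h5 : 0 ≤ 2 / N - 2 * (K.eval (inner ℝ w w') / N) :=
    h3 ▸ integral_nonneg fun z => sq_nonneg _
  rw [show 2 / N + 2 * (K.eval (inner ℝ w w') / N) = 2 * (1 + K.eval (inner ℝ w w')) / N by ring,
    le_div_iff₀ hN] at h4
  rw [show 2 / N - 2 * (K.eval (inner ℝ w w') / N) = 2 * (1 - K.eval (inner ℝ w w')) / N by ring,
    le_div_iff₀ hN] at h5
  rw [abs_le]
  constructor <;> linarith

lemma abs_eval_le (hK : IsReproducing σ k K N) (hσ : IsSphereLaw σ) (hd : 2 ≤ d) {a : ℝ}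
    (ha : |a| ≤ 1) : |K.eval a| ≤ 1 := by
  set e₀ : EuclideanSpace ℝ (Fin d) := EuclideanSpace.single ⟨0, by omega⟩ 1
  set e₁ : EuclideanSpace ℝ (Fin d) := EuclideanSpace.single ⟨1, by omega⟩ 1
  have h0 : ‖e₀‖ = 1 := by simp [e₀]
  have h1 : ‖e₁‖ = 1 := by simp [e₁]
  have h01 : inner ℝ e₀ e₁ = 0 := by simp [e₀, e₁, EuclideanSpace.inner_single_left]
  set w := a • e₀ + √(1 - a ^ 2) • e₁
  have h2 : 0 ≤ 1 - a ^ 2 := by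
    have := sq_le_one_iff_abs_le_one a |>.2 ha
    linarith
  have hw : ‖w‖ = 1 := by
    rw [← sq_eq_sq₀ (norm_nonneg _) zero_le_one, norm_add_sq_real, inner_smul_left,
      inner_smul_right, h01, norm_smul, norm_smul, h0, h1]
    simp [Real.sq_sqrt h2]
  have h3 : inner ℝ e₀ w = a := by
    rw [inner_add_right, inner_smul_right, inner_smul_right, h01, real_inner_self_eq_norm_sq, h0]
    simp
  rw [← h3]
  exact hK.abs_eval_inner_le hσ h0 hw

end IsReproducing

lemma exists_coeff_bound (k : ℕ) : ∃ C : ℝ, 0 < C ∧ ∀ K : Polynomial ℝ, K.natDegree ≤ k →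
    (∀ a : ℝ, |a| ≤ 1 → |K.eval a| ≤ 1) → ∀ j, |K.coeff j| ≤ C := by
  set v : ℕ → ℝ := fun i => i / (k + 1) with hv
  set s := Finset.range (k + 1)
  have hvinj : Set.InjOn v s := by
    intro i _ j _ h
    simp only [hv] at h
    have : (k : ℝ) + 1 ≠ 0 := by positivity
    field_simp at h
    exact_mod_cast h
  set C : ℝ := ∑ i ∈ s, ∑ j ∈ s, |(Lagrange.basis s v i).coeff j|
  have hC : 0 ≤ C := Finset.sum_nonneg fun i _ => Finset.sum_nonneg fun j _ => abs_nonneg _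
  refine ⟨C + 1, by positivity, fun K hK hb j => ?_⟩
  rcases Nat.lt_or_ge k j with hj | hj
  · rw [Polynomial.coeff_eq_zero_of_natDegree_lt (hK.trans_lt hj), abs_zero]
    positivity
  have h1 : K = Lagrange.interpolate s v fun i => K.eval (v i) := by
    refine Lagrange.eq_interpolate hvinj ?_
    rw [Finset.card_range]
    exact lt_of_le_of_lt Polynomial.degree_le_natDegree (by exact_mod_cast Nat.lt_succ_of_le hK)
  have h2 : |K.coeff j| ≤ ∑ i ∈ s, |(Lagrange.basis s v i).coeff j| := by
    rw [h1, Lagrange.interpolate_apply, Polynomial.finsetSum_coeff]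
    refine (Finset.abs_sum_le_sum_abs _ _).trans (Finset.sum_le_sum fun i hi => ?_)
    rw [Polynomial.coeff_C_mul, abs_mul]
    refine mul_le_of_le_one_left (abs_nonneg _) (hb _ ?_)
    have : (i : ℝ) < k + 1 := by exact_mod_cast Finset.mem_range.1 hi
    rw [hv, abs_of_nonneg (by positivity), div_le_one (by positivity)]
    exact this.le
  refine (h2.trans (Finset.sum_le_sum fun i hi => ?_)).trans (le_add_of_nonneg_right zero_le_one)
  exact Finset.single_le_sum (f := fun j => |(Lagrange.basis s v i).coeff j|)
    (fun j _ => abs_nonneg _) (Finset.mem_range.2 (Nat.lt_succ_of_le hj))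

lemma one_sub_eval_le {k : ℕ} {K : Polynomial ℝ} {C : ℝ} (hK : K.natDegree ≤ k) (h1 : K.eval 1 = 1)
    (hC : ∀ j, |K.coeff j| ≤ C) {a : ℝ} (ha : |a| ≤ 1) :
    1 - K.eval a ≤ (k + 1) * k * C * (1 - a) := by
  have hC0 : 0 ≤ C := (abs_nonneg _).trans (hC 0)
  have ha' := abs_le.1 ha
  have h2 : 1 - K.eval a = ∑ j ∈ Finset.range (k + 1), K.coeff j * (1 - a ^ j) := by
    conv_lhs => rw [← h1]
    rw [Polynomial.eval_eq_sum_range' (Nat.lt_succ_of_le hK),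
      Polynomial.eval_eq_sum_range' (Nat.lt_succ_of_le hK), ← Finset.sum_sub_distrib]
    exact Finset.sum_congr rfl fun j _ => by rw [one_pow]; ring
  rw [h2]
  have h3 : ∀ j ∈ Finset.range (k + 1), K.coeff j * (1 - a ^ j) ≤ C * (k * (1 - a)) := by
    intro j hj
    have hjk : (j : ℝ) ≤ k := by exact_mod_cast Nat.lt_succ_iff.1 (Finset.mem_range.1 hj)
    have h4 : 0 ≤ 1 - a ^ j := by
      have : |a ^ j| ≤ 1 := by rw [abs_pow]; exact pow_le_one₀ (abs_nonneg _) ha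
      linarith [abs_le.1 this]
    have h5 : 1 - a ^ j ≤ j * (1 - a) := by
      have := one_add_mul_le_pow (a := a - 1) (by linarith) j
      rw [add_sub_cancel] at this
      linarith
    have h6 : (j : ℝ) * (1 - a) ≤ k * (1 - a) := mul_le_mul_of_nonneg_right hjk (by linarith)
    calc K.coeff j * (1 - a ^ j) ≤ C * (1 - a ^ j) :=
          mul_le_mul_of_nonneg_right ((le_abs_self _).trans (hC j)) h4
      _ ≤ _ := mul_le_mul_of_nonneg_left (h5.trans h6) hC0
  refine (Finset.sum_le_sum h3).trans (le_of_eq ?_)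
  rw [Finset.sum_const, Finset.card_range, nsmul_eq_mul]
  push_cast
  ring

lemma IsReproducing.pow_le_mul {d k : ℕ} {σ : Measure (EuclideanSpace ℝ (Fin d))} {K : Polynomial ℝ}
    {N : ℝ} (hK : IsReproducing σ k K N) (hσ : IsSphereLaw σ) (hk : 1 ≤ k) :
    (d : ℝ) ^ k ≤ K.coeff k ^ 2 * (6 * (gaussMoment (2 * k : ℕ)).toReal) ^ (2 * k) * N := by
  obtain ⟨e, he⟩ : ∃ e : EuclideanSpace ℝ (Fin d), ‖e‖ = 1 := by
    have := hσ.prob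
    exact hσ.norm_eq.exists
  set κ := K.coeff k
  set B := (6 * (gaussMoment (2 * k : ℕ)).toReal) ^ (2 * k)
  have hd := hσ.dim_pos
  have hN := hK.pos
  have h1 := hK.integral_sq he
  have h2 : ∫ z, K.eval (inner ℝ e z) ^ 2 ∂σ = κ * ∫ z, K.eval (inner ℝ e z) * inner ℝ e z ^ k ∂σ := by
    have h1 : ∀ z, K.eval (inner ℝ e z) ^ 2 =
        ∑ j ∈ Finset.range (k + 1), K.coeff j * (K.eval (inner ℝ e z) * (inner ℝ e z : ℝ) ^ j) :=
      fun z => by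
      rw [pow_two]
      nth_rewrite 1 [Polynomial.eval_eq_sum_range' (Nat.lt_succ_of_le hK.natDegree_le)]
      rw [Finset.sum_mul]
      exact Finset.sum_congr rfl fun j _ => by ring
    simp only [h1]
    rw [integral_finsetSum _ (fun i _ => hσ.integrable (by fun_prop)), Finset.sum_range_succ,
      integral_const_mul, Finset.sum_eq_zero, zero_add]
    intro j hj
    rw [integral_const_mul, hK.orthogonal e he j (Finset.mem_range.1 hj), mul_zero]
  have h3 : κ * ∫ z, K.eval (inner ℝ e z) * inner ℝ e z ^ k ∂σ ≤
      1 / 2 * (1 / N) + κ ^ 2 / 2 * ∫ z, (inner ℝ e z : ℝ) ^ (2 * k) ∂σ := by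
    rw [← h1, ← integral_const_mul, ← integral_const_mul, ← integral_const_mul,
      ← integral_add (hσ.integrable (by fun_prop)) (hσ.integrable (by fun_prop))]
    refine integral_mono (hσ.integrable (by fun_prop)) (hσ.integrable (by fun_prop)) fun z => ?_
    have := sq_nonneg (K.eval (inner ℝ e z) - κ * (inner ℝ e z : ℝ) ^ k)
    simp only [mul_comm 2 k, pow_mul]
    nlinarith
  have h4 := hσ.integral_inner_pow_le he hk
  have h5 : 1 / N ≤ κ ^ 2 * (B / d ^ k) := by
    have : κ ^ 2 / 2 * ∫ z, (inner ℝ e z : ℝ) ^ (2 * k) ∂σ ≤ κ ^ 2 / 2 * (B / d ^ k) :=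
      mul_le_mul_of_nonneg_left h4 (by positivity)
    linarith
  rw [← mul_div_assoc, div_le_div_iff₀ hN (by positivity), one_mul] at h5
  exact h5

lemma IsReproducing.exists_bounds (k : ℕ) (hk : 1 ≤ k) : ∃ C : ℝ, 1 ≤ C ∧
    ∀ (d : ℕ) (σ : Measure (EuclideanSpace ℝ (Fin d))) (K : Polynomial ℝ) (N : ℝ), 2 ≤ d →
      IsSphereLaw σ → IsReproducing σ k K N → (d : ℝ) ^ k ≤ C * N ∧
      ∀ a : ℝ, |a| ≤ 1 → 1 - K.eval a ≤ C * (1 - a) := by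
  obtain ⟨c, hc, h⟩ := exists_coeff_bound k
  set B := (6 * (gaussMoment (2 * k : ℕ)).toReal) ^ (2 * k)
  have hB : 0 ≤ B := by positivity
  refine ⟨1 + c ^ 2 * B + (k + 1) * k * c, by
    have : 0 ≤ c ^ 2 * B + (k + 1) * k * c := by positivity
    linarith, fun d σ K N hd hσ hK => ?_⟩
  have h1 := h K hK.natDegree_le (fun a ha => hK.abs_eval_le hσ hd ha)
  have hN := hK.pos
  constructor
  · refine (hK.pow_le_mul hσ hk).trans (mul_le_mul_of_nonneg_right ?_ hN.le)
    have h2 : K.coeff k ^ 2 ≤ c ^ 2 := sq_le_sq' (by linarith [abs_le.1 (h1 k)]) (abs_le.1 (h1 k)).2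
    have h3 : 0 ≤ (k + 1) * k * c := by positivity
    have h4 := mul_le_mul_of_nonneg_right h2 hB
    linarith
  · intro a ha
    refine (one_sub_eval_le hK.natDegree_le hK.eval_one h1 ha).trans
      (mul_le_mul_of_nonneg_right ?_ (by linarith [abs_le.1 ha]))
    have : 0 ≤ c ^ 2 * B := by positivity
    linarith

lemma exists_pow_le_sphDim (k : ℕ) (hk : 1 ≤ k) : ∃ C : ℝ, 0 < C ∧ ∀ᶠ d : ℕ in atTop,
    (d : ℝ) ^ k ≤ C * sphDim d k := by
  rcases Nat.lt_or_ge k 2 with h | h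
  · obtain rfl : k = 1 := by omega
    exact ⟨1, one_pos, Eventually.of_forall fun d => by simp [sphDim]⟩
  refine ⟨2 ^ k * (k - 1).factorial * (k + k), by positivity, ?_⟩
  filter_upwards [eventually_ge_atTop (2 * k + 4)] with d hd
  set c := (d + k - 3).choose (k - 1) with hc
  have h1 : (d - 1) ^ (k - 1) ≤ (k - 1).factorial * c := by
    rw [hc, ← Nat.descFactorial_eq_factorial_mul_choose]
    have := Nat.pow_sub_le_descFactorial (d + k - 3) (k - 1)
    rwa [show d + k - 3 + 1 - (k - 1) = d - 1 by omega] at this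
  have h2 : d ^ (k - 1) ≤ 2 ^ (k - 1) * ((k - 1).factorial * c) := by
    refine le_trans ?_ (Nat.mul_le_mul_left _ h1)
    rw [← mul_pow]
    exact Nat.pow_le_pow_left (by omega) _
  have hc1 : 1 ≤ c := Nat.choose_pos (by omega)
  have h3 : sphDim d k = ((d + 2 * k - 2) * c) / k := by
    rw [sphDim, if_neg (by omega), if_neg (by omega)]
  have h4 : 1 ≤ sphDim d k := by
    rw [h3, Nat.one_le_div_iff (by omega)]
    nlinarith [show k ≤ d + 2 * k - 2 by omega]
  have h5 : d * c ≤ (k + k) * sphDim d k := by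
    have h6 : (d + 2 * k - 2) * c < k * (sphDim d k + 1) := by
      rw [h3]; exact Nat.lt_mul_div_succ _ (by omega)
    have h7 : d * c ≤ (d + 2 * k - 2) * c := Nat.mul_le_mul_right _ (by omega)
    nlinarith
  have h6 : d ^ k ≤ 2 ^ k * (k - 1).factorial * (k + k) * sphDim d k := by
    calc d ^ k = d * d ^ (k - 1) := by rw [← pow_succ', Nat.sub_add_cancel hk]
      _ ≤ d * (2 ^ (k - 1) * ((k - 1).factorial * c)) := Nat.mul_le_mul_left _ h2
      _ = 2 ^ (k - 1) * (k - 1).factorial * (d * c) := by ring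
      _ ≤ 2 ^ k * (k - 1).factorial * ((k + k) * sphDim d k) :=
        Nat.mul_le_mul (Nat.mul_le_mul_right _ (Nat.pow_le_pow_right two_pos (by omega))) h5
      _ = _ := by ring
  exact_mod_cast h6

namespace IsSphereLaw

variable {d : ℕ} {σ : Measure (EuclideanSpace ℝ (Fin d))}

lemma memLp (hσ : IsSphereLaw σ) {f : EuclideanSpace ℝ (Fin d) → ℝ} (hf : Continuous f) :
    MemLp f 2 σ := by
  have := hσ.prob
  obtain ⟨C, hC⟩ := (isCompact_sphere (0 : EuclideanSpace ℝ (Fin d)) 1).exists_bound_of_continuousOn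
    hf.continuousOn
  refine MemLp.of_bound hf.aestronglyMeasurable C ?_
  filter_upwards [hσ.norm_eq] with x hx
  exact hC x (by simpa using hx)

/-- A continuous function seen in `L²` of a sphere law. -/
def toL2 (hσ : IsSphereLaw σ) (f : C(EuclideanSpace ℝ (Fin d), ℝ)) : Lp ℝ 2 σ :=
  (hσ.memLp f.continuous).toLp f

lemma toL2_add (hσ : IsSphereLaw σ) (f g : C(EuclideanSpace ℝ (Fin d), ℝ)) :
    hσ.toL2 (f + g) = hσ.toL2 f + hσ.toL2 g := MemLp.toLp_add _ _

lemma toL2_smul (hσ : IsSphereLaw σ) (c : ℝ) (f : C(EuclideanSpace ℝ (Fin d), ℝ)) :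
    hσ.toL2 (c • f) = c • hσ.toL2 f := MemLp.toLp_const_smul _ _

/-- `toL2` as a linear map. -/
def toL2Linear (hσ : IsSphereLaw σ) : C(EuclideanSpace ℝ (Fin d), ℝ) →ₗ[ℝ] Lp ℝ 2 σ where
  toFun := hσ.toL2
  map_add' := hσ.toL2_add
  map_smul' := hσ.toL2_smul

lemma inner_toL2 (hσ : IsSphereLaw σ) (f g : C(EuclideanSpace ℝ (Fin d), ℝ)) :
    inner ℝ (hσ.toL2Linear f) (hσ.toL2Linear g) = ∫ z, f z * g z ∂σ := by
  rw [L2.inner_def]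
  refine integral_congr_ae ?_
  filter_upwards [(hσ.memLp f.continuous).coeFn_toLp, (hσ.memLp g.continuous).coeFn_toLp]
    with z h1 h2
  change inner ℝ ((hσ.memLp f.continuous).toLp f z) ((hσ.memLp g.continuous).toLp g z) = _
  rw [h1, h2]
  simp [mul_comm]

end IsSphereLaw

/-- The continuous function `z ↦ K ⟨w, z⟩`. -/
def zonalFun {d : ℕ} (K : Polynomial ℝ) (w : EuclideanSpace ℝ (Fin d)) :
    C(EuclideanSpace ℝ (Fin d), ℝ) :=
  ⟨fun z => K.eval (inner ℝ w z), by fun_prop⟩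

/-- The monomial with index word `s`. -/
def wordMonomial {d : ℕ} {k : ℕ} (s : Σ j : Fin (k + 1), (Fin j → Fin d)) :
    C(EuclideanSpace ℝ (Fin d), ℝ) :=
  ⟨fun z => ∏ i, z (s.2 i), by fun_prop⟩

lemma zonalFun_mem_span {d k : ℕ} {K : Polynomial ℝ} (hK : K.natDegree ≤ k)
    (w : EuclideanSpace ℝ (Fin d)) :
    zonalFun K w ∈ Submodule.span ℝ (Set.range (wordMonomial (d := d) (k := k))) := by
  have h : zonalFun K w = ∑ j : Fin (k + 1), ∑ s : Fin j → Fin d,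
      (K.coeff j * ∏ i, w (s i)) • wordMonomial (d := d) (k := k) ⟨j, s⟩ := by
    ext z
    simp only [zonalFun, wordMonomial, ContinuousMap.coe_mk, ContinuousMap.sum_apply,
      ContinuousMap.smul_apply, smul_eq_mul]
    rw [Polynomial.eval_eq_sum_range' (Nat.lt_succ_of_le hK), Finset.sum_range]
    refine Finset.sum_congr rfl fun j _ => ?_
    have : (inner ℝ w z : ℝ) = ∑ i, w i * z i := by
      simp [PiLp.inner_apply, mul_comm]
    rw [this, Fintype.sum_pow, Finset.mul_sum]
    refine Finset.sum_congr rfl fun s _ => ?_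
    rw [Finset.prod_mul_distrib]
    ring
  rw [h]
  exact Submodule.sum_mem _ fun j _ => Submodule.sum_mem _ fun s _ =>
    Submodule.smul_mem _ _ (Submodule.subset_span ⟨_, rfl⟩)

/-- An isotropic family of `R` functions on the sphere whose Gram kernel is `K`. -/
structure IsFeature {d : ℕ} (σ : Measure (EuclideanSpace ℝ (Fin d))) (K : Polynomial ℝ) {R : ℕ}
    (y : EuclideanSpace ℝ (Fin d) → Fin R → ℝ) : Prop where
  continuous : Continuous y
  dotProduct_eq : ∀ w w', ‖w‖ = 1 → ‖w'‖ = 1 → y w ⬝ᵥ y w' = K.eval (inner ℝ w w')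
  integral_mul : ∀ s t, ∫ w, y w s * y w t ∂σ = if s = t then 1 / (R : ℝ) else 0

lemma IsReproducing.exists_isFeature {d k : ℕ} {σ : Measure (EuclideanSpace ℝ (Fin d))}
    {K : Polynomial ℝ} {N : ℝ} (hK : IsReproducing σ k K N) (hσ : IsSphereLaw σ) :
    ∃ R : ℕ, (R : ℝ) = N ∧ R ≤ (k + 1) * d ^ k ∧
      ∃ y : EuclideanSpace ℝ (Fin d) → Fin R → ℝ, IsFeature σ K y := by
  have := hσ.prob
  have hN := hK.pos
  set L := hσ.toL2Linear
  set V₀ := Submodule.span ℝ (Set.range (wordMonomial (d := d) (k := k)))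
  set U := Submodule.span ℝ (zonalFun (d := d) K '' {w | ‖w‖ = 1})
  have hU : U ≤ V₀ := Submodule.span_le.2 (by
    rintro _ ⟨w, -, rfl⟩; exact zonalFun_mem_span hK.natDegree_le w)
  have hV₀ : FiniteDimensional ℝ V₀ := FiniteDimensional.span_of_finite ℝ (Set.finite_range _)
  have hUf : FiniteDimensional ℝ U := Submodule.finiteDimensional_of_le hU
  set V := U.map L
  have hVf : FiniteDimensional ℝ V := inferInstance
  set R := Module.finrank ℝ V with hR
  have hRle : R ≤ (k + 1) * d ^ k := by
    have h1 : R ≤ Module.finrank ℝ U := Submodule.finrank_map_le _ _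
    have h2 : Module.finrank ℝ U ≤ Module.finrank ℝ V₀ := Submodule.finrank_mono hU
    have h3 : Module.finrank ℝ V₀ ≤ Fintype.card (Σ j : Fin (k + 1), (Fin j → Fin d)) :=
      finrank_range_le_card _
    have h4 : Fintype.card (Σ j : Fin (k + 1), (Fin j → Fin d)) ≤ (k + 1) * d ^ k := by
      rw [Fintype.card_sigma]
      have : ∀ j ∈ (Finset.univ : Finset (Fin (k + 1))),
          Fintype.card (Fin (j : ℕ) → Fin d) ≤ d ^ k := fun j _ => by
        rw [Fintype.card_fun, Fintype.card_fin, Fintype.card_fin]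
        exact Nat.pow_le_pow_right hσ.dim_pos (Nat.lt_succ_iff.1 j.2)
      refine (Finset.sum_le_sum this).trans ?_
      simp
    omega
  have hrep : ∀ g ∈ U, ∀ w : EuclideanSpace ℝ (Fin d), ‖w‖ = 1 →
      inner ℝ (L g) (L (zonalFun K w)) = g w / N := by
    intro g hg
    induction hg using Submodule.span_induction with
    | mem g h =>
      obtain ⟨u, hu, rfl⟩ := h
      intro w hw
      rw [hσ.inner_toL2]
      simp only [zonalFun, ContinuousMap.coe_mk]
      exact hK.reproducing u w hu hw
    | zero => intro w hw; simp
    | add f g _ _ hf hg =>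
      intro w hw
      rw [map_add, inner_add_left, hf w hw, hg w hw, ContinuousMap.add_apply, add_div]
    | smul c f _ hf =>
      intro w hw
      rw [map_smul, inner_smul_left, hf w hw]
      simp [mul_div_assoc]
  set b := stdOrthonormalBasis ℝ V
  have hb : ∀ s : Fin R, ∃ g ∈ U, L g = b s := fun s => (b s).2
  choose g hgU hg using hb
  have horth : ∀ s t, ∫ w, g s w * g t w ∂σ = if s = t then 1 else 0 := fun s t => by
    rw [← hσ.inner_toL2]
    change inner ℝ (L (g s)) (L (g t)) = _
    rw [hg, hg, ← Submodule.coe_inner]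
    exact orthonormal_iff_ite.1 b.orthonormal s t
  have hdot : ∀ w w' : EuclideanSpace ℝ (Fin d), ‖w‖ = 1 → ‖w'‖ = 1 →
      ∑ s, g s w * g s w' = N * K.eval (inner ℝ w w') := by
    intro w w' hw hw'
    have h1 : ∀ w, ‖w‖ = 1 → L (zonalFun K w) ∈ V := fun w hw =>
      Submodule.mem_map_of_mem (Submodule.subset_span ⟨w, hw, rfl⟩)
    have h2 := b.sum_inner_mul_inner ⟨_, h1 w hw⟩ ⟨_, h1 w' hw'⟩
    simp only [Submodule.coe_inner, ← hg] at h2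
    rw [hσ.inner_toL2] at h2
    have h3 : ∀ s, inner ℝ (L (zonalFun K w)) (L (g s)) = g s w / N := fun s => by
      rw [real_inner_comm, hrep _ (hgU s) w hw]
    simp only [h3, hrep _ (hgU _) w' hw'] at h2
    have h4 := hK.reproducing w w' hw hw'
    simp only [zonalFun, ContinuousMap.coe_mk] at h2
    rw [h4] at h2
    have h5 : ∀ s, g s w / N * (g s w' / N) = (g s w * g s w') / N ^ 2 := fun s => by
      rw [div_mul_div_comm, pow_two]
    simp only [h5, ← Finset.sum_div] at h2
    rw [div_eq_div_iff (by positivity) hN.ne'] at h2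
    have h6 : (∑ s, g s w * g s w' - N * K.eval (inner ℝ w w')) * N = 0 := by linarith
    exact sub_eq_zero.1 ((mul_eq_zero.1 h6).resolve_right hN.ne')
  have hRN : (R : ℝ) = N := by
    have h1 : ∫ w, ∑ s, g s w * g s w ∂σ = N := by
      rw [integral_congr_ae (g := fun _ => N)]
      · simp
      · filter_upwards [hσ.norm_eq] with w hw
        rw [hdot w w hw hw, real_inner_self_eq_norm_sq, hw, one_pow, hK.eval_one, mul_one]
    rw [integral_finsetSum _ (fun s _ => hσ.integrable (by fun_prop))] at h1
    simpa [horth] using h1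
  refine ⟨R, hRN, hRle, fun w s => (√N)⁻¹ * g s w, ⟨by fun_prop, fun w w' hw hw' => ?_, fun s t => ?_⟩⟩
  · simp only [dotProduct]
    have : ∀ s, (√N)⁻¹ * g s w * ((√N)⁻¹ * g s w') = N⁻¹ * (g s w * g s w') := fun s => by
      rw [mul_mul_mul_comm, ← mul_inv, Real.mul_self_sqrt hN.le]
    simp only [this, ← Finset.mul_sum, hdot w w' hw hw']
    field_simp
  · have : ∀ w, (√N)⁻¹ * g s w * ((√N)⁻¹ * g t w) = N⁻¹ * (g s w * g t w) := fun w => by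
      rw [mul_mul_mul_comm, ← mul_inv, Real.mul_self_sqrt hN.le]
    simp only [this, integral_const_mul, horth, hRN]
    split_ifs <;> simp

namespace IsFeature

variable {d : ℕ} {σ : Measure (EuclideanSpace ℝ (Fin d))} {K : Polynomial ℝ} {R : ℕ}
  {y : EuclideanSpace ℝ (Fin d) → Fin R → ℝ}

lemma dotProduct_self (hy : IsFeature σ K y) (hK : K.eval 1 = 1) {w : EuclideanSpace ℝ (Fin d)}
    (hw : ‖w‖ = 1) : y w ⬝ᵥ y w = 1 := by
  rw [hy.dotProduct_eq w w hw hw, real_inner_self_eq_norm_sq, hw, one_pow, hK]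

lemma sqrt_dotProduct_sub_le (hy : IsFeature σ K y) (hK : K.eval 1 = 1) {C : ℝ}
    (hC : ∀ a : ℝ, |a| ≤ 1 → 1 - K.eval a ≤ C * (1 - a)) {w w' : EuclideanSpace ℝ (Fin d)}
    (hw : ‖w‖ = 1) (hw' : ‖w'‖ = 1) :
    √((y w - y w') ⬝ᵥ (y w - y w')) ≤ √C * ‖w - w'‖ := by
  have h1 : (y w - y w') ⬝ᵥ (y w - y w') = 2 * (1 - K.eval (inner ℝ w w')) := by
    rw [sub_dotProduct, dotProduct_sub, dotProduct_sub, hy.dotProduct_self hK hw,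
      hy.dotProduct_self hK hw', dotProduct_comm (y w') (y w), hy.dotProduct_eq w w' hw hw']
    ring
  have h2 : |(inner ℝ w w' : ℝ)| ≤ 1 := by
    simpa [hw, hw'] using abs_real_inner_le_norm w w'
  have h3 : ‖w - w'‖ ^ 2 = 2 * (1 - inner ℝ w w') := by
    rw [norm_sub_sq_real, hw, hw']; ring
  rw [← Real.sqrt_sq (norm_nonneg (w - w')), ← Real.sqrt_mul' _ (sq_nonneg _)]
  refine Real.sqrt_le_sqrt ?_
  rw [h1, h3]
  linarith [hC _ h2]

lemma lipschitzOnWith_quadratic (hy : IsFeature σ K y) (hK : K.eval 1 = 1) {C : ℝ}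
    (hC : ∀ a : ℝ, |a| ≤ 1 → 1 - K.eval a ≤ C * (1 - a)) {M : Matrix (Fin R) (Fin R) ℝ} {a : ℝ}
    (ha : 0 ≤ a) (hM : ∀ x z : Fin R → ℝ, |x ⬝ᵥ M.mulVec z| ≤ a * √(x ⬝ᵥ x) * √(z ⬝ᵥ z)) :
    LipschitzOnWith (Real.toNNReal (2 * a * √C)) (fun w => y w ⬝ᵥ M.mulVec (y w))
      (Metric.sphere 0 1) := by
  refine LipschitzOnWith.of_dist_le_mul fun w hw w' hw' => ?_
  replace hw : ‖w‖ = 1 := by simpa using hw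
  replace hw' : ‖w'‖ = 1 := by simpa using hw'
  rw [Real.coe_toNNReal _ (by positivity), Real.dist_eq, dist_eq_norm]
  have h1 : y w ⬝ᵥ M.mulVec (y w) - y w' ⬝ᵥ M.mulVec (y w') =
      (y w - y w') ⬝ᵥ M.mulVec (y w) + y w' ⬝ᵥ M.mulVec (y w - y w') := by
    rw [sub_dotProduct, Matrix.mulVec_sub, dotProduct_sub]; ring
  have h2 := hM (y w - y w') (y w)
  have h3 := hM (y w') (y w - y w')
  rw [hy.dotProduct_self hK hw, Real.sqrt_one, mul_one] at h2
  rw [hy.dotProduct_self hK hw', Real.sqrt_one, mul_one] at h3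
  have h4 := mul_le_mul_of_nonneg_left (hy.sqrt_dotProduct_sub_le hK hC hw hw') ha
  rw [h1]
  refine (abs_add_le _ _).trans ?_
  linarith

lemma integral_quadratic (hy : IsFeature σ K y) (hσ : IsSphereLaw σ)
    (M : Matrix (Fin R) (Fin R) ℝ) :
    ∫ w, y w ⬝ᵥ M.mulVec (y w) ∂σ = M.trace / R := by
  have hc := hy.continuous
  have h1 : ∀ w, y w ⬝ᵥ M.mulVec (y w) = ∑ s, ∑ t, M s t * (y w s * y w t) := fun w => by
    simp only [dotProduct, Matrix.mulVec, Finset.mul_sum]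
    exact Finset.sum_congr rfl fun s _ => Finset.sum_congr rfl fun t _ => by ring
  simp only [h1]
  rw [integral_finsetSum _ (fun i _ => hσ.integrable (by fun_prop)), Matrix.trace, Finset.sum_div]
  refine Finset.sum_congr rfl fun s _ => ?_
  rw [integral_finsetSum _ (fun i _ => hσ.integrable (by fun_prop))]
  simp only [integral_const_mul, hy.integral_mul, mul_ite, mul_zero, Finset.sum_ite_eq,
    Finset.mem_univ, if_true, Matrix.diag_apply]
  ring

lemma measure_quadratic_le (hy : IsFeature σ K y) (hσ : IsSphereLaw σ) (hK : K.eval 1 = 1) {C : ℝ}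
    (hC : ∀ a : ℝ, |a| ≤ 1 → 1 - K.eval a ≤ C * (1 - a)) {M : Matrix (Fin R) (Fin R) ℝ} {a : ℝ}
    (ha : 0 < a) (hM : ∀ x z : Fin R → ℝ, |x ⬝ᵥ M.mulVec z| ≤ a * √(x ⬝ᵥ x) * √(z ⬝ᵥ z))
    {r : ℕ} (hr : 2 ≤ r) {η : ℝ} (hη : 0 < η) :
    σ {w | M.trace / R + a * η ≤ y w ⬝ᵥ M.mulVec (y w)} ≤
      ENNReal.ofReal ((12 * √C * (gaussMoment r).toReal / (√d * η)) ^ r) := by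
  have h1 := hσ.measure_deviation_le (hy.lipschitzOnWith_quadratic hK hC ha.le hM) hr
    (mul_pos ha hη)
  rw [hy.integral_quadratic hσ, Real.coe_toNNReal _ (by positivity)] at h1
  refine (measure_mono fun w hw => ?_).trans (h1.trans (le_of_eq ?_))
  · simp only [Set.mem_ofPred_eq] at hw ⊢
    exact le_trans (by linarith) (le_abs_self _)
  · congr 2
    have : (0 : ℝ) < √d := Real.sqrt_pos.2 (by exact_mod_cast hσ.dim_pos)
    field_simp
    ring

end IsFeature

section MatrixLemmas

open Matrix

variable {n : Type*} [Fintype n] [DecidableEq n]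

/-- The matrix with eigenvalues `v` and eigenvectors the columns of `U`. -/
def diagConj (U : Matrix n n ℝ) (v : n → ℝ) : Matrix n n ℝ := U * diagonal v * Uᵀ

lemma diagConj_mul {U : Matrix n n ℝ} (hU : Uᵀ * U = 1) (v w : n → ℝ) :
    diagConj U v * diagConj U w = diagConj U (v * w) := by
  simp only [diagConj]
  rw [show U * diagonal v * Uᵀ * (U * diagonal w * Uᵀ) =
    U * diagonal v * (Uᵀ * U) * diagonal w * Uᵀ by simp only [Matrix.mul_assoc], hU, Matrix.mul_one,
    Matrix.mul_assoc U, diagonal_mul_diagonal]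
  rfl

lemma diagConj_one {U : Matrix n n ℝ} (hU' : U * Uᵀ = 1) : diagConj U 1 = 1 := by
  simp [diagConj, hU']

lemma diagConj_add (U : Matrix n n ℝ) (v w : n → ℝ) :
    diagConj U (v + w) = diagConj U v + diagConj U w := by
  simp only [diagConj]
  rw [← Matrix.add_mul, ← Matrix.mul_add, diagonal_add]
  rfl

lemma diagConj_pow {U : Matrix n n ℝ} (hU : Uᵀ * U = 1) (hU' : U * Uᵀ = 1) (v : n → ℝ) (j : ℕ) :
    diagConj U v ^ j = diagConj U (v ^ j) := by
  induction j with
  | zero => rw [pow_zero, pow_zero, diagConj_one hU']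
  | succ j ih => rw [pow_succ, ih, diagConj_mul hU, pow_succ]

lemma diagConj_add_smul_one {U : Matrix n n ℝ} (hU' : U * Uᵀ = 1) (v : n → ℝ) (c : ℝ) :
    diagConj U v + c • (1 : Matrix n n ℝ) = diagConj U (fun i => v i + c) := by
  have h : (fun i => v i + c) = v + c • (1 : n → ℝ) := by ext; simp
  rw [h, diagConj_add, ← diagConj_one hU', add_right_inj]
  simp [diagConj, diagonal_smul]

lemma diagConj_inv {U : Matrix n n ℝ} (hU : Uᵀ * U = 1) (hU' : U * Uᵀ = 1) {v : n → ℝ}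
    (hv : ∀ i, v i ≠ 0) : (diagConj U v)⁻¹ = diagConj U (v⁻¹) := by
  refine inv_eq_right_inv ?_
  rw [diagConj_mul hU, ← diagConj_one hU']
  congr 1
  ext i
  simp [hv i]

lemma diagConj_trace {U : Matrix n n ℝ} (hU : Uᵀ * U = 1) (v : n → ℝ) :
    (diagConj U v).trace = ∑ i, v i := by
  rw [diagConj, trace_mul_comm, ← Matrix.mul_assoc, hU, Matrix.one_mul, trace_diagonal]

lemma diagConj_bilin (U : Matrix n n ℝ) (v x z : n → ℝ) :
    x ⬝ᵥ (diagConj U v) *ᵥ z = ∑ i, v i * (Uᵀ *ᵥ x) i * (Uᵀ *ᵥ z) i := by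
  rw [diagConj, ← mulVec_mulVec, ← mulVec_mulVec, dotProduct_mulVec, ← mulVec_transpose, dotProduct]
  refine Finset.sum_congr rfl fun i _ => ?_
  rw [mulVec_diagonal]
  ring

lemma transpose_mulVec_dotProduct {U : Matrix n n ℝ} (hU' : U * Uᵀ = 1) (x z : n → ℝ) :
    (Uᵀ *ᵥ x) ⬝ᵥ (Uᵀ *ᵥ z) = x ⬝ᵥ z := by
  rw [dotProduct_mulVec, vecMul_transpose, mulVec_mulVec, hU', one_mulVec]

lemma exists_eq_diagConj {P : Matrix n n ℝ} (hP : P.PosDef) :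
    ∃ (U : Matrix n n ℝ) (v : n → ℝ), Uᵀ * U = 1 ∧ U * Uᵀ = 1 ∧ (∀ i, 0 < v i) ∧
      P = diagConj U v := by
  refine ⟨hP.1.eigenvectorUnitary, hP.1.eigenvalues, ?_, ?_, hP.eigenvalues_pos, ?_⟩
  · have := Unitary.coe_star_mul_self hP.1.eigenvectorUnitary
    rwa [star_eq_conjTranspose, conjTranspose_eq_transpose_of_trivial] at this
  · have := Unitary.coe_mul_star_self hP.1.eigenvectorUnitary
    rwa [Unitary.coe_star, star_eq_conjTranspose, conjTranspose_eq_transpose_of_trivial] at this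
  · have := hP.1.spectral_theorem
    rw [Unitary.conjStarAlgAut_apply, star_eq_conjTranspose,
      conjTranspose_eq_transpose_of_trivial] at this
    exact this

lemma abs_sum_mul_le {ι : Type*} [Fintype ι] {v a b : ι → ℝ} {c : ℝ} (hc : ∀ i, |v i| ≤ c) :
    |∑ i, v i * a i * b i| ≤ c * √(a ⬝ᵥ a) * √(b ⬝ᵥ b) := by
  calc |∑ i, v i * a i * b i| ≤ ∑ i, |v i * a i * b i| := Finset.abs_sum_le_sum_abs _ _
    _ ≤ ∑ i, c * (|a i| * |b i|) := Finset.sum_le_sum fun i _ => by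
        rw [abs_mul, abs_mul, mul_assoc]
        exact mul_le_mul_of_nonneg_right (hc i) (by positivity)
    _ = c * ∑ i, |a i| * |b i| := by rw [Finset.mul_sum]
    _ ≤ c * (√(∑ i, |a i| ^ 2) * √(∑ i, |b i| ^ 2)) := by
        rcases isEmpty_or_nonempty ι with h | ⟨⟨i⟩⟩
        · simp
        · exact mul_le_mul_of_nonneg_left (Real.sum_mul_le_sqrt_mul_sqrt _ _ _)
            ((abs_nonneg _).trans (hc i))
    _ = c * √(a ⬝ᵥ a) * √(b ⬝ᵥ b) := by
        simp only [sq_abs, dotProduct, ← pow_two, mul_assoc]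

/-- Bounds for the powers of the resolvent of a positive definite matrix in terms of a trace. -/
lemma resolvent_bilin_le {P : Matrix n n ℝ} (hP : P.PosDef) {α : ℝ} (hα : 0 ≤ α) {m : ℕ}
    (hm : m ≠ 0) (h : ((P⁻¹) ^ m).trace ≤ α ^ m) (j : ℕ) (x z : n → ℝ) :
    |x ⬝ᵥ (P⁻¹ ^ j) *ᵥ z| ≤ α ^ j * √(x ⬝ᵥ x) * √(z ⬝ᵥ z) := by
  obtain ⟨U, v, hU, hU', hv, rfl⟩ := exists_eq_diagConj hP
  rw [diagConj_inv hU hU' fun i => (hv i).ne', diagConj_pow hU hU'] at h ⊢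
  rw [diagConj_trace hU] at h
  rw [diagConj_bilin, ← transpose_mulVec_dotProduct hU' x x, ← transpose_mulVec_dotProduct hU' z z]
  refine abs_sum_mul_le fun i => ?_
  have hi : 0 < (v⁻¹) i := inv_pos.2 (hv i)
  have h1 : (v⁻¹) i ^ m ≤ α ^ m :=
    (Finset.single_le_sum (f := fun i => (v⁻¹ ^ m) i)
      (fun i _ => pow_nonneg (inv_pos.2 (hv i)).le _) (Finset.mem_univ i)).trans h
  have h2 := le_of_pow_le_pow_left₀ hm hα h1
  rw [Pi.pow_apply, abs_of_pos (pow_pos hi j)]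
  exact pow_le_pow_left₀ hi.le h2 j

lemma resolvent_trace_pow_le {P : Matrix n n ℝ} (hP : P.PosDef) {m : ℕ} (hm : m ≠ 0) :
    (P⁻¹.trace / Fintype.card n) ^ m ≤ (P⁻¹ ^ m).trace / Fintype.card n := by
  obtain ⟨U, v, hU, hU', hv, rfl⟩ := exists_eq_diagConj hP
  rw [diagConj_inv hU hU' fun i => (hv i).ne', diagConj_pow hU hU', diagConj_trace hU,
    diagConj_trace hU]
  obtain ⟨m, rfl⟩ := Nat.exists_eq_succ_of_ne_zero hm
  rcases isEmpty_or_nonempty n with h | h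
  · simp
  have h1 := pow_sum_div_card_le_sum_pow (s := Finset.univ) (f := v⁻¹) (n := m)
    fun i _ => (inv_pos.2 (hv i)).le
  have hc : (0 : ℝ) < Fintype.card n := by exact_mod_cast Fintype.card_pos
  rw [Finset.card_univ, div_le_iff₀ (by positivity)] at h1
  rw [div_pow, div_le_div_iff₀ (by positivity) hc, Nat.succ_eq_add_one, pow_succ (Fintype.card n : ℝ),
    ← mul_assoc]
  exact mul_le_mul_of_nonneg_right h1 hc.le

lemma resolvent_shift {P : Matrix n n ℝ} (hP : P.PosDef) {δ : ℝ} (hδ : 0 ≤ δ) (m : ℕ) :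
    (((P + δ • (1 : Matrix n n ℝ))⁻¹) ^ m).trace +
      m * δ * (((P + δ • (1 : Matrix n n ℝ))⁻¹) ^ (m + 1)).trace ≤ (P⁻¹ ^ m).trace := by
  obtain ⟨U, v, hU, hU', hv, rfl⟩ := exists_eq_diagConj hP
  have hv' : ∀ i, 0 < v i + δ := fun i => by have := hv i; positivity
  rw [diagConj_add_smul_one hU', diagConj_inv hU hU' fun i => (hv i).ne',
    diagConj_inv hU hU' fun i => (hv' i).ne']
  simp only [diagConj_pow hU hU', diagConj_trace hU]
  rw [Finset.mul_sum, ← Finset.sum_add_distrib]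
  refine Finset.sum_le_sum fun i _ => ?_
  simp only [Pi.pow_apply, Pi.inv_apply]
  have h1 := one_add_mul_le_pow (a := δ / v i) (by have := hv i; have : 0 ≤ δ / v i := by positivity
                                                   linarith) m
  have h2 : (v i)⁻¹ = (v i + δ)⁻¹ * (1 + δ / v i) := by
    have := (hv i).ne'
    have := (hv' i).ne'
    field_simp
  have h3 : (v i + δ)⁻¹ ≤ (v i)⁻¹ := inv_anti₀ (hv i) (by linarith)
  rw [h2, mul_pow, pow_succ]
  have h4 : (v i + δ)⁻¹ ^ m * (1 + m * (δ / v i)) ≤ (v i + δ)⁻¹ ^ m * (1 + δ / v i) ^ m :=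
    mul_le_mul_of_nonneg_left h1 (by have := hv' i; positivity)
  refine le_trans ?_ h4
  rw [div_eq_mul_inv, mul_add, mul_one, add_le_add_iff_left]
  have h5 : 0 ≤ (v i + δ)⁻¹ ^ m := by have := hv' i; positivity
  calc m * δ * ((v i + δ)⁻¹ ^ m * (v i + δ)⁻¹) = (v i + δ)⁻¹ ^ m * (m * (δ * (v i + δ)⁻¹)) := by ring
    _ ≤ _ := by gcongr

lemma resolvent_chebyshev {P : Matrix n n ℝ} (hP : P.PosDef) (y : n → ℝ) (i j : ℕ) :
    (y ⬝ᵥ (P⁻¹ ^ (i + 1)) *ᵥ y) * (y ⬝ᵥ (P⁻¹ ^ (j + 1)) *ᵥ y) ≤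
      (y ⬝ᵥ P⁻¹ *ᵥ y) * (y ⬝ᵥ (P⁻¹ ^ (i + j + 1)) *ᵥ y) := by
  obtain ⟨U, v, hU, hU', hv, rfl⟩ := exists_eq_diagConj hP
  rw [diagConj_inv hU hU' fun i => (hv i).ne']
  simp only [diagConj_pow hU hU', diagConj_bilin]
  set l := v⁻¹ with hl
  have hl0 : ∀ i, 0 ≤ l i := fun i => (inv_pos.2 (hv i)).le
  set c := Uᵀ *ᵥ y
  set ω : n → ℝ := fun s => l s * c s * c s
  have hω : ∀ s, 0 ≤ ω s := fun s => by
    have := hl0 s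
    simp only [ω, mul_assoc]
    exact mul_nonneg this (mul_self_nonneg _)
  have hs : ∀ i, ∑ s, (l ^ (i + 1)) s * c s * c s = ∑ s, ω s * l s ^ i := fun i =>
    Finset.sum_congr rfl fun s _ => by simp only [ω, Pi.pow_apply]; ring
  rw [hs, hs, hs]
  change _ ≤ (∑ s, ω s) * _
  have key : 0 ≤ ∑ s, ∑ t, ω s * ω t * ((l s ^ i - l t ^ i) * (l s ^ j - l t ^ j)) := by
    refine Finset.sum_nonneg fun s _ => Finset.sum_nonneg fun t _ =>
      mul_nonneg (mul_nonneg (hω s) (hω t)) ?_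
    rcases le_total (l s) (l t) with h | h
    · exact mul_nonneg_of_nonpos_of_nonpos (sub_nonpos.2 (pow_le_pow_left₀ (hl0 s) h _))
        (sub_nonpos.2 (pow_le_pow_left₀ (hl0 s) h _))
    · exact mul_nonneg (sub_nonneg.2 (pow_le_pow_left₀ (hl0 t) h _))
        (sub_nonneg.2 (pow_le_pow_left₀ (hl0 t) h _))
  have h1 : ∑ s, ∑ t, ω s * ω t * ((l s ^ i - l t ^ i) * (l s ^ j - l t ^ j)) =
      (∑ s, ω s * l s ^ (i + j)) * (∑ t, ω t) + (∑ s, ω s) * (∑ t, ω t * l t ^ (i + j))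
      - (∑ s, ω s * l s ^ i) * (∑ t, ω t * l t ^ j)
      - (∑ s, ω s * l s ^ j) * (∑ t, ω t * l t ^ i) := by
    simp only [Finset.sum_mul_sum, ← Finset.sum_add_distrib, ← Finset.sum_sub_distrib]
    exact Finset.sum_congr rfl fun s _ => Finset.sum_congr rfl fun t _ => by ring
  rw [h1] at key
  nlinarith

lemma resolvent_quadratic_nonneg {P : Matrix n n ℝ} (hP : P.PosDef) (y : n → ℝ) (i : ℕ) :
    0 ≤ y ⬝ᵥ (P⁻¹ ^ i) *ᵥ y := by
  obtain ⟨U, v, hU, hU', hv, rfl⟩ := exists_eq_diagConj hP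
  rw [diagConj_inv hU hU' fun i => (hv i).ne', diagConj_pow hU hU', diagConj_bilin]
  refine Finset.sum_nonneg fun s _ => ?_
  rw [mul_assoc]
  exact mul_nonneg (pow_nonneg (inv_pos.2 (hv s)).le _) (mul_self_nonneg _)

lemma dotProduct_sq_le {P : Matrix n n ℝ} (hP : P.PosDef) (x y : n → ℝ) :
    (x ⬝ᵥ y) ^ 2 ≤ (x ⬝ᵥ P *ᵥ x) * (y ⬝ᵥ P⁻¹ *ᵥ y) := by
  obtain ⟨U, v, hU, hU', hv, rfl⟩ := exists_eq_diagConj hP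
  rw [diagConj_inv hU hU' fun i => (hv i).ne', diagConj_bilin, diagConj_bilin,
    ← transpose_mulVec_dotProduct hU' x y]
  refine Finset.sum_sq_le_sum_mul_sum_of_sq_le_mul _ (fun i _ => ?_) (fun i _ => ?_) fun i _ => ?_
  · rw [mul_assoc]; exact mul_nonneg (hv i).le (mul_self_nonneg _)
  · rw [mul_assoc]; exact mul_nonneg (inv_pos.2 (hv i)).le (mul_self_nonneg _)
  · rw [Pi.inv_apply]
    refine le_of_eq ?_
    have := (hv i).ne'
    field_simp

end MatrixLemmas

section RankOne

open Matrix

variable {n : Type*} [Fintype n] [DecidableEq n]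

lemma posDef_sub_vecMulVec {P : Matrix n n ℝ} (hP : P.PosDef) {y : n → ℝ}
    (hr : y ⬝ᵥ P⁻¹ *ᵥ y ≤ 1 / 2) : (P - vecMulVec y y).PosDef := by
  refine PosDef.of_dotProduct_mulVec_pos (hP.1.sub ?_) fun x hx => ?_
  · ext i j
    simp [vecMulVec_apply, mul_comm]
  · have h1 : 0 < x ⬝ᵥ P *ᵥ x := hP.dotProduct_mulVec_pos hx
    have h2 := dotProduct_sq_le hP x y
    have h3 : star x ⬝ᵥ (P - vecMulVec y y) *ᵥ x = x ⬝ᵥ P *ᵥ x - (x ⬝ᵥ y) ^ 2 := by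
      rw [star_trivial, sub_mulVec, dotProduct_sub, vecMulVec_mulVec, dotProduct_smul,
        dotProduct_comm y x]
      simp [pow_two]
    rw [h3]
    nlinarith

lemma inv_sub_vecMulVec {P : Matrix n n ℝ} (hP : P.PosDef) {y : n → ℝ}
    (hr : y ⬝ᵥ P⁻¹ *ᵥ y ≤ 1 / 2) :
    (P - vecMulVec y y)⁻¹ =
      P⁻¹ + (1 - y ⬝ᵥ P⁻¹ *ᵥ y)⁻¹ • vecMulVec (P⁻¹ *ᵥ y) (P⁻¹ *ᵥ y) := by
  set r := y ⬝ᵥ P⁻¹ *ᵥ y with hrdef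
  have hdet : IsUnit P.det := (Matrix.isUnit_iff_isUnit_det _).1 hP.isUnit
  have hsymm : P⁻¹ᵀ = P⁻¹ := by
    have := hP.1.inv
    rwa [IsHermitian, conjTranspose_eq_transpose_of_trivial] at this
  refine inv_eq_right_inv ?_
  have h1 : P *ᵥ (P⁻¹ *ᵥ y) = y := by rw [mulVec_mulVec, mul_nonsing_inv _ hdet, one_mulVec]
  have h2 : y ᵥ* P⁻¹ = P⁻¹ *ᵥ y := by rw [← mulVec_transpose, hsymm]
  rw [Matrix.mul_add, Matrix.sub_mul, Matrix.sub_mul, mul_nonsing_inv _ hdet, Matrix.mul_smul,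
    Matrix.mul_smul, mul_vecMulVec, mul_vecMulVec, h1, vecMulVec_mul, h2, vecMulVec_mulVec]
  have h3 : vecMulVec (MulOpposite.op (y ⬝ᵥ P⁻¹ *ᵥ y) • y) (P⁻¹ *ᵥ y) =
      r • vecMulVec y (P⁻¹ *ᵥ y) := by
    ext i j
    simp [vecMulVec_apply, ← hrdef]
    ring
  rw [h3]
  have h4 : (1 - r) ≠ 0 := by linarith
  have h5 : (1 - r)⁻¹ - (1 - r)⁻¹ * r - 1 = 0 := by field_simp; ring
  have h6 : ∀ V : Matrix n n ℝ, 1 - V + ((1 - r)⁻¹ • V - (1 - r)⁻¹ • r • V) =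
      1 + ((1 - r)⁻¹ - (1 - r)⁻¹ * r - 1) • V := fun V => by module
  rw [h6, h5, zero_smul, add_zero]

/-- Effect of a small rank one perturbation on the trace of powers of the resolvent. -/
lemma trace_inv_sub_vecMulVec_pow_le {P : Matrix n n ℝ} (hP : P.PosDef) {y : n → ℝ}
    (hr : y ⬝ᵥ P⁻¹ *ᵥ y ≤ 1 / 2) (m : ℕ) :
    (((P - vecMulVec y y)⁻¹) ^ m).trace ≤
      (P⁻¹ ^ m).trace + 2 ^ (m + 1) * (y ⬝ᵥ (P⁻¹ ^ (m + 1)) *ᵥ y) := by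
  rw [inv_sub_vecMulVec hP hr]
  set r := y ⬝ᵥ P⁻¹ *ᵥ y with hrdef
  have hsymm : P⁻¹ᵀ = P⁻¹ := by
    have := hP.1.inv
    rwa [IsHermitian, conjTranspose_eq_transpose_of_trivial] at this
  have hr0 : 0 ≤ r := by simpa using resolvent_quadratic_nonneg hP y 1
  have hnn := resolvent_quadratic_nonneg hP y
  have hch := resolvent_chebyshev hP y
  set A := P⁻¹
  set v := A *ᵥ y
  set β := (1 - r)⁻¹
  have hβ0 : 0 ≤ β := inv_nonneg.2 (by linarith)
  have hβ : β ≤ 2 := by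
    rw [inv_le_comm₀ (by linarith) two_pos]; linarith
  have hβr : β * r ≤ 1 := by
    rw [inv_mul_le_one₀ (by linarith)]; linarith
  set B := A + β • vecMulVec v v
  have hvA : ∀ x : n → ℝ, v ⬝ᵥ x = y ⬝ᵥ A *ᵥ x := fun x => by
    rw [dotProduct_mulVec, ← mulVec_transpose, hsymm]
  have ha : ∀ i, v ⬝ᵥ (A ^ i) *ᵥ v = y ⬝ᵥ (A ^ (i + 2)) *ᵥ y := fun i => by
    rw [hvA, mulVec_mulVec, mulVec_mulVec, ← pow_succ', ← pow_succ]
  have hBx : ∀ x, B *ᵥ x = A *ᵥ x + (β * (v ⬝ᵥ x)) • v := fun x => by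
    rw [add_mulVec, smul_mulVec, vecMulVec_mulVec, op_smul_eq_smul, smul_smul]
  have hc : ∀ j i, v ⬝ᵥ (A ^ i) *ᵥ ((B ^ j) *ᵥ v) ≤ 2 ^ j * (y ⬝ᵥ (A ^ (i + j + 2)) *ᵥ y) := by
    intro j
    induction j with
    | zero => intro i; simp [ha]
    | succ j ih =>
      intro i
      rw [pow_succ' B, ← mulVec_mulVec, hBx, mulVec_add, dotProduct_add, mulVec_smul,
        dotProduct_smul, ha, smul_eq_mul, mulVec_mulVec,
        ← pow_succ A i]
      have h1 := ih (i + 1)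
      have h2 := ih 0
      rw [pow_zero, one_mulVec, zero_add] at h2
      have h3 := hch (j + 1) (i + 1)
      have h4 : β * (v ⬝ᵥ (B ^ j) *ᵥ v) * (y ⬝ᵥ (A ^ (i + 2)) *ᵥ y) ≤
          2 ^ j * (y ⬝ᵥ (A ^ (j + 1 + (i + 1) + 1)) *ᵥ y) := by
        calc β * (v ⬝ᵥ (B ^ j) *ᵥ v) * (y ⬝ᵥ (A ^ (i + 2)) *ᵥ y) ≤
            β * (2 ^ j * (y ⬝ᵥ (A ^ (j + 2)) *ᵥ y)) * (y ⬝ᵥ (A ^ (i + 2)) *ᵥ y) := by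
              have := hnn (i + 2)
              gcongr
          _ = β * 2 ^ j * ((y ⬝ᵥ (A ^ (j + 2)) *ᵥ y) * (y ⬝ᵥ (A ^ (i + 2)) *ᵥ y)) := by ring
          _ ≤ β * 2 ^ j * (r * (y ⬝ᵥ (A ^ (j + 1 + (i + 1) + 1)) *ᵥ y)) := by
              gcongr
          _ = β * r * (2 ^ j * (y ⬝ᵥ (A ^ (j + 1 + (i + 1) + 1)) *ᵥ y)) := by ring
          _ ≤ _ := mul_le_of_le_one_left (mul_nonneg (by positivity) (hnn _)) hβr
      rw [show j + 1 + (i + 1) + 1 = i + (j + 1) + 2 by ring] at h4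
      rw [show i + 1 + j + 2 = i + (j + 1) + 2 by ring] at h1
      have h5 : (2 : ℝ) ^ (j + 1) = 2 ^ j + 2 ^ j := by ring
      rw [h5, add_mul]
      linarith
  have ht : ∀ m i, (A ^ i * B ^ m).trace + 2 * (y ⬝ᵥ (A ^ (i + m + 1)) *ᵥ y) ≤
      (A ^ (i + m)).trace + 2 ^ (m + 1) * (y ⬝ᵥ (A ^ (i + m + 1)) *ᵥ y) := by
    intro m
    induction m with
    | zero => intro i; simp
    | succ m ih =>
      intro i
      have h1 : (A ^ i * B ^ (m + 1)).trace = (A ^ (i + 1) * B ^ m).trace +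
          β * (v ⬝ᵥ (A ^ i) *ᵥ ((B ^ m) *ᵥ v)) := by
        rw [pow_succ B, ← Matrix.mul_assoc, Matrix.mul_add, trace_add, trace_mul_comm _ A,
          ← Matrix.mul_assoc, ← pow_succ', Matrix.mul_smul, trace_smul, mul_vecMulVec,
          trace_vecMulVec, smul_eq_mul, ← mulVec_mulVec, dotProduct_comm]
      have h2 := ih (i + 1)
      have h3 := hc m i
      have h4 : β * (v ⬝ᵥ (A ^ i) *ᵥ ((B ^ m) *ᵥ v)) ≤
          2 * (2 ^ m * (y ⬝ᵥ (A ^ (i + m + 2)) *ᵥ y)) := by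
        calc _ ≤ β * (2 ^ m * (y ⬝ᵥ (A ^ (i + m + 2)) *ᵥ y)) := by gcongr
          _ ≤ _ := mul_le_mul_of_nonneg_right hβ (mul_nonneg (by positivity) (hnn _))
      rw [h1]
      rw [show i + 1 + m + 1 = i + m + 2 by ring, show i + 1 + m = i + (m + 1) by ring] at h2
      rw [show i + (m + 1) + 1 = i + m + 2 by ring]
      have h5 : (2 : ℝ) ^ (m + 1 + 1) = 2 ^ (m + 1) + 2 * 2 ^ m := by ring
      rw [h5, add_mul]
      linarith
  have h := ht m 0
  simp only [pow_zero, Matrix.one_mul, zero_add] at h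
  have := hnn (m + 1)
  linarith

end RankOne

section Barrier

open Matrix

/-- The truncated exponential barrier of a symmetric matrix `S` below the level `u`. -/
def barrier {R : ℕ} (m : ℕ) (θ κ u : ℝ) (S : Matrix (Fin R) (Fin R) ℝ) : ℝ≥0∞ := by
  classical
  exact if (u • (1 : Matrix (Fin R) (Fin R) ℝ) - S).PosDef then
    min 1 (ENNReal.ofReal
      (Real.exp (θ * ((((u • (1 : Matrix (Fin R) (Fin R) ℝ) - S)⁻¹) ^ m).trace / R - κ))))
  else 1

lemma barrier_of_posDef {R m : ℕ} {θ κ u : ℝ} {S : Matrix (Fin R) (Fin R) ℝ}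
    (h : (u • (1 : Matrix (Fin R) (Fin R) ℝ) - S).PosDef) :
    barrier m θ κ u S = min 1 (ENNReal.ofReal
      (Real.exp (θ * ((((u • (1 : Matrix (Fin R) (Fin R) ℝ) - S)⁻¹) ^ m).trace / R - κ)))) :=
  if_pos h

lemma barrier_of_not_posDef {R m : ℕ} {θ κ u : ℝ} {S : Matrix (Fin R) (Fin R) ℝ}
    (h : ¬(u • (1 : Matrix (Fin R) (Fin R) ℝ) - S).PosDef) : barrier m θ κ u S = 1 :=
  if_neg h

lemma barrier_le_one {R m : ℕ} {θ κ u : ℝ} {S : Matrix (Fin R) (Fin R) ℝ} :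
    barrier m θ κ u S ≤ 1 := by
  unfold barrier
  split_ifs
  · exact min_le_left _ _
  · exact le_rfl

/-- Adding `y yᵀ` to `S` and raising the level by `δ` multiplies the barrier by a controlled
factor, provided two quadratic forms of `y` are close to their means. -/
lemma barrier_add_le {R m : ℕ} {θ κ u α η : ℝ} {S : Matrix (Fin R) (Fin R) ℝ} {y : Fin R → ℝ}
    {A : Matrix (Fin R) (Fin R) ℝ} {δ : ℝ}
    (hR : 0 < R) (hm : m ≠ 0) (hθ : 0 ≤ θ) (hκ : κ = (1 / 4) ^ m) (hδ : δ = 2 * 2 ^ (m + 1) / (m * R))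
    (hα : α * η ≤ 1 / 4) (hbnd : θ * 2 ^ (m + 1) * (α * κ + α ^ (m + 1) * η) ≤ R)
    (hP : (u • (1 : Matrix (Fin R) (Fin R) ℝ) - S).PosDef)
    (htr : (((u • (1 : Matrix (Fin R) (Fin R) ℝ) - S)⁻¹) ^ m).trace / R < κ)
    (hA : A = ((u + δ) • (1 : Matrix (Fin R) (Fin R) ℝ) - S)⁻¹)
    (hAm : (A ^ (m + 1)).trace ≤ R * (α * κ))
    (h1 : y ⬝ᵥ A *ᵥ y ≤ A.trace / R + α * η)
    (h2 : y ⬝ᵥ (A ^ (m + 1)) *ᵥ y ≤ (A ^ (m + 1)).trace / R + α ^ (m + 1) * η) :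
    barrier m θ κ (u + δ) (S + vecMulVec y y) ≤ ENNReal.ofReal
      (Real.exp (θ * ((((u • (1 : Matrix (Fin R) (Fin R) ℝ) - S)⁻¹) ^ m).trace / R - κ)) *
        (Real.exp (-(2 * (θ * 2 ^ (m + 1) / R * ((A ^ (m + 1)).trace / R)))) *
          (1 + 2 * (θ * 2 ^ (m + 1) / R * (y ⬝ᵥ (A ^ (m + 1)) *ᵥ y))))) := by
  set P₀ := u • (1 : Matrix (Fin R) (Fin R) ℝ) - S
  have hR' : (0 : ℝ) < R := by exact_mod_cast hR
  have hm' : (0 : ℝ) < m := by exact_mod_cast Nat.pos_of_ne_zero hm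
  have hδ0 : 0 < δ := by rw [hδ]; positivity
  have hPe : (u + δ) • (1 : Matrix (Fin R) (Fin R) ℝ) - S = P₀ + δ • 1 := by
    simp only [P₀]; module
  have hPP : (P₀ + δ • (1 : Matrix (Fin R) (Fin R) ℝ)).PosDef :=
    hP.add (PosDef.one.smul hδ0)
  have hshift := resolvent_shift hP hδ0.le m
  rw [hPe] at hA
  rw [← hA] at hshift
  have hpow := resolvent_trace_pow_le hPP hm
  have hnn := resolvent_quadratic_nonneg hPP y
  rw [← hA, Fintype.card_fin] at hpow
  rw [← hA] at hnn
  have hAm0 : 0 ≤ (A ^ (m + 1)).trace := by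
    rw [hA]; exact (hPP.inv.posSemidef.pow (m + 1)).trace_nonneg
  have hAle : (A ^ m).trace / R < κ := by
    refine lt_of_le_of_lt ?_ htr
    gcongr
    have : 0 ≤ m * δ * (A ^ (m + 1)).trace := by positivity
    linarith
  have hA1 : A.trace / R ≤ 1 / 4 := by
    refine le_of_lt (lt_of_pow_lt_pow_left₀ m (by norm_num) ?_)
    rw [← hκ]; exact hpow.trans_lt hAle
  have hr : y ⬝ᵥ (P₀ + δ • (1 : Matrix (Fin R) (Fin R) ℝ))⁻¹ *ᵥ y ≤ 1 / 2 := by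
    rw [← hA]; linarith
  have hpd := posDef_sub_vecMulVec hPP hr
  have htr' := trace_inv_sub_vecMulVec_pow_le hPP hr m
  rw [← hA] at htr'
  have heq : (u + δ) • (1 : Matrix (Fin R) (Fin R) ℝ) - (S + vecMulVec y y) =
      P₀ + δ • 1 - vecMulVec y y := by rw [← hPe]; abel
  rw [barrier_of_posDef (by rw [heq]; exact hpd), heq]
  refine (min_le_right _ _).trans (ENNReal.ofReal_le_ofReal ?_)
  set X := y ⬝ᵥ (A ^ (m + 1)) *ᵥ y
  set T := (A ^ (m + 1)).trace
  set T₀ := (P₀⁻¹ ^ m).trace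
  have hX0 : 0 ≤ X := hnn (m + 1)
  set z := θ * 2 ^ (m + 1) / R * X
  have hz0 : 0 ≤ z := by positivity
  have hTR : T / R ≤ α * κ := by rw [div_le_iff₀ hR']; linarith
  have hz1 : z ≤ 1 := by
    have : z ≤ θ * 2 ^ (m + 1) / R * (α * κ + α ^ (m + 1) * η) := by
      refine mul_le_mul_of_nonneg_left ?_ (by positivity)
      linarith
    refine this.trans ?_
    rw [div_mul_eq_mul_div, div_le_one hR']
    exact hbnd
  have hexp : Real.exp z ≤ 1 + 2 * z := by
    have := Real.abs_exp_sub_one_le (x := z) (by rwa [abs_of_nonneg hz0])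
    rw [abs_of_nonneg hz0] at this
    linarith [le_abs_self (Real.exp z - 1)]
  refine le_trans ?_ (mul_le_mul_of_nonneg_left (mul_le_mul_of_nonneg_left hexp
    (Real.exp_pos _).le) (Real.exp_pos _).le)
  rw [← Real.exp_add, ← Real.exp_add, Real.exp_le_exp]
  have h3 : m * δ * T = 2 * 2 ^ (m + 1) * (T / R) := by rw [hδ]; field_simp
  rw [h3] at hshift
  have h4 : (((P₀ + δ • 1 - vecMulVec y y)⁻¹) ^ m).trace ≤
      T₀ - 2 * 2 ^ (m + 1) * (T / R) + 2 ^ (m + 1) * X := by linarith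
  calc θ * ((((P₀ + δ • 1 - vecMulVec y y)⁻¹) ^ m).trace / R - κ) ≤
      θ * ((T₀ - 2 * 2 ^ (m + 1) * (T / R) + 2 ^ (m + 1) * X) / R - κ) := by gcongr
    _ = _ := by simp only [z]; ring

end Barrier

section BarrierIntegral

open Matrix

lemma resolvent_trace_pow_succ_le {n : Type*} [Fintype n] [DecidableEq n] {P : Matrix n n ℝ}
    (hP : P.PosDef) {α : ℝ} (hα : 0 ≤ α) {m : ℕ} (hm : m ≠ 0)
    (h : ((P⁻¹) ^ m).trace ≤ α ^ m) :
    (P⁻¹ ^ (m + 1)).trace ≤ α * (P⁻¹ ^ m).trace := by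
  obtain ⟨U, v, hU, hU', hv, rfl⟩ := exists_eq_diagConj hP
  rw [diagConj_inv hU hU' fun i => (hv i).ne', diagConj_pow hU hU', diagConj_trace hU] at h
  rw [diagConj_inv hU hU' fun i => (hv i).ne', diagConj_pow hU hU', diagConj_trace hU,
    diagConj_pow hU hU', diagConj_trace hU, Finset.mul_sum]
  refine Finset.sum_le_sum fun i _ => ?_
  have hnn : ∀ i, 0 ≤ v⁻¹ i := fun i => inv_nonneg.2 (hv i).le
  have h1 : v⁻¹ i ≤ α := by
    refine le_of_pow_le_pow_left₀ hm hα (le_trans ?_ h)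
    exact Finset.single_le_sum (f := fun i => (v⁻¹ ^ m) i) (fun j _ => pow_nonneg (hnn j) m)
      (Finset.mem_univ i)
  rw [Pi.pow_apply, Pi.pow_apply, pow_succ, mul_comm]
  exact mul_le_mul_of_nonneg_right h1 (pow_nonneg (hnn i) m)

variable {d R : ℕ} {σ : Measure (EuclideanSpace ℝ (Fin d))} {K : Polynomial ℝ}
  {y : EuclideanSpace ℝ (Fin d) → Fin R → ℝ}

lemma lintegral_barrier_add_le {m : ℕ} {θ κ α η δ C : ℝ} {r : ℕ}
    (hσ : IsSphereLaw σ) (hy : IsFeature σ K y) (hK : K.eval 1 = 1)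
    (hC : ∀ a : ℝ, |a| ≤ 1 → 1 - K.eval a ≤ C * (1 - a))
    (hr : 2 ≤ r) (hη : 0 < η) (hα0 : 0 < α)
    (hR : 0 < R) (hm : m ≠ 0) (hθ : 0 ≤ θ) (hκ : κ = (1 / 4) ^ m)
    (hδ : δ = 2 * 2 ^ (m + 1) / (m * R)) (hα : α * η ≤ 1 / 4)
    (hbnd : θ * 2 ^ (m + 1) * (α * κ + α ^ (m + 1) * η) ≤ R) (hRα : R * κ ≤ α ^ m)
    (u : ℝ) (S : Matrix (Fin R) (Fin R) ℝ) :
    ∫⁻ w, barrier m θ κ (u + δ) (S + vecMulVec (y w) (y w)) ∂σ ≤ barrier m θ κ u S +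
      2 * ENNReal.ofReal ((12 * √C * (gaussMoment r).toReal / (√d * η)) ^ r) := by
  have := hσ.prob
  have hR' : (0 : ℝ) < R := by exact_mod_cast hR
  have hm' : (0 : ℝ) < m := by exact_mod_cast Nat.pos_of_ne_zero hm
  have hδ0 : 0 < δ := by rw [hδ]; positivity
  have htriv : ∫⁻ w, barrier m θ κ (u + δ) (S + vecMulVec (y w) (y w)) ∂σ ≤ 1 := by
    refine (lintegral_mono fun w => barrier_le_one).trans ?_
    simp
  by_cases hP : (u • (1 : Matrix (Fin R) (Fin R) ℝ) - S).PosDef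
  swap
  · rw [barrier_of_not_posDef hP]
    exact htriv.trans le_self_add
  by_cases htr : (((u • (1 : Matrix (Fin R) (Fin R) ℝ) - S)⁻¹) ^ m).trace / R < κ
  swap
  · have : barrier m θ κ u S = 1 := by
      rw [barrier_of_posDef hP, min_eq_left]
      rw [ENNReal.one_le_ofReal, Real.one_le_exp_iff]
      exact mul_nonneg hθ (by linarith [not_lt.1 htr])
    rw [this]
    exact htriv.trans le_self_add
  have hbar : barrier m θ κ u S = ENNReal.ofReal (Real.exp (θ *
      ((((u • (1 : Matrix (Fin R) (Fin R) ℝ) - S)⁻¹) ^ m).trace / R - κ))) := by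
    rw [barrier_of_posDef hP, min_eq_right]
    rw [ENNReal.ofReal_le_one, Real.exp_le_one_iff]
    exact mul_nonpos_of_nonneg_of_nonpos hθ (by linarith)
  set w₀ := Real.exp (θ * ((((u • (1 : Matrix (Fin R) (Fin R) ℝ) - S)⁻¹) ^ m).trace / R - κ))
  set A := ((u + δ) • (1 : Matrix (Fin R) (Fin R) ℝ) - S)⁻¹ with hA
  have hPe : (u + δ) • (1 : Matrix (Fin R) (Fin R) ℝ) - S =
      u • (1 : Matrix (Fin R) (Fin R) ℝ) - S + δ • 1 := by module
  have hPP : ((u + δ) • (1 : Matrix (Fin R) (Fin R) ℝ) - S).PosDef := by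
    rw [hPe]; exact hP.add (PosDef.one.smul hδ0)
  have hAm0 : 0 ≤ (A ^ (m + 1)).trace := (hPP.inv.posSemidef.pow (m + 1)).trace_nonneg
  have hAκ : (A ^ m).trace ≤ R * κ := by
    have hshift := resolvent_shift hP hδ0.le m
    rw [← hPe, ← hA] at hshift
    rw [div_lt_iff₀ hR'] at htr
    have : 0 ≤ m * δ * (A ^ (m + 1)).trace := by positivity
    linarith
  have hAα := hAκ.trans hRα
  have hAm : (A ^ (m + 1)).trace ≤ R * (α * κ) := by
    have h1 := resolvent_trace_pow_succ_le hPP hα0.le hm hAα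
    have h2 := mul_le_mul_of_nonneg_left hAκ hα0.le
    rw [← hA] at h1
    linarith
  have hbil := resolvent_bilin_le hPP hα0.le hm hAα
  rw [← hA] at hbil
  set x := θ * 2 ^ (m + 1) / R * ((A ^ (m + 1)).trace / R)
  have hx : 0 ≤ x := by positivity
  set ε := ENNReal.ofReal ((12 * √C * (gaussMoment r).toReal / (√d * η)) ^ r)
  set s₁ := {w | A.trace / R + α * η ≤ y w ⬝ᵥ A *ᵥ (y w)}
  set s₂ := {w | (A ^ (m + 1)).trace / R + α ^ (m + 1) * η ≤ y w ⬝ᵥ (A ^ (m + 1)) *ᵥ (y w)}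
  have hc := hy.continuous
  have hs₁ : MeasurableSet s₁ := by
    refine IsClosed.measurableSet (isClosed_le continuous_const ?_)
    exact hc.dotProduct (continuous_const.matrix_mulVec hc)
  have hcX : Continuous fun w => y w ⬝ᵥ (A ^ (m + 1)) *ᵥ (y w) :=
    hc.dotProduct (continuous_const.matrix_mulVec hc)
  have hs₂ : MeasurableSet s₂ := IsClosed.measurableSet (isClosed_le continuous_const hcX)
  have hε₁ : σ s₁ ≤ ε := hy.measure_quadratic_le hσ hK hC hα0
    (fun a b => by simpa using hbil 1 a b) hr hη
  have hε₂ : σ s₂ ≤ ε := hy.measure_quadratic_le hσ hK hC (pow_pos hα0 (m + 1))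
    (hbil (m + 1)) hr hη
  set g : EuclideanSpace ℝ (Fin d) → ℝ := fun w => w₀ * (Real.exp (-(2 * x)) *
    (1 + 2 * (θ * 2 ^ (m + 1) / R * (y w ⬝ᵥ (A ^ (m + 1)) *ᵥ (y w))))) with hg
  have hgc : Continuous g := by fun_prop
  have hg0 : ∀ w, 0 ≤ g w := fun w => by
    have : 0 ≤ y w ⬝ᵥ (A ^ (m + 1)) *ᵥ (y w) := resolvent_quadratic_nonneg hPP (y w) (m + 1)
    have : 0 < w₀ := Real.exp_pos _
    positivity
  have hgi : ∫⁻ w, ENNReal.ofReal (g w) ∂σ ≤ ENNReal.ofReal w₀ := by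
    rw [← ofReal_integral_eq_lintegral_ofReal (hσ.integrable hgc) (ae_of_all _ hg0)]
    refine ENNReal.ofReal_le_ofReal ?_
    have h1 : ∫ w, g w ∂σ = w₀ * (Real.exp (-(2 * x)) * (1 + 2 * x)) := by
      simp only [hg]
      rw [integral_const_mul, integral_const_mul,
        integral_add (integrable_const _) (hσ.integrable (by fun_prop)), integral_const_mul,
        integral_const_mul, hy.integral_quadratic hσ]
      simp [x]
    rw [h1]
    refine mul_le_of_le_one_right (Real.exp_pos _).le ?_
    rw [Real.exp_neg, inv_mul_le_one₀ (Real.exp_pos _)]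
    linarith [Real.add_one_le_exp (2 * x)]
  have hpt : ∀ w, barrier m θ κ (u + δ) (S + vecMulVec (y w) (y w)) ≤
      ENNReal.ofReal (g w) + (s₁ ∪ s₂).indicator 1 w := by
    intro w
    by_cases hw : w ∈ s₁ ∪ s₂
    · rw [Set.indicator_of_mem hw]
      exact barrier_le_one.trans le_add_self
    · refine le_trans ?_ le_self_add
      rw [Set.mem_union, not_or] at hw
      exact barrier_add_le hR hm hθ hκ hδ hα hbnd hP htr hA hAm (le_of_lt (not_le.1 hw.1))
        (le_of_lt (not_le.1 hw.2))
  calc ∫⁻ w, barrier m θ κ (u + δ) (S + vecMulVec (y w) (y w)) ∂σ ≤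
      ∫⁻ w, (ENNReal.ofReal (g w) + (s₁ ∪ s₂).indicator 1 w) ∂σ := lintegral_mono hpt
    _ = ∫⁻ w, ENNReal.ofReal (g w) ∂σ + σ (s₁ ∪ s₂) := by
      rw [lintegral_add_left hgc.measurable.ennreal_ofReal,
        lintegral_indicator_one (hs₁.union hs₂)]
    _ ≤ ENNReal.ofReal w₀ + 2 * ε := by
      rw [two_mul]
      exact add_le_add hgi ((measure_union_le _ _).trans (add_le_add hε₁ hε₂))
    _ = _ := by rw [hbar]

lemma lintegral_pi_barrier_le {m : ℕ} {θ κ α η δ C : ℝ} {r : ℕ}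
    (hσ : IsSphereLaw σ) (hy : IsFeature σ K y) (hK : K.eval 1 = 1)
    (hC : ∀ a : ℝ, |a| ≤ 1 → 1 - K.eval a ≤ C * (1 - a))
    (hr : 2 ≤ r) (hη : 0 < η) (hα0 : 0 < α)
    (hR : 0 < R) (hm : m ≠ 0) (hθ : 0 ≤ θ) (hκ : κ = (1 / 4) ^ m)
    (hδ : δ = 2 * 2 ^ (m + 1) / (m * R)) (hα : α * η ≤ 1 / 4)
    (hbnd : θ * 2 ^ (m + 1) * (α * κ + α ^ (m + 1) * η) ≤ R) (hRα : R * κ ≤ α ^ m)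
    (n : ℕ) (u : ℝ) (S : Matrix (Fin R) (Fin R) ℝ) :
    ∫⁻ w : Fin n → EuclideanSpace ℝ (Fin d),
        barrier m θ κ (u + n * δ) (S + ∑ i, vecMulVec (y (w i)) (y (w i)))
          ∂Measure.pi (fun _ => σ) ≤ barrier m θ κ u S +
      n * (2 * ENNReal.ofReal ((12 * √C * (gaussMoment r).toReal / (√d * η)) ^ r)) := by
  have := hσ.prob
  set ε := 2 * ENNReal.ofReal ((12 * √C * (gaussMoment r).toReal / (√d * η)) ^ r)
  induction n generalizing u S with
  | zero => simp
  | succ n ih =>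
    have hmp := (measurePreserving_piFinSuccAbove
      (fun _ : Fin (n + 1) => σ) 0).symm
    rw [← hmp.lintegral_comp_emb (MeasurableEquiv.measurableEmbedding _)]
    refine (lintegral_prod_le _).trans ?_
    have h1 : ∀ (a : EuclideanSpace ℝ (Fin d)) (w : Fin n → EuclideanSpace ℝ (Fin d)),
        barrier m θ κ (u + (n + 1 : ℕ) * δ) (S + ∑ i, vecMulVec
          (y ((MeasurableEquiv.piFinSuccAbove (fun _ : Fin (n + 1) =>
            EuclideanSpace ℝ (Fin d)) 0).symm (a, w) i))
          (y ((MeasurableEquiv.piFinSuccAbove (fun _ : Fin (n + 1) =>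
            EuclideanSpace ℝ (Fin d)) 0).symm (a, w) i))) =
        barrier m θ κ (u + δ + n * δ) (S + vecMulVec (y a) (y a) +
          ∑ i, vecMulVec (y (w i)) (y (w i))) := by
      intro a w
      rw [Fin.sum_univ_succ]
      simp only [MeasurableEquiv.piFinSuccAbove_symm_apply, Fin.insertNthEquiv_zero,
        Fin.consEquiv_apply, Fin.cons_zero, Fin.cons_succ]
      rw [← add_assoc]
      push_cast
      congr 1
      ring
    simp only [h1]
    calc _ ≤ ∫⁻ a, (barrier m θ κ (u + δ) (S + vecMulVec (y a) (y a)) + n * ε) ∂σ :=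
          lintegral_mono fun a => ih _ _
      _ = ∫⁻ a, barrier m θ κ (u + δ) (S + vecMulVec (y a) (y a)) ∂σ + n * ε := by
          rw [lintegral_add_right _ measurable_const]; simp
      _ ≤ barrier m θ κ u S + ε + n * ε := by
          gcongr
          exact lintegral_barrier_add_le hσ hy hK hC hr hη hα0 hR hm hθ hκ hδ hα hbnd hRα u S
      _ = _ := by push_cast; ring

end BarrierIntegral

section OperatorNorm

open Matrix

lemma opNorm_le_of_forall {n p : ℕ} {A : Matrix (Fin n) (Fin p) ℝ} {u : ℝ} (hu : 0 ≤ u)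
    (h : ∀ x : Fin p → ℝ, (A *ᵥ x) ⬝ᵥ (A *ᵥ x) ≤ u ^ 2 * (x ⬝ᵥ x)) : opNorm A ≤ u := by
  refine ContinuousLinearMap.opNorm_le_bound _ hu fun x => ?_
  have h1 := h x.ofLp
  refine le_of_sq_le_sq ?_ (by positivity)
  rw [mul_pow, EuclideanSpace.real_norm_sq_eq, EuclideanSpace.real_norm_sq_eq]
  simpa [dotProduct, ← pow_two] using h1

lemma opNorm_nonneg {n p : ℕ} (A : Matrix (Fin n) (Fin p) ℝ) : 0 ≤ opNorm A := norm_nonneg _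

lemma opNorm_smul {n p : ℕ} (c : ℝ) (A : Matrix (Fin n) (Fin p) ℝ) :
    opNorm (c • A) = |c| * opNorm A := by
  rw [opNorm, opNorm, map_smul, map_smul, norm_smul, Real.norm_eq_abs]

lemma continuous_opNorm {n p : ℕ} :
    Continuous (opNorm : Matrix (Fin n) (Fin p) ℝ → ℝ) := by
  have : Continuous (Matrix.toEuclideanLin (𝕜 := ℝ) (m := Fin n) (n := Fin p) ≪≫ₗ
      LinearMap.toContinuousLinearMap).toLinearMap :=
    LinearMap.continuous_of_finiteDimensional _
  exact continuous_norm.comp this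

lemma opNorm_le_of_entry_le {n : ℕ} {A : Matrix (Fin n) (Fin n) ℝ} {b : ℝ} (hb : 0 ≤ b)
    (h : ∀ i j, |A i j| ≤ b) : opNorm A ≤ n * b := by
  refine opNorm_le_of_forall (by positivity) fun x => ?_
  have h1 : ∀ i, (A *ᵥ x) i ^ 2 ≤ n * b ^ 2 * (x ⬝ᵥ x) := fun i => by
    calc (A *ᵥ x) i ^ 2 ≤ (∑ j, A i j ^ 2) * ∑ j, x j ^ 2 :=
          Finset.sum_mul_sq_le_sq_mul_sq Finset.univ (A i) x
      _ ≤ (∑ _j : Fin n, b ^ 2) * ∑ j, x j ^ 2 := by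
        refine mul_le_mul_of_nonneg_right (Finset.sum_le_sum fun j _ => sq_le_sq.2 ?_)
          (Finset.sum_nonneg fun j _ => sq_nonneg _)
        rw [abs_of_nonneg hb]
        exact h i j
      _ = _ := by simp [dotProduct, pow_two]
  calc (A *ᵥ x) ⬝ᵥ (A *ᵥ x) = ∑ i, (A *ᵥ x) i ^ 2 := by simp [dotProduct, pow_two]
    _ ≤ ∑ _i : Fin n, n * b ^ 2 * (x ⬝ᵥ x) := Finset.sum_le_sum fun i _ => h1 i
    _ = _ := by simp; ring

/-- The Gram matrix of the `Y i` has the same norm as `∑ i, Y i (Y i)ᵀ`. -/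
lemma opNorm_gram_le {n R : ℕ} {Y : Fin n → Fin R → ℝ} {u : ℝ} (hu : 0 ≤ u)
    (h : (u • (1 : Matrix (Fin R) (Fin R) ℝ) - ∑ i, vecMulVec (Y i) (Y i)).PosDef) :
    opNorm (Matrix.of fun i j => Y i ⬝ᵥ Y j) ≤ u := by
  have hS : ∀ v : Fin R → ℝ, ∑ i, (Y i ⬝ᵥ v) * (Y i ⬝ᵥ v) ≤ u * (v ⬝ᵥ v) := fun v => by
    have := h.posSemidef.dotProduct_mulVec_nonneg v
    rw [star_trivial, sub_mulVec, smul_mulVec, one_mulVec, dotProduct_sub, dotProduct_smul,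
      sum_mulVec, dotProduct_sum] at this
    have h2 : ∀ i, v ⬝ᵥ vecMulVec (Y i) (Y i) *ᵥ v = (Y i ⬝ᵥ v) * (Y i ⬝ᵥ v) := fun i => by
      rw [vecMulVec_mulVec, dotProduct_smul, dotProduct_comm v]
      simp
    simp only [h2, smul_eq_mul] at this
    linarith
  refine opNorm_le_of_forall hu fun x => ?_
  set A : Matrix (Fin n) (Fin n) ℝ := Matrix.of fun i j => Y i ⬝ᵥ Y j
  set v : Fin R → ℝ := ∑ i, x i • Y i
  have hAx : ∀ i, (A *ᵥ x) i = Y i ⬝ᵥ v := fun i => by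
    simp only [A, v, mulVec, dotProduct_sum, dotProduct_smul, of_apply]
    exact Finset.sum_congr rfl fun j _ => mul_comm _ _
  have h1 : (A *ᵥ x) ⬝ᵥ (A *ᵥ x) ≤ u * (v ⬝ᵥ v) := by
    refine le_of_eq_of_le (Finset.sum_congr rfl fun i _ => ?_) (hS v)
    rw [hAx]
  have h3 : v ⬝ᵥ v = x ⬝ᵥ (A *ᵥ x) := by
    conv_lhs => rw [show v = ∑ i, x i • Y i from rfl]
    rw [sum_dotProduct]
    simp only [smul_dotProduct, smul_eq_mul]
    exact Finset.sum_congr rfl fun i _ => by rw [hAx]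
  have h4 : (x ⬝ᵥ (A *ᵥ x)) ^ 2 ≤ (x ⬝ᵥ x) * ((A *ᵥ x) ⬝ᵥ (A *ᵥ x)) := by
    have := Finset.sum_mul_sq_le_sq_mul_sq Finset.univ x (A *ᵥ x)
    simpa [dotProduct, pow_two] using this
  have hx : 0 ≤ x ⬝ᵥ x := by
    simpa [dotProduct] using Finset.sum_nonneg fun i _ => mul_self_nonneg (x i)
  have ha : 0 ≤ (A *ᵥ x) ⬝ᵥ (A *ᵥ x) := by
    simpa [dotProduct] using Finset.sum_nonneg fun i _ => mul_self_nonneg ((A *ᵥ x) i)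
  rw [h3] at h1
  rcases ha.eq_or_lt with h0 | h0
  · rw [← h0]; positivity
  · refine le_of_mul_le_mul_right ?_ h0
    calc _ = ((A *ᵥ x) ⬝ᵥ (A *ᵥ x)) ^ 2 := by ring
      _ ≤ (u * (x ⬝ᵥ (A *ᵥ x))) ^ 2 := by gcongr
      _ = u ^ 2 * (x ⬝ᵥ (A *ᵥ x)) ^ 2 := by ring
      _ ≤ u ^ 2 * ((x ⬝ᵥ x) * ((A *ᵥ x) ⬝ᵥ (A *ᵥ x))) := by gcongr
      _ = _ := by ring

lemma barrier_eight_zero_le {R m : ℕ} {θ κ : ℝ} (hR : 0 < R) :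
    barrier m θ κ 8 (0 : Matrix (Fin R) (Fin R) ℝ) ≤
      ENNReal.ofReal (Real.exp (θ * ((1 / 8) ^ m - κ))) := by
  have hR' : (R : ℝ) ≠ 0 := by exact_mod_cast hR.ne'
  have h1 : ((8 : ℝ) • (1 : Matrix (Fin R) (Fin R) ℝ))⁻¹ = (1 / 8 : ℝ) • 1 := by
    refine inv_eq_right_inv ?_
    rw [smul_mul_smul_comm]
    norm_num
  rw [barrier_of_posDef (by rw [sub_zero]; exact PosDef.one.smul (by norm_num)), sub_zero, h1,
    smul_pow, one_pow, trace_smul, trace_one, Fintype.card_fin, smul_eq_mul, mul_div_assoc,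
    div_self hR', mul_one]
  exact min_le_right _ _

variable {d R : ℕ} {σ : Measure (EuclideanSpace ℝ (Fin d))} {K : Polynomial ℝ}
  {y : EuclideanSpace ℝ (Fin d) → Fin R → ℝ}

lemma IsFeature.measure_opNorm_le {m : ℕ} {θ κ α η δ C : ℝ} {r : ℕ}
    (hσ : IsSphereLaw σ) (hy : IsFeature σ K y) (hK : K.eval 1 = 1)
    (hC : ∀ a : ℝ, |a| ≤ 1 → 1 - K.eval a ≤ C * (1 - a))
    (hr : 2 ≤ r) (hη : 0 < η) (hα0 : 0 < α)
    (hR : 0 < R) (hm : m ≠ 0) (hθ : 0 ≤ θ) (hκ : κ = (1 / 4) ^ m)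
    (hδ : δ = 2 * 2 ^ (m + 1) / (m * R)) (hα : α * η ≤ 1 / 4)
    (hbnd : θ * 2 ^ (m + 1) * (α * κ + α ^ (m + 1) * η) ≤ R) (hRα : R * κ ≤ α ^ m) (n : ℕ) :
    Measure.pi (fun _ : Fin n => σ)
      {w | 8 + n * δ < opNorm (Matrix.of fun i j => K.eval (inner ℝ (w i) (w j)))} ≤
      ENNReal.ofReal (Real.exp (θ * ((1 / 8) ^ m - κ))) +
      n * (2 * ENNReal.ofReal ((12 * √C * (gaussMoment r).toReal / (√d * η)) ^ r)) := by
  have := hσ.prob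
  have hδ0 : 0 ≤ δ := by rw [hδ]; positivity
  set s := {w : Fin n → EuclideanSpace ℝ (Fin d) |
    8 + n * δ < opNorm (Matrix.of fun i j => y (w i) ⬝ᵥ y (w j))}
  have hs : MeasurableSet s := by
    refine IsOpen.measurableSet (isOpen_lt continuous_const (continuous_opNorm.comp ?_))
    refine continuous_matrix fun i j => ?_
    exact (hy.continuous.comp (continuous_apply i)).dotProduct
      (hy.continuous.comp (continuous_apply j))
  have hae : ∀ᵐ w ∂Measure.pi (fun _ : Fin n => σ), ∀ i, ‖w i‖ = 1 :=
    ae_all_iff.2 fun i => (measurePreserving_eval (fun _ : Fin n => σ) i).quasiMeasurePreserving.ae hσ.norm_eq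
  have h1 : Measure.pi (fun _ : Fin n => σ)
      {w | 8 + n * δ < opNorm (Matrix.of fun i j => K.eval (inner ℝ (w i) (w j)))} ≤
      Measure.pi (fun _ : Fin n => σ) s := by
    refine measure_mono_ae (hae.mono fun w hw hws => ?_)
    have : (Matrix.of fun i j => y (w i) ⬝ᵥ y (w j)) =
        Matrix.of fun i j => K.eval (inner ℝ (w i) (w j)) := by
      ext i j
      exact hy.dotProduct_eq _ _ (hw i) (hw j)
    change 8 + n * δ < _
    rw [this]
    exact hws
  refine h1.trans ?_
  have h2 := lintegral_pi_barrier_le hσ hy hK hC hr hη hα0 hR hm hθ hκ hδ hα hbnd hRα n 8 0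
  refine le_trans ?_ (h2.trans (add_le_add (barrier_eight_zero_le hR) le_rfl))
  rw [← lintegral_indicator_one hs]
  refine lintegral_mono fun w => ?_
  by_cases hw : w ∈ s
  · rw [Set.indicator_of_mem hw, barrier_of_not_posDef]
    · rfl
    · rw [zero_add]
      exact fun hpd => (not_le.2 hw) (opNorm_gram_le (by positivity) hpd)
  · rw [Set.indicator_of_notMem hw]
    exact zero_le

end OperatorNorm

section Asymptotics

lemma eventually_barrier_bound {m : ℕ} (hm : 4 ≤ m) {b κ C : ℝ} (hb : 0 ≤ b) (hκ : 0 ≤ κ)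
    (hC : 0 < C) :
    ∀ᶠ x : ℝ in atTop, x ^ 2 * 2 ^ (m + 1) * (b * x * κ + (b * x) ^ (m + 1) * (x ^ 4)⁻¹) ≤
      x ^ m / C := by
  obtain ⟨l, rfl⟩ : ∃ l, m = l + 1 := ⟨m - 1, by omega⟩
  filter_upwards [eventually_ge_atTop 1,
    eventually_ge_atTop (2 ^ (l + 2) * (b * κ + b ^ (l + 2)) * C)] with x hx1 hx2
  have hx0 : 0 < x := by linarith
  have h1 : x ^ 3 ≤ x ^ l := pow_le_pow_right₀ hx1 (by omega)
  calc x ^ 2 * 2 ^ (l + 1 + 1) * (b * x * κ + (b * x) ^ (l + 1 + 1) * (x ^ 4)⁻¹) =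
      2 ^ (l + 2) * (b * κ * x ^ 3 + b ^ (l + 2) * x ^ l) := by
        rw [mul_pow, show l + 1 + 1 = l + 2 by ring, pow_add x l 2]
        field_simp
    _ ≤ 2 ^ (l + 2) * (b * κ * x ^ l + b ^ (l + 2) * x ^ l) := by gcongr
    _ = 2 ^ (l + 2) * (b * κ + b ^ (l + 2)) * x ^ l := by ring
    _ ≤ x / C * x ^ l := by
        gcongr
        rw [le_div_iff₀ hC]
        exact hx2
    _ = x ^ (l + 1) / C := by ring

lemma eventually_exp_add_le (m a : ℕ) {ν M c : ℝ} (hν : 0 < ν) :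
    ∀ᶠ x : ℝ in atTop, Real.exp (x ^ 2 * (-ν)) +
      M * x ^ m * (2 * (c / x ^ 4) ^ (m + a + 2)) ≤ (x ^ a)⁻¹ := by
  have h1 : Tendsto (fun x : ℝ => x ^ (a : ℝ) * Real.exp (-ν * x)) atTop (𝓝 0) :=
    tendsto_rpow_mul_exp_neg_mul_atTop_nhds_zero a ν hν
  have h2 := h1.comp (tendsto_pow_atTop (α := ℝ) two_ne_zero)
  filter_upwards [eventually_ge_atTop 1, eventually_ge_atTop (4 * M * c ^ (m + a + 2)),
    h2.eventually (eventually_le_nhds (show (0 : ℝ) < 1 / 2 by norm_num))] with x hx1 hx2 hx3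
  have hx0 : 0 < x := by linarith
  rw [← one_div, le_div_iff₀ (by positivity), add_mul]
  have h3 : Real.exp (x ^ 2 * (-ν)) * x ^ a ≤ 1 / 2 := by
    refine le_trans ?_ hx3
    simp only [Function.comp, Real.rpow_natCast]
    rw [mul_comm, mul_comm (x ^ 2) (-ν)]
    gcongr
    exact le_self_pow₀ hx1 two_ne_zero
  have h4 : M * x ^ m * (2 * (c / x ^ 4) ^ (m + a + 2)) * x ^ a ≤ 1 / 2 := by
    rw [div_pow, ← pow_mul]
    calc M * x ^ m * (2 * (c ^ (m + a + 2) / x ^ (4 * (m + a + 2)))) * x ^ a =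
        (4 * M * c ^ (m + a + 2)) * (x ^ (m + a) / x ^ (4 * (m + a + 2))) / 2 := by ring
      _ ≤ x * (x ^ (m + a) / x ^ (4 * (m + a + 2))) / 2 := by gcongr
      _ = (x ^ (m + a + 1) / x ^ (4 * (m + a + 2))) / 2 := by ring
      _ ≤ 1 / 2 := by
        gcongr
        rw [div_le_one (by positivity)]
        exact pow_le_pow_right₀ hx1 (by omega)
  linarith

end Asymptotics

section GramTail

lemma dotp_eq_inner {d : ℕ} (u v : EuclideanSpace ℝ (Fin d)) : dotp u v = inner ℝ u v := by
  simp only [dotp, PiLp.inner_apply, RCLike.inner_apply, conj_trivial]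
  exact Finset.sum_congr rfl fun i _ => mul_comm _ _

lemma QWmat_eq_smul {d k : ℕ} (hk : 1 ≤ k) (hd : 2 ≤ d) {q : Polynomial ℝ}
    (hq : IsGegenbauer d k q) :
    ∃ (K : Polynomial ℝ) (N : ℝ), IsReproducing (sphereUniform d 1) k K N ∧
      (∀ a, |q.eval (√d * a)| = √N * |K.eval a|) ∧
      ∀ n Nk w, opNorm (QWmat d n q Nk w) =
        √N / √Nk * opNorm (Matrix.of fun i j => K.eval (inner ℝ (w i) (w j))) := by
  have hσ := hq.isSphereLaw hk
  obtain ⟨hs, hK⟩ := (hq.isZonal hk).isReproducing hσ hd hk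
  set s := (q.comp (Polynomial.C √(d : ℝ) * Polynomial.X)).eval 1
  have hev : ∀ a, q.eval (√d * a) = s * (Polynomial.C s⁻¹ *
      q.comp (Polynomial.C √(d : ℝ) * Polynomial.X)).eval a := fun a => by
    simp only [Polynomial.eval_mul, Polynomial.eval_C, Polynomial.eval_comp, Polynomial.eval_X]
    rw [mul_inv_cancel_left₀ hs]
  refine ⟨_, _, hK, fun a => ?_, fun n Nk w => ?_⟩
  · rw [hev, abs_mul, Real.sqrt_sq_eq_abs]
  · have h1 : QWmat d n q Nk w = (s / √Nk) • Matrix.of fun i j => (Polynomial.C s⁻¹ *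
        q.comp (Polynomial.C √(d : ℝ) * Polynomial.X)).eval (inner ℝ (w i) (w j)) := by
      ext i j
      rw [QWmat, Matrix.of_apply, Matrix.smul_apply, Matrix.of_apply, dotp_eq_inner, hev,
        smul_eq_mul]
      ring
    rw [h1, opNorm_smul, abs_div, Real.sqrt_sq_eq_abs, abs_of_nonneg (Real.sqrt_nonneg (Nk : ℝ))]

lemma exists_measure_opNorm_le {k : ℕ} (hk : 1 ≤ k) {M : ℝ} (hM : 0 ≤ M) :
    ∃ C : ℝ, 0 < C ∧ ∀ D : ℕ, ∀ᶠ d : ℕ in atTop, ∀ n : ℕ, (n : ℝ) ≤ M * (d : ℝ) ^ k →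
      ∀ q, IsGegenbauer d k q →
        Wmeas d n {w | C ≤ opNorm (QWmat d n q (sphDim d k) w)} ≤
          ENNReal.ofReal (((d : ℝ) ^ D)⁻¹) := by
  obtain ⟨C₁, hC₁, hdim⟩ := exists_pow_le_sphDim k hk
  obtain ⟨C₂, hC₂, hrep⟩ := IsReproducing.exists_bounds k hk
  have hC₂0 : 0 < C₂ := by linarith
  set m := 16 * k with hm
  have hm' : (0 : ℝ) < m := by rw [hm]; positivity
  set B := 8 + M * C₂ * (2 * 2 ^ (m + 1) / m) with hB
  have hB0 : 0 < B := by positivity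
  refine ⟨√((k + 1) * C₁) * B + 1, by positivity, fun D => ?_⟩
  set x : ℕ → ℝ := fun d => (d : ℝ) ^ (1 / 16 : ℝ) with hx
  have hxlim : Tendsto x atTop atTop :=
    (tendsto_rpow_atTop (by norm_num)).comp tendsto_natCast_atTop_atTop
  have hν : (0 : ℝ) < (1 / 4) ^ m - (1 / 8) ^ m := by
    rw [sub_pos]
    exact pow_lt_pow_left₀ (by norm_num) (by norm_num) (by omega)
  have e1 := eventually_barrier_bound (m := m) (by omega) (b := (k + 1) / 4) (κ := (1 / 4) ^ m)
    (C := C₂) (by positivity) (by positivity) hC₂0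
  have e2 := eventually_exp_add_le m (16 * D) (M := M)
    (c := 12 * √C₂ * (gaussMoment ((m + 16 * D + 2 : ℕ))).toReal) hν
  filter_upwards [hdim, hxlim.eventually e1, hxlim.eventually e2, eventually_ge_atTop 2,
    hxlim.eventually (eventually_ge_atTop 1),
    hxlim.eventually (eventually_ge_atTop ((k : ℝ) + 1))] with d hd1 hd2 hd3 hd hx1 hxk n hn q hq
  have hd0 : (0 : ℝ) < d := by exact_mod_cast (by omega : 0 < d)
  have hσ := hq.isSphereLaw hk
  obtain ⟨K, N, hK, -, hQ⟩ := QWmat_eq_smul hk hd hq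
  obtain ⟨hN, h1K⟩ := hrep d _ K N hd hσ hK
  obtain ⟨R, hRN, hRle, y, hy⟩ := hK.exists_isFeature hσ
  have hNpos := hK.pos
  have hR : 0 < R := by
    rw [← hRN] at hNpos
    exact_mod_cast hNpos
  have hx0 : 0 < x d := by linarith
  have hx16 : x d ^ 16 = d := by
    rw [hx, ← Real.rpow_natCast, ← Real.rpow_mul hd0.le]
    norm_num
  have hxm : x d ^ m = (d : ℝ) ^ k := by rw [hm, pow_mul, hx16]
  have hsq : √(d : ℝ) = x d ^ 8 := by
    rw [← hx16, show x d ^ 16 = (x d ^ 8) ^ 2 by ring, Real.sqrt_sq (by positivity)]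
  have hRle' : (R : ℝ) ≤ (k + 1) * (d : ℝ) ^ k := by exact_mod_cast hRle
  have hRge : x d ^ m / C₂ ≤ R := by
    rw [div_le_iff₀ hC₂0, hxm, hRN]
    linarith
  have hmain := hy.measure_opNorm_le (m := m) (θ := x d ^ 2) (κ := (1 / 4) ^ m)
    (α := (k + 1) / 4 * x d) (η := (x d ^ 4)⁻¹) (r := m + 16 * D + 2) hσ hK.eval_one h1K
    (by omega) (by positivity) (by positivity) hR (by omega) (by positivity) rfl rfl
    (by
      rw [← div_eq_mul_inv, div_le_iff₀ (by positivity)]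
      have : x d ≤ x d ^ 3 := le_self_pow₀ hx1 (by norm_num)
      nlinarith)
    (hd2.trans hRge)
    (by
      have h1 : ((k : ℝ) + 1) ≤ ((k : ℝ) + 1) ^ m :=
        le_self_pow₀ (by linarith [k.cast_nonneg (α := ℝ)]) (by omega)
      calc (R : ℝ) * (1 / 4) ^ m ≤ ((k + 1) ^ m * (d : ℝ) ^ k) * (1 / 4) ^ m := by
            gcongr
            exact hRle'.trans (by gcongr)
        _ = ((k + 1) / 4 * x d) ^ m := by
            rw [mul_pow, hxm, div_eq_mul_one_div ((k : ℝ) + 1), mul_pow]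
            ring) n
  set ε := (12 * √C₂ * (gaussMoment ((m + 16 * D + 2 : ℕ))).toReal / (√d * (x d ^ 4)⁻¹)) ^
    (m + 16 * D + 2) with hε
  have hε' : ε = (12 * √C₂ * (gaussMoment ((m + 16 * D + 2 : ℕ))).toReal / x d ^ 4) ^
      (m + 16 * D + 2) := by
    rw [hε, hsq]
    congr 2
    field_simp
  have hε0 : 0 ≤ ε := by positivity
  calc _ ≤ Measure.pi (fun _ : Fin n => sphereUniform d 1)
        {w | 8 + n * (2 * 2 ^ (m + 1) / (m * R)) <
          opNorm (Matrix.of fun i j => K.eval (inner ℝ (w i) (w j)))} := by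
        refine measure_mono fun w hw => ?_
        change _ ≤ opNorm _ at hw
        change _ < opNorm _
        rw [hQ] at hw
        have h1 : √N / √(sphDim d k) ≤ √((k + 1) * C₁) := by
          rw [← Real.sqrt_div hNpos.le]
          refine Real.sqrt_le_sqrt (div_le_of_le_mul₀ (by positivity) (by positivity) ?_)
          rw [← hRN]
          calc (R : ℝ) ≤ (k + 1) * (d : ℝ) ^ k := hRle'
            _ ≤ (k + 1) * (C₁ * sphDim d k) := by gcongr
            _ = _ := by ring
        have h2 : 8 + n * (2 * 2 ^ (m + 1) / (m * R)) ≤ B := by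
          rw [hB]
          gcongr 8 + ?_
          calc n * (2 * 2 ^ (m + 1) / (m * R)) ≤
              (M * C₂ * R) * (2 * 2 ^ (m + 1) / (m * R)) := by
                gcongr
                refine hn.trans ?_
                rw [mul_assoc, hRN]
                gcongr
            _ = _ := by
                have : (R : ℝ) ≠ 0 := by positivity
                field_simp
        refine lt_of_le_of_lt h2 (lt_of_not_ge fun h3 => ?_)
        have h4 := mul_le_mul h1 h3 (opNorm_nonneg _) (Real.sqrt_nonneg _)
        linarith
    _ ≤ _ := hmain
    _ = ENNReal.ofReal (Real.exp (x d ^ 2 * ((1 / 8) ^ m - (1 / 4) ^ m)) + n * (2 * ε)) := by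
        rw [ENNReal.ofReal_add (by positivity) (by positivity),
          ENNReal.ofReal_mul (p := (n : ℝ)) (by positivity),
          ENNReal.ofReal_mul (p := (2 : ℝ)) (by positivity), ENNReal.ofReal_natCast]
        simp
    _ ≤ _ := by
        refine ENNReal.ofReal_le_ofReal ?_
        have h5 : x d ^ (16 * D) = (d : ℝ) ^ D := by rw [pow_mul, hx16]
        rw [← h5]
        refine le_trans ?_ hd3
        rw [neg_sub, hxm, ← hε']
        gcongr

end GramTail

section Transfer

variable {d k : ℕ} {q : Polynomial ℝ}

lemma continuous_opNorm_QXmat (d n : ℕ) (q : Polynomial ℝ) (Nk : ℕ) :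
    Continuous fun x => opNorm (QXmat d n q Nk x) := by
  refine continuous_opNorm.comp (continuous_matrix fun i j => ?_)
  simp only [QXmat, Matrix.of_apply, dotp]
  fun_prop

lemma Xmeas_eq_map (hk : 1 ≤ k) (hq : IsGegenbauer d k q) (n : ℕ) :
    Xmeas d n = (Wmeas d n).map fun w i => √(d : ℝ) • w i := by
  have := (hq.isSphereLaw hk).prob
  have hm : Measurable fun x : EuclideanSpace ℝ (Fin d) => √(d : ℝ) • x := by fun_prop
  have := Measure.isProbabilityMeasure_map (μ := sphereUniform d 1) hm.aemeasurable
  rw [Wmeas, Measure.pi_map_pi (f := fun _ x => √(d : ℝ) • x) fun _ => hm.aemeasurable, Xmeas,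
    sphereUniform_eq_map (hq.dim_pos hk)]

lemma QXmat_smul (hd : 0 < d) (n Nk : ℕ) (w : Fin n → EuclideanSpace ℝ (Fin d)) :
    QXmat d n q Nk (fun i => √(d : ℝ) • w i) = QWmat d n q Nk w := by
  ext i j
  have hd' : (0 : ℝ) < √d := by positivity
  rw [QXmat, QWmat, Matrix.of_apply, Matrix.of_apply, dotp_eq_inner, dotp_eq_inner,
    real_inner_smul_left, real_inner_smul_right, mul_div_assoc, mul_div_cancel_left₀ _ hd'.ne']

lemma Xmeas_opNorm_ge (hk : 1 ≤ k) (hq : IsGegenbauer d k q) (n Nk : ℕ) (a : ℝ) :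
    Xmeas d n {x | a ≤ opNorm (QXmat d n q Nk x)} =
      Wmeas d n {w | a ≤ opNorm (QWmat d n q Nk w)} := by
  rw [Xmeas_eq_map hk hq, Measure.map_apply (by fun_prop)
    (isClosed_le continuous_const (continuous_opNorm_QXmat d n q Nk)).measurableSet]
  simp only [Set.preimage_ofPred_eq, QXmat_smul (hq.dim_pos hk)]

lemma lintegral_Xmeas_opNorm (hk : 1 ≤ k) (hq : IsGegenbauer d k q) (n Nk : ℕ) (r : ℝ) :
    ∫⁻ x, ENNReal.ofReal (opNorm (QXmat d n q Nk x) ^ r) ∂Xmeas d n =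
      ∫⁻ w, ENNReal.ofReal (opNorm (QWmat d n q Nk w) ^ r) ∂Wmeas d n := by
  rw [Xmeas_eq_map hk hq, lintegral_map
    ((continuous_opNorm_QXmat d n q Nk).measurable.pow_const r).ennreal_ofReal (by fun_prop)]
  simp only [QXmat_smul (hq.dim_pos hk)]

lemma abs_eval_one_dim_le {σ : Measure (EuclideanSpace ℝ (Fin 1))} (hσ : IsSphereLaw σ)
    {p : Polynomial ℝ} (hp : IsZonal σ k p) {u v : EuclideanSpace ℝ (Fin 1)} (hu : ‖u‖ = 1)
    (hv : ‖v‖ = 1) : |p.eval (inner ℝ u v)| ≤ 2 := by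
  have := hσ.prob
  have h1 := hp.integral_sq u hu
  have h2 : ∫ z, p.eval (inner ℝ u (-z)) ^ 2 ∂σ = 1 := by
    rw [← h1]
    exact hσ.integral_comp (LinearIsometryEquiv.neg ℝ) fun z => p.eval (inner ℝ u z) ^ 2
  have hpm : ∀ z : EuclideanSpace ℝ (Fin 1), ‖z‖ = 1 → z = v ∨ z = -v := by
    have hn : ∀ z : EuclideanSpace ℝ (Fin 1), ‖z‖ = 1 → z 0 ^ 2 = 1 := fun z hz => by
      have := EuclideanSpace.real_norm_sq_eq z
      rw [hz] at this
      simpa using this.symm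
    intro z hz
    rcases sq_eq_sq_iff_eq_or_eq_neg.1 ((hn z hz).trans (hn v hv).symm) with h | h
    · left; ext i; fin_cases i; exact h
    · right; ext i; fin_cases i; exact h
  have h3 : ∫ z, (p.eval (inner ℝ u z) ^ 2 + p.eval (inner ℝ u (-z)) ^ 2) ∂σ = 2 := by
    rw [integral_add (hσ.integrable (by fun_prop)) (hσ.integrable (by fun_prop)), h1, h2]
    norm_num
  have h4 : ∫ z, (p.eval (inner ℝ u z) ^ 2 + p.eval (inner ℝ u (-z)) ^ 2) ∂σ =
      ∫ _z, (p.eval (inner ℝ u v) ^ 2 + p.eval (inner ℝ u (-v)) ^ 2) ∂σ := by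
    refine integral_congr_ae (hσ.norm_eq.mono fun z hz => ?_)
    rcases hpm z hz with rfl | rfl
    · rfl
    · simp only [neg_neg]
      ring
  rw [h4, integral_const] at h3
  simp only [probReal_univ, one_smul] at h3
  refine abs_le_of_sq_le_sq ?_ two_pos.le
  nlinarith [sq_nonneg (p.eval (inner ℝ u (-v)))]

lemma abs_eval_sqrt_mul_inner_le (hk : 1 ≤ k) (hq : IsGegenbauer d k q)
    {u v : EuclideanSpace ℝ (Fin d)} (hu : ‖u‖ = 1) (hv : ‖v‖ = 1) :
    |q.eval (√d * inner ℝ u v)| ≤ 2 * (k + 1) * (d : ℝ) ^ k := by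
  have hd := hq.dim_pos hk
  have hσ := hq.isSphereLaw hk
  have hd1 : (1 : ℝ) ≤ d := by exact_mod_cast hd
  have hdk : (1 : ℝ) ≤ (d : ℝ) ^ k := one_le_pow₀ hd1
  have hk0 : (0 : ℝ) ≤ k := k.cast_nonneg
  rcases Nat.lt_or_ge d 2 with h | h
  · obtain rfl : d = 1 := by omega
    have := abs_eval_one_dim_le hσ (hq.isZonal hk) hu hv
    simp only [Polynomial.eval_comp, Polynomial.eval_mul, Polynomial.eval_C,
      Polynomial.eval_X] at this
    refine this.trans ?_
    norm_num
  · obtain ⟨K, N, hK, hev, -⟩ := QWmat_eq_smul hk h hq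
    obtain ⟨R, hRN, hRle, -⟩ := hK.exists_isFeature hσ
    have hRle' : (R : ℝ) ≤ (k + 1) * (d : ℝ) ^ k := by exact_mod_cast hRle
    have h1 : |(inner ℝ u v : ℝ)| ≤ 1 := by
      simpa [hu, hv] using abs_real_inner_le_norm u v
    have h2 : (1 : ℝ) ≤ (k + 1) * (d : ℝ) ^ k := by nlinarith
    rw [hev]
    calc √N * |K.eval (inner ℝ u v)| ≤ √N * 1 := by
          gcongr
          exact hK.abs_eval_le hσ h h1
      _ ≤ (k + 1) * (d : ℝ) ^ k := by
          rw [mul_one, ← hRN]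
          refine (Real.sqrt_le_sqrt hRle').trans ?_
          exact (Real.sqrt_le_left (by linarith)).2 (by nlinarith)
      _ ≤ _ := by nlinarith

lemma ae_opNorm_QWmat_le (hk : 1 ≤ k) (hq : IsGegenbauer d k q) (n Nk : ℕ) :
    ∀ᵐ w ∂Wmeas d n, opNorm (QWmat d n q Nk w) ≤ n * (2 * (k + 1) * (d : ℝ) ^ k) := by
  have hσ := hq.isSphereLaw hk
  have := hσ.prob
  have hae : ∀ᵐ w ∂Wmeas d n, ∀ i, ‖w i‖ = 1 := ae_all_iff.2 fun i =>
    (measurePreserving_eval (fun _ : Fin n => sphereUniform d 1) i).quasiMeasurePreserving.ae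
      hσ.norm_eq
  filter_upwards [hae] with w hw
  refine opNorm_le_of_entry_le (by positivity) fun i j => ?_
  have h1 := abs_eval_sqrt_mul_inner_le hk hq (hw i) (hw j)
  rw [QWmat, Matrix.of_apply, dotp_eq_inner, abs_div, abs_of_nonneg (Real.sqrt_nonneg (Nk : ℝ))]
  rcases Nat.eq_zero_or_pos Nk with rfl | h
  · simp only [CharP.cast_eq_zero, Real.sqrt_zero, div_zero]
    positivity
  · refine (div_le_self (abs_nonneg _) ?_).trans h1
    rw [Real.one_le_sqrt]
    exact_mod_cast h

end Transfer

section Conclusion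

variable {k : ℕ}

lemma exists_Wmeas_opNorm_tail (hk : 1 ≤ k) {n : ℕ → ℕ} {M : ℝ} (hM : 0 ≤ M)
    (hn : ∀ᶠ d : ℕ in atTop, (n d : ℝ) ≤ M * (d : ℝ) ^ k) :
    ∃ C : ℝ, 0 < C ∧ ∀ D : ℝ, 0 < D → ∃ d₀ : ℕ, ∀ d, d₀ ≤ d → ∀ t : ℝ, 0 < t →
      ∀ q : Polynomial ℝ, IsGegenbauer d k q →
        Wmeas d (n d) {w | C + t ≤ opNorm (QWmat d (n d) q (sphDim d k) w)} ≤
          ENNReal.ofReal (((d : ℝ) * t) ^ (-D)) := by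
  obtain ⟨C, hC, hmain⟩ := exists_measure_opNorm_le hk hM
  refine ⟨C, hC, fun D hD => ?_⟩
  obtain ⟨D', hD'⟩ := exists_nat_ge (((2 * k + 2 : ℕ) : ℝ) * D)
  refine eventually_atTop.1 ?_
  filter_upwards [hmain D', hn, eventually_ge_atTop 2,
    tendsto_natCast_atTop_atTop.eventually (eventually_ge_atTop (M * (2 * (k + 1))))]
    with d h1 h2 h3 h4 t ht q hq
  have hd : (1 : ℝ) ≤ d := by exact_mod_cast (by omega : 1 ≤ d)
  have hd0 : (0 : ℝ) < d := by linarith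
  rcases lt_or_ge ((d : ℝ) ^ (2 * k + 1)) t with h5 | h5
  · refine le_of_eq_of_le ?_ zero_le
    refine measure_mono_null (t := {w | ¬ opNorm (QWmat d (n d) q (sphDim d k) w) ≤
      n d * (2 * (k + 1) * (d : ℝ) ^ k)}) (fun w hw => ?_) (ae_iff.1 (ae_opNorm_QWmat_le hk hq _ _))
    have hw' : C + t ≤ opNorm (QWmat d (n d) q (sphDim d k) w) := hw
    refine not_le.2 (lt_of_lt_of_le ?_ hw')
    calc n d * (2 * (k + 1) * (d : ℝ) ^ k) ≤ M * (d : ℝ) ^ k * (2 * (k + 1) * (d : ℝ) ^ k) := by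
          gcongr
      _ = M * (2 * (k + 1)) * (d : ℝ) ^ (2 * k) := by ring
      _ ≤ d * (d : ℝ) ^ (2 * k) := by gcongr
      _ = (d : ℝ) ^ (2 * k + 1) := by ring
      _ < C + t := by linarith
  · refine (measure_mono fun w hw => ?_).trans ((h1 (n d) h2 q hq).trans
      (ENNReal.ofReal_le_ofReal ?_))
    · exact le_trans (by linarith) (show C + t ≤ opNorm (QWmat d (n d) q (sphDim d k) w) from hw)
    · rw [Real.rpow_neg (by positivity)]
      refine inv_anti₀ (by positivity) ?_
      calc ((d : ℝ) * t) ^ D ≤ ((d : ℝ) ^ (2 * k + 2)) ^ D := by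
            gcongr
            calc (d : ℝ) * t ≤ d * (d : ℝ) ^ (2 * k + 1) := by gcongr
              _ = _ := by ring
        _ = (d : ℝ) ^ (((2 * k + 2 : ℕ) : ℝ) * D) := by
            rw [← Real.rpow_natCast, ← Real.rpow_mul hd0.le]
        _ ≤ (d : ℝ) ^ (D' : ℝ) := Real.rpow_le_rpow_of_exponent_le hd hD'
        _ = (d : ℝ) ^ D' := Real.rpow_natCast _ _

lemma exists_Wmeas_opNorm_moment (hk : 1 ≤ k) {n : ℕ → ℕ} {M : ℝ} (hM : 0 ≤ M)
    (hn : ∀ᶠ d : ℕ in atTop, (n d : ℝ) ≤ M * (d : ℝ) ^ k) {r : ℝ} (hr : 0 < r) :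
    ∃ K : ℝ, 0 < K ∧ ∀ d : ℕ, ∀ q : Polynomial ℝ, IsGegenbauer d k q →
      ∫⁻ w, ENNReal.ofReal (opNorm (QWmat d (n d) q (sphDim d k) w) ^ r) ∂Wmeas d (n d) ≤
        ENNReal.ofReal K := by
  obtain ⟨C, hC, hmain⟩ := exists_measure_opNorm_le hk hM
  obtain ⟨D, hD⟩ := exists_nat_ge (((2 * k : ℕ) : ℝ) * r)
  obtain ⟨d₀, hd₀⟩ := eventually_atTop.1 ((hmain D).and (hn.and (eventually_ge_atTop 1)))
  set L : ℕ → ℝ := fun d => n d * (2 * (k + 1) * (d : ℝ) ^ k) with hL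
  have hL0 : ∀ d, 0 ≤ L d := fun d => by positivity
  set B := M * (2 * (k + 1)) with hB
  have hB0 : 0 ≤ B := by positivity
  have hsum : 0 ≤ ∑ d ∈ Finset.range d₀, L d ^ r :=
    Finset.sum_nonneg fun d _ => Real.rpow_nonneg (hL0 d) r
  have hCr : 0 < C ^ r := Real.rpow_pos_of_pos hC r
  have hBr : 0 ≤ B ^ r := Real.rpow_nonneg hB0 r
  refine ⟨C ^ r + B ^ r + ∑ d ∈ Finset.range d₀, L d ^ r, by positivity, fun d q hq => ?_⟩
  have := (hq.isSphereLaw hk).prob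
  have : IsProbabilityMeasure (Wmeas d (n d)) := by unfold Wmeas; infer_instance
  have hae := ae_opNorm_QWmat_le hk hq (n d) (sphDim d k)
  rcases lt_or_ge d d₀ with h | h
  · calc ∫⁻ w, ENNReal.ofReal (opNorm (QWmat d (n d) q (sphDim d k) w) ^ r) ∂Wmeas d (n d) ≤
        ∫⁻ _w, ENNReal.ofReal (L d ^ r) ∂Wmeas d (n d) := by
          refine lintegral_mono_ae (hae.mono fun w hw => ENNReal.ofReal_le_ofReal ?_)
          exact Real.rpow_le_rpow (opNorm_nonneg _) hw hr.le
      _ = ENNReal.ofReal (L d ^ r) := by simp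
      _ ≤ _ := by
          refine ENNReal.ofReal_le_ofReal ?_
          have := Finset.single_le_sum (f := fun d => L d ^ r)
            (fun d _ => Real.rpow_nonneg (hL0 d) r) (Finset.mem_range.2 h)
          linarith
  · obtain ⟨h1, h2, h3⟩ := hd₀ d h
    have hd : (1 : ℝ) ≤ d := by exact_mod_cast h3
    have hd0 : (0 : ℝ) < d := by linarith
    set s := {w | C ≤ opNorm (QWmat d (n d) q (sphDim d k) w)}
    have hLr : L d ^ r ≤ B ^ r * (d : ℝ) ^ D := by
      calc L d ^ r ≤ (B * (d : ℝ) ^ (2 * k)) ^ r := by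
            refine Real.rpow_le_rpow (hL0 d) ?_ hr.le
            calc L d ≤ M * (d : ℝ) ^ k * (2 * (k + 1) * (d : ℝ) ^ k) := by
                  simp only [hL]; gcongr
              _ = _ := by rw [hB]; ring
        _ = B ^ r * (d : ℝ) ^ (((2 * k : ℕ) : ℝ) * r) := by
            rw [Real.mul_rpow hB0 (by positivity), ← Real.rpow_natCast, ← Real.rpow_mul hd0.le]
        _ ≤ B ^ r * (d : ℝ) ^ (D : ℝ) := by
            gcongr
        _ = _ := by rw [Real.rpow_natCast]
    calc ∫⁻ w, ENNReal.ofReal (opNorm (QWmat d (n d) q (sphDim d k) w) ^ r) ∂Wmeas d (n d) ≤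
        ∫⁻ w, (ENNReal.ofReal (C ^ r) +
          s.indicator (fun _ => ENNReal.ofReal (L d ^ r)) w) ∂Wmeas d (n d) := by
          refine lintegral_mono_ae (hae.mono fun w hw => ?_)
          by_cases hws : w ∈ s
          · rw [Set.indicator_of_mem hws]
            exact le_add_left (ENNReal.ofReal_le_ofReal
              (Real.rpow_le_rpow (opNorm_nonneg _) hw hr.le))
          · refine le_add_right (ENNReal.ofReal_le_ofReal
              (Real.rpow_le_rpow (opNorm_nonneg _) (le_of_lt (not_le.1 hws)) hr.le))
      _ ≤ ENNReal.ofReal (C ^ r) + ENNReal.ofReal (L d ^ r) * Wmeas d (n d) s := by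
          rw [lintegral_add_left measurable_const, lintegral_const, measure_univ, mul_one]
          gcongr
          exact lintegral_indicator_const_le _ _
      _ ≤ ENNReal.ofReal (C ^ r) + ENNReal.ofReal (B ^ r * (d : ℝ) ^ D) *
            ENNReal.ofReal (((d : ℝ) ^ D)⁻¹) := by
          gcongr
          exact h1 (n d) h2 q hq
      _ = ENNReal.ofReal (C ^ r + B ^ r) := by
          rw [← ENNReal.ofReal_mul (by positivity), mul_assoc,
            mul_inv_cancel₀ (by positivity), mul_one, ENNReal.ofReal_add hCr.le hBr]
      _ ≤ _ := ENNReal.ofReal_le_ofReal (by linarith)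

end Conclusion

end GramNorm

/-- If `limsup_d max{p,n}/d^k < ∞`, then the operator norms of `Q_k^W` and `Q_k^X` satisfy a
`(dt)^{-D}` tail bound above a fixed constant `C`, and all their moments are bounded
uniformly in `d`. -/
theorem gegenbauer_gram_opNorm_bounds
    (k : ℕ) (hk : 1 ≤ k)
    (p n : ℕ → ℕ) (hp : ∀ d, 0 < p d) (hn : ∀ d, 0 < n d)
    (hbdd : ∃ M : ℝ, ∀ᶠ d in atTop, (max (p d) (n d) : ℝ) / (d : ℝ) ^ k ≤ M) :
    (∃ C : ℝ, 0 < C ∧ ∀ D : ℝ, 0 < D → ∃ d₀ : ℕ, ∀ d, d₀ ≤ d → ∀ t : ℝ, 0 < t →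
      ∀ q : Polynomial ℝ, IsGegenbauer d k q →
        Wmeas d (p d) {w | C + t ≤ opNorm (QWmat d (p d) q (sphDim d k) w)} ≤
            ENNReal.ofReal (((d : ℝ) * t) ^ (-D)) ∧
        Xmeas d (n d) {x | C + t ≤ opNorm (QXmat d (n d) q (sphDim d k) x)} ≤
            ENNReal.ofReal (((d : ℝ) * t) ^ (-D))) ∧
    (∀ r : ℝ, 0 < r → ∃ K : ℝ, 0 < K ∧ ∀ d : ℕ, ∀ q : Polynomial ℝ, IsGegenbauer d k q →
      (∫⁻ w, ENNReal.ofReal (opNorm (QWmat d (p d) q (sphDim d k) w) ^ r)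
          ∂Wmeas d (p d)) ≤ ENNReal.ofReal K ∧
      (∫⁻ x, ENNReal.ofReal (opNorm (QXmat d (n d) q (sphDim d k) x) ^ r)
          ∂Xmeas d (n d)) ≤ ENNReal.ofReal K) := by
  obtain ⟨M, hM⟩ := hbdd
  have hmax : ∀ᶠ d : ℕ in atTop, (max (p d) (n d) : ℝ) ≤ |M| * (d : ℝ) ^ k := by
    filter_upwards [hM, eventually_gt_atTop 0] with d hd hd0
    have hd' : (0 : ℝ) < (d : ℝ) ^ k := by positivity
    rw [div_le_iff₀ hd'] at hd
    exact hd.trans (mul_le_mul_of_nonneg_right (le_abs_self M) hd'.le)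
  have hp' := hmax.mono fun d hd => (le_max_left _ _).trans hd
  have hn' := hmax.mono fun d hd => (le_max_right _ _).trans hd
  refine ⟨?_, fun r hr => ?_⟩
  · obtain ⟨C₁, hC₁, h₁⟩ := exists_Wmeas_opNorm_tail hk (abs_nonneg M) hp'
    obtain ⟨C₂, hC₂, h₂⟩ := exists_Wmeas_opNorm_tail hk (abs_nonneg M) hn'
    refine ⟨C₁ + C₂, by positivity, fun D hD => ?_⟩
    obtain ⟨a, ha⟩ := h₁ D hD
    obtain ⟨b, hb⟩ := h₂ D hD
    refine ⟨max a b, fun d hd t ht q hq => ⟨?_, ?_⟩⟩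
    · refine (measure_mono fun w hw => ?_).trans (ha d ((le_max_left _ _).trans hd) t ht q hq)
      exact le_trans (by linarith) (show _ ≤ opNorm _ from hw)
    · rw [Xmeas_opNorm_ge hk hq]
      refine (measure_mono fun w hw => ?_).trans (hb d ((le_max_right _ _).trans hd) t ht q hq)
      exact le_trans (by linarith) (show _ ≤ opNorm _ from hw)
  · obtain ⟨K₁, hK₁, h₁⟩ := exists_Wmeas_opNorm_moment hk (abs_nonneg M) hp' hr
    obtain ⟨K₂, hK₂, h₂⟩ := exists_Wmeas_opNorm_moment hk (abs_nonneg M) hn' hr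
    refine ⟨K₁ + K₂, by positivity, fun d q hq => ⟨?_, ?_⟩⟩
    · exact (h₁ d q hq).trans (ENNReal.ofReal_le_ofReal (by linarith))
    · rw [lintegral_Xmeas_opNorm hk hq]
      exact (h₂ d q hq).trans (ENNReal.ofReal_le_ofReal (by linarith))

end
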